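/- Biorthogonality of the Griffiths polynomials of q-Racah type: for all nonnegative integers i, j, k, ℓ with i+j ≤ N and k+ℓ ≤ N, one has Σ_{x,y ≥ 0, x+y ≤ N} [Ω(x;c₁,c₂,c₄;N−y)·Λ(y;c₃,c₀,c₄,c₁;N) / (ξ_x(c₂,c₄)·ξ_y(c₀,c₃)·(c₁/c₀)^{x/2}·(c₄/c₁)^{y/2})]·G_{i,j}(x,y;c₁,c₂,c₃,c₄;N)·G_{k,ℓ}(y,x;c₁,c₃,c₂,c₀;N) = δ_{i,k}·δ_{j,ℓ}·[ω_j(c₂c₀c₄/c₃)·ω_N(qc₁c₂c₃)/ω_i(c₂c₃)]·[Ω(i;c₁,c₂,c₃;N−j)·Λ(j;c₄,c₀,c₃,c₁;N)/(ξ_i(c₂,c₃)·ξ_j(c₀,c₄))]. (For the parameter list (c₁,c₃,c₂,c₀) the induced fifth parameter (q^{2N+3}c₁c₃c₂c₀)^{−1} equals c₄.) -/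

import Mathlib

noncomputable section
namespace qR

/-- q-Pochhammer symbol `(a;q)_k = ∏_{l<k} (1 - a qˡ)`. -/
def poch (q a : ℂ) (k : ℕ) : ℂ := ∏ l ∈ Finset.range k, (1 - a * q ^ l)

/-- q-binomial coefficient, zero outside `0 ≤ n ≤ N`. -/
def binom (q : ℂ) (N n : ℤ) : ℂ :=
  if 0 ≤ n ∧ n ≤ N then poch q q N.toNat / (poch q q n.toNat * poch q q (N - n).toNat) else 0

/-- Normalisation `Ω(n;c1,c2,c3;N)`; `s` and `t2` are the chosen square roots of `q` and `c2`,
so that `(q c2)^(n - N/2) = (s t2)^(2n - N)`. -/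
def Om (q s c1 c2 c3 t2 : ℂ) (N n : ℤ) : ℂ :=
  binom q N n * (1 - c2 * c3 * q ^ (2 * n + 1)) * poch q (q * c2) n.toNat
      * poch q (c1 * c2 * c3 * q ^ (N + 2)) n.toNat * poch q (q * c1) (N - n).toNat
    / ((s * t2) ^ (2 * n - N) * poch q (c2 * c3 * q ^ (n + 1)) (N + 1).toNat
        * poch q (q * c3) n.toNat)

/-- Normalised q-Racah polynomial `p_n(x;c1,c2,c3;N)`, with the convention that it
vanishes unless `0 ≤ n ≤ N` and `0 ≤ x ≤ N`. -/
def p (q s c1 c2 c3 t2 : ℂ) (N n x : ℤ) : ℂ :=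
  if 0 ≤ n ∧ n ≤ N ∧ 0 ≤ x ∧ x ≤ N then
    Om q s c1 c2 c3 t2 N n *
      ∑ k ∈ Finset.range (n.toNat + 1),
        poch q (q ^ (-n)) k * poch q (c2 * c3 * q ^ (n + 1)) k * poch q (q ^ (-x)) k
            * poch q (c1 * c2 * q ^ (x + 1)) k * q ^ k
          / (poch q (q * c2) k * poch q (c1 * c2 * c3 * q ^ (N + 2)) k
              * poch q (q ^ (-N)) k * poch q q k)
  else 0

/-- `ω_n(c) = (-1)^n c^{n/2} q^{n(n+1)/2}`, where `r` is the chosen square root of `c`. -/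
def om (q r : ℂ) (n : ℤ) : ℂ := (-1 : ℂ) ^ n * r ^ n * q ^ (n * (n + 1) / 2)

/-- `ξ_n(c1,c2) = ((qc1;q)_n/(qc2;q)_n) (c2/c1)^{n/2}`, where `t1, t2` are the chosen
square roots of `c1, c2`. -/
def xi (q c1 c2 t1 t2 : ℂ) (n : ℤ) : ℂ :=
  poch q (q * c1) n.toNat / poch q (q * c2) n.toNat * (t2 / t1) ^ n

/-- `λ(x;c) = -(1-q^{-x})(1-c q^{x+1})`. -/
def lam (q c : ℂ) (x : ℤ) : ℂ := -(1 - q ^ (-x)) * (1 - c * q ^ (x + 1))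

def PhiP (q c1 c2 c3 : ℂ) (N n : ℤ) : ℂ :=
  -c2 * q ^ (n - N) * (1 - q ^ n) * (1 - c1 * q ^ (N - n + 1)) * (1 - c2 * c3 * q ^ (n + N + 1))
      * (1 - c3 * q ^ n)
    / ((1 - c2 * c3 * q ^ (2 * n)) * (1 - c2 * c3 * q ^ (2 * n + 1)))

def PhiM (q c1 c2 c3 : ℂ) (N n : ℤ) : ℂ :=
  (1 - q ^ (n - N)) * (1 - c1 * c2 * c3 * q ^ (n + N + 2)) * (1 - c2 * q ^ (n + 1))
      * (1 - c2 * c3 * q ^ (n + 1))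
    / ((1 - c2 * c3 * q ^ (2 * n + 1)) * (1 - c2 * c3 * q ^ (2 * n + 2)))

/-- `Φ^ε(n;c1,c2,c3;N)`, where `ε = 1, -1, 0` selects `Φ⁺, Φ⁻, Φ⁰`. -/
def Phi (q c1 c2 c3 : ℂ) (N ε n : ℤ) : ℂ :=
  if ε = 1 then PhiP q c1 c2 c3 N n
  else if ε = -1 then PhiM q c1 c2 c3 N n
  else -PhiP q c1 c2 c3 N n - PhiM q c1 c2 c3 N n

/-- `λ₊(x;c1,c2,c3;N)`. -/
def lamP (q c1 c2 c3 : ℂ) (N x : ℤ) : ℂ :=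
  -(q ^ (-N - 1) / c3 - q ^ (-x)) * (1 - c1 * c2 * c3 * q ^ (N + x + 2))

/-- `λ₋(x;c1,c2,c3;N)`. -/
def lamM (q c1 c2 c3 : ℂ) (N x : ℤ) : ℂ :=
  -(q ^ (-N) - q ^ (-x)) * (1 - c1 * c2 * q ^ (N + x + 1))

def PhiPp (q sq c1 c2 c3 : ℂ) (N n : ℤ) : ℂ :=
  -sq * c2 * q ^ (2 * n - N - 1) * (1 - q ^ n) * (1 - c1 * q ^ (N - n + 1))
      * (1 - c1 * q ^ (N + 2 - n)) * (1 - c3 * q ^ n)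
    / ((1 - c2 * c3 * q ^ (2 * n)) * (1 - c2 * c3 * q ^ (2 * n + 1)))

def PhiPm (q sq c1 c2 c3 : ℂ) (N n : ℤ) : ℂ :=
  -((1 - c1 * c2 * c3 * q ^ (n + N + 2)) * (1 - c1 * c2 * c3 * q ^ (n + N + 3))
      * (1 - c2 * q ^ (n + 1)) * (1 - c2 * c3 * q ^ (n + 1)))
    / (c3 * q ^ (N + 1) * sq * (1 - c2 * c3 * q ^ (2 * n + 1)) * (1 - c2 * c3 * q ^ (2 * n + 2)))

def PhiP0 (q sq c1 c2 c3 : ℂ) (N n : ℤ) : ℂ :=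
  -PhiPp q sq c1 c2 c3 N n - PhiPm q sq c1 c2 c3 N n
    - (1 - c1 * c2 * q ^ (N + 2)) * (1 - c1 * c2 * c3 * q ^ (N + 2)) / (c3 * q ^ (N + 1) * sq)

def PhiMp (q sq c1 c2 c3 : ℂ) (N n : ℤ) : ℂ :=
  -sq * (1 - q ^ n) * (1 - c3 * q ^ n) * (1 - c2 * c3 * q ^ (n + N))
      * (1 - c2 * c3 * q ^ (n + N + 1))
    / (q ^ N * (1 - c2 * c3 * q ^ (2 * n)) * (1 - c2 * c3 * q ^ (2 * n + 1)))

def PhiMm (q sq c1 c2 c3 : ℂ) (N n : ℤ) : ℂ :=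
  -c3 * sq * q ^ N * (1 - q ^ (n - N)) * (1 - q ^ (n - N + 1)) * (1 - c2 * q ^ (n + 1))
      * (1 - c2 * c3 * q ^ (n + 1))
    / ((1 - c2 * c3 * q ^ (2 * n + 1)) * (1 - c2 * c3 * q ^ (2 * n + 2)))

def PhiM0 (q sq c1 c2 c3 : ℂ) (N n : ℤ) : ℂ :=
  -PhiMp q sq c1 c2 c3 N n - PhiMm q sq c1 c2 c3 N n - sq * (1 - c3 * q ^ N) * (q ^ (-N) - 1)

/-- Contiguity coefficient `Φ_σ^ε(n;c1,c2,c3;N)`, where `σ = 1` is the `+` and `σ = -1`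
the `-` family, `ε ∈ {1,0,-1}` selects the superscript, and `sq` is the chosen square
root of `q c2`. -/
def PhiC (q sq c1 c2 c3 : ℂ) (σ ε N n : ℤ) : ℂ :=
  if σ = 1 then
    if ε = 1 then PhiPp q sq c1 c2 c3 N n
    else if ε = -1 then PhiPm q sq c1 c2 c3 N n
    else PhiP0 q sq c1 c2 c3 N n
  else
    if ε = 1 then PhiMp q sq c1 c2 c3 N n
    else if ε = -1 then PhiMm q sq c1 c2 c3 N n
    else PhiM0 q sq c1 c2 c3 N n

def Fp (q c1 c2 : ℂ) (x : ℤ) : ℂ :=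
  c1 * c2 ^ 2 * q ^ (x + 1) * (1 - c1 * q ^ x) * (1 - q ^ x)
    / ((1 - c1 * c2 * q ^ (2 * x)) * (1 - c1 * c2 * q ^ (2 * x + 1)))

def Fm (q c1 c2 : ℂ) (x : ℤ) : ℂ :=
  c1 * c2 * q ^ (x + 1) * (1 - c2 * q ^ (x + 1)) * (1 - c1 * c2 * q ^ (x + 1))
    / ((1 - c1 * c2 * q ^ (2 * x + 1)) * (1 - c1 * c2 * q ^ (2 * x + 2)))

/-- The coefficients `A^{ε,ε'}_{i,j}(c1,c2,c3,c4;N)` for `(ε,ε') ≠ (0,0)`;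
`t2` is the chosen square root of `c2` and the fifth parameter
`c0 = (q^{2N+3} c1 c2 c3 c4)⁻¹` is computed internally. -/
def Aaux (q s c1 c2 c3 c4 t2 : ℂ) (N ε ε' i j : ℤ) : ℂ :=
  if ε' = 1 ∨ ε' = -1 then
    -c3 * q ^ (N + 1) *
        (if ε' = 1 then Fp q c4 ((q ^ (2 * N + 3) * c1 * c2 * c3 * c4)⁻¹) j
         else Fm q c4 ((q ^ (2 * N + 3) * c1 * c2 * c3 * c4)⁻¹) j) *
        PhiC q (s * t2) c1 c2 c3 ε' ε (N - j) i
  else if ε = 1 ∨ ε = -1 then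
    c3 * q ^ (N + 1) *
        (Fp q c4 ((q ^ (2 * N + 3) * c1 * c2 * c3 * c4)⁻¹) j
          + Fm q c4 ((q ^ (2 * N + 3) * c1 * c2 * c3 * c4)⁻¹) j) *
        Phi q c1 c2 c3 (N - j) ε i
  else 0

/-- The coefficients `A^{ε,ε'}_{i,j}(c1,c2,c3,c4;N)`. -/
def A (q s c1 c2 c3 c4 t2 : ℂ) (N ε ε' i j : ℤ) : ℂ :=
  if ε = 0 ∧ ε' = 0 then
    -((1 - c3 * q ^ (N + 1 - j)) * (s * t2) / (1 - c1 * c2 * q ^ (N + 2 - j)))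
          * ∑ e ∈ ({-1, 0, 1} : Finset ℤ), Aaux q s c1 c2 c3 c4 t2 N e 1 i j
      - (1 - c1 * c2 * q ^ (N + 1 - j)) / ((1 - c3 * q ^ (N - j)) * (s * t2))
          * ∑ e ∈ ({-1, 0, 1} : Finset ℤ), Aaux q s c1 c2 c3 c4 t2 N e (-1) i j
      - ∑ e ∈ ({-1, 1} : Finset ℤ), Aaux q s c1 c2 c3 c4 t2 N e 0 i j
  else Aaux q s c1 c2 c3 c4 t2 N ε ε' i j

/-- `Λ(x;c1,c2,c3,c4;N)`; `s, t1, t2, t3, t4` are the chosen square roots of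
`q, c1, c2, c3, c4`. -/
def Lam (q s c1 c2 c3 c4 t1 t2 t3 t4 : ℂ) (N x : ℤ) : ℂ :=
  (-1 : ℂ) ^ x * binom q N x * (1 - c1 * c2 * q ^ (2 * x + 1)) * poch q (q * c2) x.toNat
      * (s * t2) ^ N * (t1 * t3 / (t2 * t4)) ^ x * q ^ (x * (x - 1) / 2)
    / (poch q (q * c1) x.toNat * poch q (q ^ (x + 1) * c1 * c2) (N + 1).toNat)

/-- Tratnik polynomial of q-Racah type `T_{i,j}(x,y;c1,c2,c3,c4;N)`; the fifth parameter
`c0 = (q^{2N+3} c1 c2 c3 c4)⁻¹` and its square root `t0 = (s^{2N+3} t1 t2 t3 t4)⁻¹`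
are computed internally. -/
def T (q s c1 c2 c3 c4 t1 t2 t3 t4 : ℂ) (N i j x y : ℤ) : ℂ :=
  if 0 ≤ i ∧ 0 ≤ j ∧ i + j ≤ N then
    p q s c1 c2 c3 t2 (N - j) i x *
      p q s c3 ((q ^ (2 * N + 3) * c1 * c2 * c3 * c4)⁻¹) c4
        ((s ^ (2 * N + 3) * t1 * t2 * t3 * t4)⁻¹) (N - x) j y
  else 0

/-- Griffiths polynomial of q-Racah type `G_{i,j}(x,y;c1,c2,c3,c4;N)`; the fifth parameter
`c0 = (q^{2N+3} c1 c2 c3 c4)⁻¹` and its square root `t0 = (s^{2N+3} t1 t2 t3 t4)⁻¹`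
are computed internally. -/
def G (q s c1 c2 c3 c4 t1 t2 t3 t4 : ℂ) (N i j x y : ℤ) : ℂ :=
  if 0 ≤ i ∧ 0 ≤ j ∧ i + j ≤ N then
    ∑ a ∈ Finset.range ((min (N - j) (N - y)).toNat + 1),
      om q (t1 * t2 * t3 / t4) (a : ℤ) * p q s c1 c2 c3 t2 (N - j) i (a : ℤ) *
        p q s c3 ((q ^ (2 * N + 3) * c1 * c2 * c3 * c4)⁻¹) c4
          ((s ^ (2 * N + 3) * t1 * t2 * t3 * t4)⁻¹) (N - (a : ℤ)) j y *
        p q s c4 c2 c1 t2 (N - y) (a : ℤ) x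
  else 0

end qR

section
open qR Finset

theorem poch_zero (q a : ℂ) : poch q a 0 = 1 := by simp [poch]
theorem poch_succ (q a : ℂ) (k : ℕ) : poch q a (k+1) = poch q a k * (1 - a * q^k) := by
  simp [poch, prod_range_succ]
theorem poch_shift (q a : ℂ) (k : ℕ) : (1 - a) * poch q (a*q) k = poch q a (k+1) := by
  simp only [poch, prod_range_succ']
  rw [mul_comm]; simp only [pow_zero, mul_one]
  congr 1
  apply prod_congr rfl; intros; ring
theorem poch_shift2 (q a : ℂ) (k : ℕ) : (1 - a) * poch q (a*q) k = poch q a k * (1 - a*q^k) := by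
  rw [poch_shift, poch_succ]
theorem poch_ne (q a : ℂ) (k : ℕ) (h : ∀ j < k, 1 - a*q^j ≠ 0) : poch q a k ≠ 0 := by
  simp only [poch]; rw [prod_ne_zero_iff]; intro j hj; exact h j (by simpa using hj)
theorem poch_eq_zero (q a : ℂ) (k m : ℕ) (h : 1 - a*q^m = 0) (hm : m < k) : poch q a k = 0 := by
  simp only [poch]; exact prod_eq_zero (i := m) (by simpa using hm) h

/-- the k-th term -/
def tt (q A B C D E F G : ℂ) (k : ℕ) : ℂ :=
  poch q A k * poch q B k * poch q C k * poch q D k * q^k /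
    (poch q E k * poch q F k * poch q G k * poch q q k)

theorem tt_T (q A B C D E F G : ℂ) (k : ℕ) 
    (hG : ∀ j ≤ k, 1 - G*q^j ≠ 0) :
    (D-C)*(1-G)*tt q A B C D E F G k = (G-C)*(1-D)*tt q A B C (D*q) E F (G*q) k
      + (D-G)*(1-C)*tt q A B (C*q) D E F (G*q) k := by
  have hG0 : 1 - G ≠ 0 := by simpa using hG 0 (by omega)
  have hGk := hG k le_rfl
  have e1 := poch_shift2 q D k
  have e2 := poch_shift2 q C k
  have e3 : poch q (G*q) k = poch q G k * (1 - G*q^k)/(1-G) := by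
    rw [← poch_shift2]; field_simp
  have hp : poch q G k ≠ 0 := poch_ne _ _ _ fun j hj => hG j hj.le
  have : tt q A B C (D*q) E F (G*q) k *(1-D) = tt q A B C D E F G k * ((1-D*q^k)*(1-G)/(1-G*q^k)) := by
    unfold tt; rw [e3]
    calc _ = poch q A k * poch q B k * poch q C k * ((1-D)*poch q (D*q) k) * q^k /
         (poch q E k * poch q F k * (poch q G k * (1 - G * q ^ k) / (1 - G)) * poch q q k) := by ring
      _ = _ := by 
        rw [e1]; simp only [div_eq_mul_inv, mul_inv, inv_inv]; ring
  have h2 : tt q A B (C*q) D E F (G*q) k *(1-C) = tt q A B C D E F G k * ((1-C*q^k)*(1-G)/(1-G*q^k)) := by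
    unfold tt; rw [e3]
    calc _ = poch q A k * poch q B k * ((1-C)*poch q (C*q) k) * poch q D k * q^k /
         (poch q E k * poch q F k * (poch q G k * (1 - G * q ^ k) / (1 - G)) * poch q q k) := by ring
      _ = _ := by 
        rw [e2]; simp only [div_eq_mul_inv, mul_inv, inv_inv]; ring
  have : (G-C)*(1-D)*tt q A B C (D*q) E F (G*q) k
      + (D-G)*(1-C)*tt q A B (C*q) D E F (G*q) k = (G-C)*(tt q A B C (D*q) E F (G*q) k *(1-D)) + (D-G)*(tt q A B (C*q) D E F (G*q) k *(1-C)) := by ring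
  rw [this]; simp only [*]
  field_simp; ring

theorem tt_zero (q A B C D E F G : ℂ) : tt q A B C D E F G 0 = 1 := by simp [tt, poch_zero]
theorem tt_succ (q A B C D E F G : ℂ) (k : ℕ) : tt q A B C D E F G (k+1) = 
    tt q A B C D E F G k * ((1-A*q^k)*(1-B*q^k)*(1-C*q^k)*(1-D*q^k)*q/
      ((1-E*q^k)*(1-F*q^k)*(1-G*q^k)*(1-q^(k+1)))) := by
  unfold tt; simp only [poch_succ]
  rw [show q * q^k = q^(k+1) by ring]
  simp only [div_eq_mul_inv, mul_inv]; ring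

/-- multiplying two-parameter shifted terms -/
theorem sh_num (q A : ℂ) (k : ℕ) : (1-A)*poch q (A*q) k = (1-A*q^k) * poch q A k := by
  rw [poch_shift2]; ring
theorem sh_den' (q E : ℂ) (k : ℕ) (h0 : 1 - E ≠ 0) (hk : 1 - E*q^k ≠ 0) :
    (poch q (E*q) k)⁻¹ = (1-E)/(1-E*q^k)*(poch q E k)⁻¹ := by
  have : poch q (E*q) k = poch q E k * (1 - E*q^k)/(1-E) := by
    rw [← poch_shift2]; field_simp
  rw [this]; simp only [div_eq_mul_inv, mul_inv, inv_inv]; ring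

/-- (I), term relation -/
theorem tt_I (q A B C D E F G : ℂ) (K : ℕ) (hq : q ≠ 0)
    (hbal : q*A*B*C*D = E*F*G) (hF' : F ≠ 0) (hG' : G ≠ 0)
    (hE : ∀ j < K, 1 - E*q^j ≠ 0) (hF : ∀ j < K, 1 - F*q^j ≠ 0) (hG : ∀ j < K, 1 - G*q^j ≠ 0)
    (hQ : ∀ j < K, 1 - q^(j+1) ≠ 0) (hA : 1 - A ≠ 0) (hB : 1 - B ≠ 0) :
    ∑ k ∈ range K, (1-A)*(1-B)*(C*D*(D-C)*(1-E)*(1-F)*(1-G)*tt q A B C D E F G k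
      - D*(1-D)*(E-C)*(F-C)*(G-C)*tt q (A*q) (B*q) C (D*q) (E*q) (F*q) (G*q) k
      + C*(1-C)*(E-D)*(F-D)*(G-D)*tt q (A*q) (B*q) (C*q) D (E*q) (F*q) (G*q) k)
    = C*D*(D-C)*(1-E)*(1-F)*(1-G)*(1-A*B*q^K)*(1-q^K)/q^K*tt q A B C D E F G K := by
  induction K with
  | zero => simp
  | succ K ih =>
    rw [sum_range_succ, ih (fun j hj => hE j (by omega)) (fun j hj => hF j (by omega))
      (fun j hj => hG j (by omega)) (fun j hj => hQ j (by omega)), tt_succ]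
    have hE0 : 1 - E ≠ 0 := by simpa using hE 0 (by omega)
    have hF0 : 1 - F ≠ 0 := by simpa using hF 0 (by omega)
    have hG0 : 1 - G ≠ 0 := by simpa using hG 0 (by omega)
    have hEK := hE K (by omega)
    have hFK := hF K (by omega)
    have hGK := hG K (by omega)
    have hQK := hQ K (by omega)
    have h1 : (1-A)*(1-B)*((1-D)*tt q (A*q) (B*q) C (D*q) (E*q) (F*q) (G*q) K) =
      tt q A B C D E F G K * ((1-A*q^K)*(1-B*q^K)*(1-D*q^K)*(1-E)*(1-F)*(1-G)/((1-E*q^K)*(1-F*q^K)*(1-G*q^K))) := by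
      calc _ = ((1-A)*poch q (A*q) K) * ((1-B)*poch q (B*q) K) * ((1-D)*poch q (D*q) K) * poch q C K * q^K *
          ((poch q (E*q) K)⁻¹ * (poch q (F*q) K)⁻¹ * (poch q (G*q) K)⁻¹ * (poch q q K)⁻¹) := by
            unfold tt; simp only [div_eq_mul_inv, mul_inv]; ring
        _ = _ := by
            rw [sh_num, sh_num, sh_num, sh_den' q E K hE0 hEK, sh_den' q F K hF0 hFK, sh_den' q G K hG0 hGK]
            unfold tt; simp only [div_eq_mul_inv, mul_inv]; ring
    have h2 : (1-A)*(1-B)*((1-C)*tt q (A*q) (B*q) (C*q) D (E*q) (F*q) (G*q) K) =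
      tt q A B C D E F G K * ((1-A*q^K)*(1-B*q^K)*(1-C*q^K)*(1-E)*(1-F)*(1-G)/((1-E*q^K)*(1-F*q^K)*(1-G*q^K))) := by
      calc _ = ((1-A)*poch q (A*q) K) * ((1-B)*poch q (B*q) K) * ((1-C)*poch q (C*q) K) * poch q D K * q^K *
          ((poch q (E*q) K)⁻¹ * (poch q (F*q) K)⁻¹ * (poch q (G*q) K)⁻¹ * (poch q q K)⁻¹) := by
            unfold tt; simp only [div_eq_mul_inv, mul_inv]; ring
        _ = _ := by
            rw [sh_num, sh_num, sh_num, sh_den' q E K hE0 hEK, sh_den' q F K hF0 hFK, sh_den' q G K hG0 hGK]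
            unfold tt; simp only [div_eq_mul_inv, mul_inv]; ring
    have h3 : ∀ X Y Z J O P: ℂ, (1-A)*(1-B)*(J*X - D*(1-D)*(E-C)*(F-C)*(G-C)*Y + C*(1-C)*(E-D)*(F-D)*(G-D)*Z)
      = (1-A)*(1-B)*J*X - D*(E-C)*(F-C)*(G-C)*((1-A)*(1-B)*((1-D)*Y)) + C*(E-D)*(F-D)*(G-D)*((1-A)*(1-B)*((1-C)*Z)) := by
      intros; ring
    rw [h3 _ _ _ _ 0 0, h1, h2]
    generalize tt q A B C D E F G K = t
    rw [pow_succ] at hQK ⊢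
    have hz : q^K ≠ 0 := pow_ne_zero _ hq
    generalize q^K = z at *
    clear h1 h2 h3 ih hE hF hG hQ
    field_simp
    have : E = q*A*B*C*D/(F*G) := by field_simp; linear_combination -hbal
    rw [this]
    field_simp
    ring


theorem tt_X (q A B C D E F G : ℂ) (K : ℕ) (hq : q ≠ 0)
    (hbal : q*A*B*C*D = E*F*G) (hF' : F ≠ 0) (hG' : G ≠ 0)
    (hA : A ≠ 0) (hB : B ≠ 0) (hAB : A - B ≠ 0)
    (hE : ∀ j < K, 1 - E*q^j ≠ 0) (hF : ∀ j < K, 1 - F*q^j ≠ 0) (hG : ∀ j < K, 1 - G*q^j ≠ 0)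
    (hQ : ∀ j < K, 1 - q^(j+1) ≠ 0) :
    ∑ k ∈ range K, (1-D)*((q*D-F)*(1-E)*(1-G)*tt q A B C D E F G k
      - (A-E)*(A-G)*(q*A*D-F)/(A*(A-B))*(1-B)*tt q A (B*q) C (D*q) (E*q) F (G*q) k
      - (B-E)*(B-G)*(q*B*D-F)/(B*(B-A))*(1-A)*tt q (A*q) B C (D*q) (E*q) F (G*q) k)
    = (1-E)*(1-G)*(q*D)*(1-q^K)*(1-F*q^K/q)/q^K*tt q A B C D E F G K := by
  induction K with
  | zero => simp
  | succ K ih =>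
    rw [sum_range_succ, ih (fun j hj => hE j (by omega)) (fun j hj => hF j (by omega))
      (fun j hj => hG j (by omega)) (fun j hj => hQ j (by omega)), tt_succ]
    have hE0 : 1 - E ≠ 0 := by simpa using hE 0 (by omega)
    have hG0 : 1 - G ≠ 0 := by simpa using hG 0 (by omega)
    have hEK := hE K (by omega)
    have hFK := hF K (by omega)
    have hGK := hG K (by omega)
    have hQK := hQ K (by omega)
    have hBA : B - A ≠ 0 := fun h => hAB (by linear_combination -h)
    have h1 : (1-B)*((1-D)*tt q A (B*q) C (D*q) (E*q) F (G*q) K) =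
      tt q A B C D E F G K * ((1-B*q^K)*(1-D*q^K)*(1-E)*(1-G)/((1-E*q^K)*(1-G*q^K))) := by
      calc _ = ((1-B)*poch q (B*q) K) * ((1-D)*poch q (D*q) K) * poch q A K * poch q C K * q^K *
          ((poch q (E*q) K)⁻¹ * (poch q F K)⁻¹ * (poch q (G*q) K)⁻¹ * (poch q q K)⁻¹) := by
            unfold tt; simp only [div_eq_mul_inv, mul_inv]; ring
        _ = _ := by
            rw [sh_num, sh_num, sh_den' q E K hE0 hEK, sh_den' q G K hG0 hGK]
            unfold tt; simp only [div_eq_mul_inv, mul_inv]; ring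
    have h2 : (1-A)*((1-D)*tt q (A*q) B C (D*q) (E*q) F (G*q) K) =
      tt q A B C D E F G K * ((1-A*q^K)*(1-D*q^K)*(1-E)*(1-G)/((1-E*q^K)*(1-G*q^K))) := by
      calc _ = ((1-A)*poch q (A*q) K) * ((1-D)*poch q (D*q) K) * poch q B K * poch q C K * q^K *
          ((poch q (E*q) K)⁻¹ * (poch q F K)⁻¹ * (poch q (G*q) K)⁻¹ * (poch q q K)⁻¹) := by
            unfold tt; simp only [div_eq_mul_inv, mul_inv]; ring
        _ = _ := by
            rw [sh_num, sh_num, sh_den' q E K hE0 hEK, sh_den' q G K hG0 hGK]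
            unfold tt; simp only [div_eq_mul_inv, mul_inv]; ring
    have h3 : ∀ X Y Z a b c: ℂ, (1-D)*(a*X - b*(1-B)*Y -c*(1-A)*Z)
      = (1-D)*a*X - b*((1-B)*((1-D)*Y)) - c*((1-A)*((1-D)*Z)) := by
      intros; ring
    rw [h3, h1, h2]
    generalize tt q A B C D E F G K = t
    rw [pow_succ] at hQK ⊢
    have hz : q^K ≠ 0 := pow_ne_zero _ hq
    generalize q^K = z at *
    clear h1 h2 h3 ih hE hF hG hQ
    rw [show 1 - F*(z*q)/q = 1 - F*z by field_simp]
    have hFK2 : 1 - z * F ≠ 0 := by rwa [mul_comm]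
    field_simp
    have : E = q*A*B*C*D/(F*G) := by field_simp; linear_combination -hbal
    rw [this]
    field_simp
    ring

/-- the 4φ3 of the q-Racah polynomial -/
def ff (q J O P : ℂ) (N n x : ℕ) : ℂ :=
  ∑ k ∈ range (n+1), tt q (q^n)⁻¹ (O*P*q^(n+1)) (q^x)⁻¹ (J*O*q^(x+1))
    (q*O) (J*O*P*q^(N+2)) (q^N)⁻¹ k

theorem tt_symm (q A B C D E F G : ℂ) (k : ℕ) : tt q A B C D E F G k = tt q C D A B E F G k := by
  unfold tt; congr 1; ring
theorem tt_FG (q A B C D E F G : ℂ) (k : ℕ) : tt q A B C D E F G k = tt q A B C D E G F k := by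
  unfold tt; congr 1; ring
theorem tt_CD (q A B C D E F G : ℂ) (k : ℕ) : tt q A B C D E F G k = tt q A B D C E F G k := by
  unfold tt; congr 1; ring

theorem tt_van (q B C D E F G : ℂ) (n k : ℕ) (hq : q ≠ 0) (h : n < k) :
    tt q (q^n)⁻¹ B C D E F G k = 0 := by
  unfold tt
  rw [poch_eq_zero q (q^n)⁻¹ k n (by field_simp; simp) h]; simp

theorem tt_vanC (q A B D E F G : ℂ) (n k : ℕ) (hq : q ≠ 0) (h : n < k) :
    tt q A B (q^n)⁻¹ D E F G k = 0 := by
  rw [tt_symm, tt_van _ _ _ _ _ _ _ _ _ hq h]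

theorem sum_cut (f : ℕ → ℂ) (m K L : ℕ) (hf : ∀ k, m < k → f k = 0) (hK : m < K) (hL : m < L) :
    ∑ k ∈ range K, f k = ∑ k ∈ range L, f k := by
  have h : ∀ K, m < K → ∑ k ∈ range K, f k = ∑ k ∈ range (m+1), f k := by
    intro K hK
    symm
    apply sum_subset
    · intro a; simp; omega
    · intro a h1 h2; apply hf; simp at *; omega
  rw [h K hK, h L hL]

theorem ff_eq (q J O P : ℂ) (N n x K : ℕ) (hq : q ≠ 0) (hK : n < K ∨ x < K) :
    ff q J O P N n x = ∑ k ∈ range K, tt q (q^n)⁻¹ (O*P*q^(n+1)) (q^x)⁻¹ (J*O*q^(x+1))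
    (q*O) (J*O*P*q^(N+2)) (q^N)⁻¹ k := by
  unfold ff
  apply sum_cut _ (min n x)
  · intro k hk
    by_cases h : n < k
    · exact tt_van _ _ _ _ _ _ _ _ _ hq h
    · exact tt_vanC _ _ _ _ _ _ _ _ _ hq (by omega)
  · omega
  · omega

theorem ff_dual (q J O P : ℂ) (N n x : ℕ) (hq : q ≠ 0) :
    ff q J O P N n x = ff q P O J N x n := by
  rw [ff_eq q J O P N n x (n+x+1) hq (by omega), ff_eq q P O J N x n (n+x+1) hq (by omega)]
  apply sum_congr rfl; intro k _
  rw [tt_symm, mul_comm P O, mul_comm J O, show O*J*P = O*P*J by ring]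

theorem ff_zero (q J O P : ℂ) (N x : ℕ) : ff q J O P N 0 x = 1 := by
  simp [ff, tt_zero]
theorem ff_zero' (q J O P : ℂ) (N n : ℕ) (hq : q ≠ 0) : ff q J O P N n 0 = 1 := by
  rw [ff_dual _ _ _ _ _ _ _ hq, ff_zero]


structure Gf (q J O P : ℂ) (N : ℕ) : Prop where
  hq : q ≠ 0
  h1 : J ≠ 0
  h2 : O ≠ 0
  h3 : P ≠ 0
  hQ : ∀ k, 1 ≤ k → k ≤ N → 1 - q^k ≠ 0
  n1 : ∀ k, 1 ≤ k → k ≤ 2*N+5 → 1 - J*q^k ≠ 0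
  n2 : ∀ k, 1 ≤ k → k ≤ 2*N+5 → 1 - O*q^k ≠ 0
  n3 : ∀ k, 1 ≤ k → k ≤ 2*N+5 → 1 - P*q^k ≠ 0
  n12 : ∀ k, 1 ≤ k → k ≤ 2*N+5 → 1 - J*O*q^k ≠ 0
  n23 : ∀ k, 1 ≤ k → k ≤ 2*N+5 → 1 - O*P*q^k ≠ 0
  n123 : ∀ k, 1 ≤ k → k ≤ 2*N+5 → 1 - J*O*P*q^k ≠ 0

theorem Gf.symm {q J O P : ℂ} {N : ℕ} (g : Gf q J O P N) : Gf q P O J N where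
  hq := g.hq
  h1 := g.h3
  h2 := g.h2
  h3 := g.h1
  hQ := g.hQ
  n1 := g.n3
  n2 := g.n2
  n3 := g.n1
  n12 := by intro k h h'; rw [mul_comm P]; exact g.n23 k h h'
  n23 := by intro k h h'; rw [mul_comm O]; exact g.n12 k h h'
  n123 := by intro k h h'; rw [show P*O*J = J*O*P by ring]; exact g.n123 k h h'

theorem Gf.hE {q J O P : ℂ} {N : ℕ} (g : Gf q J O P N) (j : ℕ) (h : j ≤ N) :
    1 - q*O*q^j ≠ 0 := by
  rw [show q*O*q^j = O*q^(j+1) by ring]; exact g.n2 _ (by omega) (by omega)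
theorem Gf.hF {q J O P : ℂ} {N : ℕ} (g : Gf q J O P N) (j : ℕ) (h : j ≤ N) :
    1 - J*O*P*q^(N+2)*q^j ≠ 0 := by
  rw [mul_assoc _ (q^_), ← pow_add]; exact g.n123 _ (by omega) (by omega)
theorem Gf.hG {q J O P : ℂ} {N : ℕ} (g : Gf q J O P N) (j : ℕ) (h : j < N) :
    1 - (q^N)⁻¹*q^j ≠ 0 := by
  obtain ⟨m, rfl⟩ : ∃ m, N = j+m := ⟨N-j, by omega⟩
  have := g.hQ m (by omega) (by omega)
  have hq := g.hq
  intro h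
  apply this
  rw [pow_add] at h
  field_simp at h
  linear_combination -h

theorem mul_congr_of (a x y : ℂ) (h : a ≠ 0 → x = y) : a * x = a * y := by
  by_cases ha : a = 0
  · simp [ha]
  · rw [h ha]

theorem ffT1 {q J O P : ℂ} {N : ℕ} (g : Gf q J O P (N+1)) (n x : ℕ) (hn : n ≤ N) :
    (J*O*q^(x+1) - (q^x)⁻¹)*(1-(q^(N+1))⁻¹) * ff q J O P (N+1) n x =
    ((q^(N+1))⁻¹ - (q^x)⁻¹)*(1-J*O*q^(x+1))*ff q (q*J) O P N n x
    + (J*O*q^(x+1) - (q^(N+1))⁻¹)*(1-(q^x)⁻¹)*ff q (q*J) O P N n (x-1) := by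
  have hq := g.hq
  unfold ff
  simp only [mul_sum]
  rw [← sum_add_distrib]
  apply sum_congr rfl
  intro k hk
  have hk : k ≤ n := by simpa [Nat.lt_succ_iff] using hk
  rw [tt_T _ _ _ _ _ _ _ _ _ (fun j hj => g.hG j (by omega))]
  congr 1
  · congr 1; congr 1 <;> (first | ring1 | (field_simp; done) | (field_simp; ring1))
  · apply mul_congr_of; intro h
    have : x ≠ 0 := by rintro rfl; simp at h
    obtain ⟨x, rfl⟩ : ∃ m, x = m+1 := ⟨x-1, by omega⟩
    simp only [Nat.add_sub_cancel]
    congr 1 <;> (first | ring1 | (field_simp; done) | (field_simp; ring1))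

theorem ffT2 {q J O P : ℂ} {N : ℕ} (g : Gf q J O P N) (n x : ℕ) (hn : n ≤ N) :
    (J*O*q^(x+1) - (q^x)⁻¹)*(1-J*O*P*q^(N+2)) * ff q J O P N n x =
    (J*O*P*q^(N+2) - (q^x)⁻¹)*(1-J*O*q^(x+1))*ff q (q*J) O P N n x
    + (J*O*q^(x+1) - J*O*P*q^(N+2))*(1-(q^x)⁻¹)*ff q (q*J) O P N n (x-1) := by
  have hq := g.hq
  unfold ff
  simp only [mul_sum]
  rw [← sum_add_distrib]
  apply sum_congr rfl
  intro k hk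
  have hk : k ≤ n := by simpa [Nat.lt_succ_iff] using hk
  rw [tt_FG, tt_T _ _ _ _ _ _ _ _ _ (fun j hj => g.hF j (by omega)), tt_FG,
    tt_FG _ _ _ ((q^x)⁻¹*q)]
  congr 1
  · congr 1; congr 1 <;> ring1
  · apply mul_congr_of; intro h
    have : x ≠ 0 := by rintro rfl; simp at h
    obtain ⟨x, rfl⟩ : ∃ m, x = m+1 := ⟨x-1, by omega⟩
    simp only [Nat.add_sub_cancel]
    congr 1 <;> (first | ring1 | (field_simp; done) | (field_simp; ring1))

theorem ffI {q J O P : ℂ} {N : ℕ} (g : Gf q J O P (N+1)) (n x : ℕ) (hn : n ≤ N) 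
    (C D E F G : ℂ) (hC : C = (q^x)⁻¹) (hD : D = J*O*q^(x+1)) (hE : E = q*O)
    (hF : F = J*O*P*q^(N+3)) (hG : G = (q^(N+1))⁻¹) :
    C*D*(D-C)*(1-E)*(1-F)*(1-G) * ff q J O P (N+1) (n+1) x =
    D*(1-D)*(E-C)*(F-C)*(G-C)*ff q J (q*O) (q*P) N n x
    - C*(1-C)*(E-D)*(F-D)*(G-D)*ff q J (q*O) (q*P) N n (x-1) := by
  have hq := g.hq
  have h1 := g.h1
  have h2 := g.h2
  have h3 := g.h3
  have key := tt_I q (q^(n+1))⁻¹ (O*P*q^(n+1+1)) C D E F G (n+1) hq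
    (by subst_vars; field_simp <;> ring1) (by subst_vars; simp [*]) (by subst_vars; simp [*])
    (by subst_vars; intro j hj; exact g.hE j (by omega))
    (by subst_vars; intro j hj; exact g.hF j (by omega))
    (by subst_vars; intro j hj; exact g.hG j (by omega))
    (by intro j hj; exact g.hQ (j+1) (by omega) (by omega))
  have hA : 1 - (q^(n+1))⁻¹ ≠ 0 := by
    have := g.hQ (n+1) (by omega) (by omega)
    intro h; apply this; field_simp at h; linear_combination -h
  have hB : 1 - (O*P*q^(n+1+1)) ≠ 0 := g.n23 _ (by omega) (by omega)
  replace key := key hA hB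
  rw [← mul_sum] at key
  have b : C * D * (D - C) * (1 - E) * (1 - F) * (1 - G) * (1 - (q ^ (n + 1))⁻¹ * (O * P * q ^ (n + 1 + 1)) * q ^ (n + 1)) *
        (1 - q ^ (n + 1)) / q ^ (n + 1) = (1 - (q^(n+1))⁻¹)*(1 - (O*P*q^(n+1+1)))*(-(C * D * (D - C) * (1 - E) * (1 - F) * (1 - G))) := by
    have : q^(n+1) ≠ 0 := pow_ne_zero _ hq
    generalize C * D * (D - C) * (1 - E) * (1 - F) * (1 - G) = M
    rw [pow_succ q (n+1)]
    generalize q^(n+1) = z at *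
    field_simp; ring
  rw [b, mul_assoc ((1 - (q^(n+1))⁻¹)*(1 - (O*P*q^(n+1+1))))] at key
  replace key := mul_left_cancel₀ (mul_ne_zero hA hB) key
  have e1 : ff q J O P (N+1) (n+1) x = ∑ k ∈ range (n+1), tt q (q^(n+1))⁻¹ (O*P*q^(n+1+1)) C D E F G k
     + tt q (q^(n+1))⁻¹ (O*P*q^(n+1+1)) C D E F G (n+1) := by
    subst_vars; unfold ff; rw [sum_range_succ]
  have e2 : ff q J (q*O) (q*P) N n x = ∑ k ∈ range (n+1), tt q ((q^(n+1))⁻¹*q) (O*P*q^(n+1+1)*q) C (D*q) (E*q) (F*q) (G*q) k := by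
    subst_vars; unfold ff; apply sum_congr rfl; intro k _; congr 1 <;> (first | ring1 | (field_simp; done) | (field_simp; ring1))
  have e3 : C*(1-C)*(E-D)*(F-D)*(G-D)*ff q J (q*O) (q*P) N n (x-1) = C*(1-C)*(E-D)*(F-D)*(G-D)*∑ k ∈ range (n+1), tt q ((q^(n+1))⁻¹*q) (O*P*q^(n+1+1)*q) (C*q) D (E*q) (F*q) (G*q) k := by
    apply mul_congr_of; intro h
    have : x ≠ 0 := by rintro rfl; simp [hC] at h
    obtain ⟨x, rfl⟩ : ∃ m, x = m+1 := ⟨x-1, by omega⟩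
    simp only [Nat.add_sub_cancel]
    subst_vars; unfold ff; apply sum_congr rfl; intro k _; congr 1 <;> (first | ring1 | (field_simp; done) | (field_simp; ring1))
  rw [e3, e1, e2]
  rw [sum_add_distrib, sum_sub_distrib, ← mul_sum, ← mul_sum, ← mul_sum] at key
  linear_combination key

theorem ffX {q J O P : ℂ} {N : ℕ} (g : Gf q J O P (N+1)) (i a : ℕ) (hi : i ≤ N+1) (ha : a ≤ N)
    (A B E F G : ℂ) (hA : A = (q^i)⁻¹) (hB : B = O*P*q^(i+1)) (hE : E = q*O)
    (hF : F = J*O*P*q^(N+3)) (hG : G = (q^(N+1))⁻¹) :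
    (q*(J*O*q^(a+1))-F)*(1-E)*(1-G)*ff q J O P (N+1) i a =
      (A-E)*(A-G)*(q*A*(J*O*q^(a+1))-F)/(A*(A-B))*(1-B)*ff q J (q*O) P N i a
      + (B-E)*(B-G)*(q*B*(J*O*q^(a+1))-F)/(B*(B-A))*(1-A)*ff q J (q*O) P N (i-1) a ∧
    ((q^a)⁻¹-F)*(1-E)*(1-G)*ff q J O P (N+1) i (a+1) =
      (A-E)*(A-G)*(A*(q^a)⁻¹-F)/(A*(A-B))*(1-B)*ff q J (q*O) P N i a
      + (B-E)*(B-G)*(B*(q^a)⁻¹-F)/(B*(B-A))*(1-A)*ff q J (q*O) P N (i-1) a := by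
  have hq := g.hq
  have h1 := g.h1
  have h2 := g.h2
  have h3 := g.h3
  have hAB : A - B ≠ 0 := by
    subst_vars
    have := g.n23 (2*i+1) (by omega) (by omega)
    intro h; apply this; field_simp at h; linear_combination h
  have eA : ∀ Y, (1-A)*Y*ff q J (q*O) P N (i-1) a = (1-A)*Y*∑ k ∈ range (a+1), tt q (A*q) B (q^a)⁻¹ (J*O*q^(a+1)*q) (E*q) F (G*q) k := by
    intro Y
    rw [mul_assoc, mul_assoc]
    apply mul_congr_of; intro h
    have : i ≠ 0 := by rintro rfl; simp [hA] at h
    obtain ⟨i, rfl⟩ : ∃ m, i = m+1 := ⟨i-1, by omega⟩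
    simp only [Nat.add_sub_cancel]
    subst_vars; rw [ff_eq _ _ _ _ _ _ _ (a+1) hq (by omega)]; congr 1
    apply sum_congr rfl; intro k _; congr 1 <;> (first | ring1 | (field_simp; done) | (field_simp; ring1))
  have eB : ff q J (q*O) P N i a = ∑ k ∈ range (a+1), tt q A (B*q) (q^a)⁻¹ (J*O*q^(a+1)*q) (E*q) F (G*q) k := by
    subst_vars; rw [ff_eq _ _ _ _ _ _ _ (a+1) hq (by omega)]
    apply sum_congr rfl; intro k _; congr 1 <;> (first | ring1 | (field_simp; done) | (field_simp; ring1))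
  have hEE : ∀ j ≤ N+1, 1 - E*q^j ≠ 0 := by subst_vars; intro j hj; exact g.hE j (by omega)
  have hFF : ∀ j ≤ N+1, 1 - F*q^j ≠ 0 := by subst_vars; intro j hj; exact g.hF j (by omega)
  have hGG : ∀ j < N+1, 1 - G*q^j ≠ 0 := by subst_vars; intro j hj; exact g.hG j (by omega)
  have hQQ : ∀ j < N+1, 1 - q^(j+1) ≠ 0 := by intro j hj; exact g.hQ (j+1) (by omega) (by omega)
  have hA0 : A ≠ 0 := by subst_vars; simp [*]
  have hB0 : B ≠ 0 := by subst_vars; simp [*]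
  have hF0 : F ≠ 0 := by subst_vars; simp [*]
  have hG0 : G ≠ 0 := by subst_vars; simp [*]
  constructor
  · have key := tt_X q A B (q^a)⁻¹ (J*O*q^(a+1)) E F G (a+1) hq (by subst_vars; field_simp <;> ring1)
      hF0 hG0 hA0 hB0 hAB
      (fun j hj => hEE j (by omega)) (fun j hj => hFF j (by omega)) (fun j hj => hGG j (by omega))
      (fun j hj => hQQ j (by omega))
    rw [tt_vanC _ _ _ _ _ _ _ _ _ hq (Nat.lt_succ_self a), mul_zero, ← mul_sum] at key
    have hD : 1 - J*O*q^(a+1) ≠ 0 := g.n12 _ (by omega) (by omega)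
    replace key := (mul_eq_zero.1 key).resolve_left hD
    rw [sum_sub_distrib, sum_sub_distrib, ← mul_sum, ← mul_sum, ← mul_sum] at key
    have e1 : ff q J O P (N+1) i a = ∑ k ∈ range (a+1), tt q A B (q^a)⁻¹ (J*O*q^(a+1)) E F G k := by
      subst_vars; exact ff_eq _ _ _ _ _ _ _ (a+1) hq (by omega)
    rw [e1, eB]
    have := eA ((B-E)*(B-G)*(q*B*(J*O*q^(a+1))-F)/(B*(B-A)))
    linear_combination key - this
  · have key := tt_X q A B (J*O*q^(a+1)*q) ((q^(a+1))⁻¹) E F G (a+1) hq (by subst_vars; field_simp <;> ring1)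
      hF0 hG0 hA0 hB0 hAB
      (fun j hj => hEE j (by omega)) (fun j hj => hFF j (by omega)) (fun j hj => hGG j (by omega))
      (fun j hj => hQQ j (by omega))
    have hD : 1 - (q^(a+1))⁻¹ ≠ 0 := by
      have := g.hQ (a+1) (by omega) (by omega)
      intro h; apply this; field_simp at h; linear_combination -h
    have b : (1 - E) * (1 - G) * (q * (q ^ (a + 1))⁻¹) * (1 - q ^ (a + 1)) * (1 - F * q ^ (a + 1) / q) / q ^ (a + 1)
       = (1 - (q^(a+1))⁻¹) * (-((1-E)*(1-G)*(q*(q^(a+1))⁻¹-F))) := by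
      have : q^(a+1) ≠ 0 := pow_ne_zero _ hq
      generalize q^(a+1) = z at *
      field_simp; ring
    rw [b, ← mul_sum, mul_assoc (1 - (q^(a+1))⁻¹)] at key
    replace key := mul_left_cancel₀ hD key
    rw [sum_sub_distrib, sum_sub_distrib, ← mul_sum, ← mul_sum, ← mul_sum] at key
    have eqa : q * (q^(a+1))⁻¹ = (q^a)⁻¹ := by (first | ring1 | (field_simp; done) | (field_simp; ring1))
    have eqa2 : (q^(a+1))⁻¹*q = (q^a)⁻¹ := by (first | ring1 | (field_simp; done) | (field_simp; ring1))
    have e1 : ff q J O P (N+1) i (a+1) = ∑ k ∈ range (a+1), tt q A B (J*O*q^(a+1)*q) ((q^(a+1))⁻¹) E F G k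
       + tt q A B (J*O*q^(a+1)*q) ((q^(a+1))⁻¹) E F G (a+1) := by
      rw [ff_eq _ _ _ _ _ _ _ (a+2) hq (by omega), sum_range_succ]
      subst_vars
      congr 1
      · apply sum_congr rfl; intro k _; rw [tt_CD]; congr 1; ring
      · rw [tt_CD]; congr 1; ring
    rw [e1, eB]
    have := eA ((B-E)*(B-G)*(B*(q^a)⁻¹-F)/(B*(B-A)))
    rw [mul_right_comm q A, mul_right_comm q B] at key
    simp only [eqa, eqa2, tt_CD _ _ _ (J*O*q^(a+1)*q) (q^a)⁻¹] at key
    linear_combination key - this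


def PP (q c : ℂ) (n : ℕ) : ℂ := poch q (q*c) n
def Fb (q c : ℂ) (n : ℕ) : ℂ := 1 - c*q^n
theorem Fb_shift (q c : ℂ) (n : ℕ) : Fb q (q*c) n = Fb q c (n+1) := by unfold Fb; ring
theorem PP_zero (q c : ℂ) : PP q c 0 = 1 := poch_zero _ _
theorem PP_succ (q c : ℂ) (n : ℕ) : PP q c (n+1) = PP q c n * Fb q c (n+1) := by
  unfold PP Fb; rw [poch_succ]; ring
theorem PP_shift (q c : ℂ) (n : ℕ) (h : Fb q c 1 ≠ 0) : PP q (q*c) n = PP q c n * Fb q c (n+1) / Fb q c 1 := by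
  rw [← PP_succ]; unfold PP
  rw [show Fb q c 1 = 1 - q*c by unfold Fb; ring] at *
  rw [← poch_shift, mul_comm (q*c) q]; field_simp
theorem PP_ne (q c : ℂ) (n : ℕ) (h : ∀ k, 1 ≤ k → k ≤ n → 1 - c*q^k ≠ 0) : PP q c n ≠ 0 := by
  unfold PP; apply poch_ne; intro j hj
  have := h (j+1) (by omega) (by omega)
  rwa [show q*c*q^j = c*q^(j+1) by ring]

/-- normalised weight, square-root free -/
def om1n (q J O P : ℂ) (n u : ℕ) : ℂ :=
  PP q 1 (n+u) * Fb q (O*P) (n+n+1) * PP q O n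
    * PP q (J*O*P) (n+n+u+1) * PP q J u * PP q (O*P) n
def om1d (q J O P : ℂ) (n u : ℕ) : ℂ :=
  PP q 1 n * PP q 1 u * PP q (J*O*P) (n+u+1) * (q*O)^n * PP q (O*P) (n+n+u+1) * PP q P n
def om1 (q J O P : ℂ) (n u : ℕ) : ℂ := om1n q J O P n u / om1d q J O P n u

/-- forward shift -/
theorem tt_fs (q A B C D E F G : ℂ) (k : ℕ) (hQ : 1 - q^(k+1) ≠ 0) (hE : 1 - E ≠ 0) (hF : 1 - F ≠ 0) (hG : 1 - G ≠ 0) :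
   tt q A B C (D*q) E F G (k+1) - tt q A B (C*q) D E F G (k+1) =
    q*(D-C)*(1-A)*(1-B)/((1-E)*(1-F)*(1-G)) * tt q (A*q) (B*q) (C*q) (D*q) (E*q) (F*q) (G*q) k := by
  unfold tt
  rw [← poch_shift q A, ← poch_shift q B, ← poch_shift q E, ← poch_shift q F, ← poch_shift q G,
    ← poch_shift q C, ← poch_shift q D, poch_succ q (D*q), poch_succ q (C*q), poch_succ q q,
    show q*q^k = q^(k+1) by ring, show D*q*q^k = D*q^(k+1) by ring, show C*q*q^k = C*q^(k+1) by ring]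
  generalize poch q (A*q) k = a
  generalize poch q (B*q) k = b
  generalize poch q (C*q) k = c
  generalize poch q (D*q) k = d
  generalize poch q q k = z
  rw [pow_succ] at hQ ⊢
  simp only [div_eq_mul_inv, mul_inv]
  have : ∀ e : ℂ, (1-q^k*q)⁻¹ * (1-q^k*q) = 1 := fun _ => inv_mul_cancel₀ hQ
  linear_combination ((1-A)*(1-B)*a*b*c*d*(D-C)*q*q^k*((1-E)⁻¹*(1-F)⁻¹*(1-G)⁻¹*(poch q (E*q) k)⁻¹*(poch q (F*q) k)⁻¹*(poch q (G*q) k)⁻¹*z⁻¹)) * this 0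

theorem ff_fs {q J O P : ℂ} {N : ℕ} (g : Gf q J O P (N+1)) (m x : ℕ) (hm : m ≤ N) :
    ff q J O P (N+1) (m+1) (x+1) - ff q J O P (N+1) (m+1) x =
    q*(J*O*q^(x+1) - (q^(x+1))⁻¹)*(1-(q^(m+1))⁻¹)*(1-O*P*q^(m+2))/
      ((1-q*O)*(1-J*O*P*q^(N+3))*(1-(q^(N+1))⁻¹)) * ff q J (q*O) (q*P) N m x := by
  have hq := g.hq
  unfold ff
  rw [sum_range_succ', sum_range_succ' _ (m+1), mul_sum]
  simp only [tt_zero]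
  rw [add_sub_add_right_eq_sub, ← sum_sub_distrib]
  apply sum_congr rfl
  intro k hk
  have hk : k ≤ m := by simpa [Nat.lt_succ_iff] using hk
  have := tt_fs q (q^(m+1))⁻¹ (O*P*q^(m+2)) (q^(x+1))⁻¹ (J*O*q^(x+1)) (q*O) (J*O*P*q^(N+3)) (q^(N+1))⁻¹ k
    (g.hQ _ (by omega) (by omega)) (by simpa using g.hE 0) (by simpa using g.hF 0) (by simpa using g.hG 0)
  convert this using 1
  · congr 1 <;> congr 1 <;> (first | ring1 | (field_simp; done) | (field_simp; ring1))
  · congr 1; congr 1 <;> (first | ring1 | (field_simp; done) | (field_simp; ring1))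

theorem q1 (q : ℂ) {N : ℕ} (h : ∀ k, 1 ≤ k → k ≤ N → 1 - q^k ≠ 0) (n : ℕ) (hn : n ≤ N) : PP q 1 n ≠ 0 :=
  PP_ne _ _ _ (fun k h1 h2 => by rw [one_mul]; exact h k h1 (by omega))

theorem Gf.P1 {q J O P : ℂ} {N : ℕ} (g : Gf q J O P N) (n : ℕ) (hn : n ≤ 2*N+5) : PP q J n ≠ 0 :=
  PP_ne _ _ _ (fun k h1 h2 => g.n1 k h1 (by omega))
theorem Gf.P2 {q J O P : ℂ} {N : ℕ} (g : Gf q J O P N) (n : ℕ) (hn : n ≤ 2*N+5) : PP q O n ≠ 0 :=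
  PP_ne _ _ _ (fun k h1 h2 => g.n2 k h1 (by omega))
theorem Gf.P3 {q J O P : ℂ} {N : ℕ} (g : Gf q J O P N) (n : ℕ) (hn : n ≤ 2*N+5) : PP q P n ≠ 0 :=
  PP_ne _ _ _ (fun k h1 h2 => g.n3 k h1 (by omega))
theorem Gf.P12 {q J O P : ℂ} {N : ℕ} (g : Gf q J O P N) (n : ℕ) (hn : n ≤ 2*N+5) : PP q (J*O) n ≠ 0 :=
  PP_ne _ _ _ (fun k h1 h2 => g.n12 k h1 (by omega))
theorem Gf.P23 {q J O P : ℂ} {N : ℕ} (g : Gf q J O P N) (n : ℕ) (hn : n ≤ 2*N+5) : PP q (O*P) n ≠ 0 :=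
  PP_ne _ _ _ (fun k h1 h2 => g.n23 k h1 (by omega))
theorem Gf.P123 {q J O P : ℂ} {N : ℕ} (g : Gf q J O P N) (n : ℕ) (hn : n ≤ 2*N+5) : PP q (J*O*P) n ≠ 0 :=
  PP_ne _ _ _ (fun k h1 h2 => g.n123 k h1 (by omega))

theorem Gf.om1d_ne {q J O P : ℂ} {N : ℕ} (g : Gf q J O P N) (n u : ℕ) (h : n+u ≤ N) :
    om1d q J O P n u ≠ 0 := by
  have hq := g.hq
  have h2 := g.h2
  unfold om1d
  have a2 := q1 q g.hQ n (by omega)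
  have a3 := q1 q g.hQ u (by omega)
  have a6 := g.P123 (n+u+1) (by omega)
  have a9 := g.P23 (n+n+u+1) (by omega)
  have a0 := g.P3 n (by omega)
  simp [*]
theorem Gf.om1_ne {q J O P : ℂ} {N : ℕ} (g : Gf q J O P N) (n u : ℕ) (h : n+u ≤ N) :
    om1 q J O P n u ≠ 0 := by
  have hq := g.hq
  have h2 := g.h2
  have := g.om1d_ne n u h
  unfold om1 om1n
  have a1 := q1 q g.hQ (n+u) (by omega)
  have a4 := g.P2 n (by omega)
  have a5 := g.P123 (n+n+u+1) (by omega)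
  have a7 := g.P1 u (by omega)
  have a8 := g.P23 n (by omega)
  have b : Fb q (O*P) (n+n+1) ≠ 0 := g.n23 (n+n+1) (by omega) (by omega)
  simp [*]
theorem Gf.f0 {q J O P : ℂ} {N : ℕ} (g : Gf q J O P N) (n : ℕ) (h : n + 1 ≤ N) :
    Fb q 1 (n+1) ≠ 0 := by unfold Fb; rw [one_mul]; exact g.hQ _ (by omega) h
theorem Gf.f1 {q J O P : ℂ} {N : ℕ} (g : Gf q J O P N) (n : ℕ) (h : n + 1 ≤ 2*N+5) :
    Fb q J (n+1) ≠ 0 := g.n1 _ (by omega) (by omega)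
theorem Gf.f2 {q J O P : ℂ} {N : ℕ} (g : Gf q J O P N) (n : ℕ) (h : n + 1 ≤ 2*N+5) :
    Fb q O (n+1) ≠ 0 := g.n2 _ (by omega) (by omega)
theorem Gf.f3 {q J O P : ℂ} {N : ℕ} (g : Gf q J O P N) (n : ℕ) (h : n + 1 ≤ 2*N+5) :
    Fb q P (n+1) ≠ 0 := g.n3 _ (by omega) (by omega)
theorem Gf.f12 {q J O P : ℂ} {N : ℕ} (g : Gf q J O P N) (n : ℕ) (h : n + 1 ≤ 2*N+5) :
    Fb q (J*O) (n+1) ≠ 0 := g.n12 _ (by omega) (by omega)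
theorem Gf.f23 {q J O P : ℂ} {N : ℕ} (g : Gf q J O P N) (n : ℕ) (h : n + 1 ≤ 2*N+5) :
    Fb q (O*P) (n+1) ≠ 0 := g.n23 _ (by omega) (by omega)
theorem Gf.f123 {q J O P : ℂ} {N : ℕ} (g : Gf q J O P N) (n : ℕ) (h : n + 1 ≤ 2*N+5) :
    Fb q (J*O*P) (n+1) ≠ 0 := g.n123 _ (by omega) (by omega)

theorem PP_pair (q c : ℂ) (n : ℕ) (h : Fb q c 1 ≠ 0) :
    ∃ v, PP q c n = v * Fb q c 1 ∧ PP q (q*c) n = v * Fb q c (n+1) := by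
  refine ⟨PP q c n / Fb q c 1, by field_simp, ?_⟩
  rw [PP_shift _ _ _ h]; ring
theorem PP_succ' (q c : ℂ) (n : ℕ) (h : Fb q c 1 ≠ 0) : PP q c (n+1) = Fb q c 1 * PP q (q*c) n := by
  obtain ⟨v, h1, h2⟩ := PP_pair q c n h
  rw [PP_succ, h1, h2]; ring

attribute [irreducible] PP Fb

theorem om1_succ_n {q J O P : ℂ} {N : ℕ} (g : Gf q J O P N) (n u : ℕ) (h : n+u+1 ≤ N) :
    om1 q J O P (n+1) u * (Fb q 1 (n+1) * Fb q (O*P) (n+n+1) * Fb q J (u+1) *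
      ((q*O)*Fb q (O*P) (n+n+u+1+1+1)*Fb q P (n+1))) = om1 q J O P n (u+1) * (
     Fb q 1 (u+1) * Fb q (O*P) (n+n+1+1+1) * Fb q O (n+1) *
      Fb q (J*O*P) (n+n+u+1+1+1) * Fb q (O*P) (n+1)) := by
  unfold om1
  rw [div_mul_eq_mul_div, div_mul_eq_mul_div, div_eq_div_iff (g.om1d_ne _ _ (by omega)) (g.om1d_ne _ _ (by omega))]
  unfold om1n om1d
  simp only [← add_assoc, add_right_comm _ 1 n, add_right_comm _ 1 u]
  simp only [PP_succ, pow_succ]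
  ring

/-- passing to (J, O, q P) at N-1 -/
theorem om1_sh3 {q J O P : ℂ} {N : ℕ} (g : Gf q J O P (N+1)) (g' : Gf q J O (q*P) N) (x u : ℕ) (h : x+u ≤ N) :
    om1 q (q*P) O J x u * (Fb q 1 (x+u+1) * Fb q P 1) = om1 q P O J x (u+1) *
      (Fb q 1 (u+1) * Fb q (O*J) (x+x+u+1+1)) := by
  have g := g.symm
  have g' := g'.symm
  have b3 := g.f1 0 (by omega)
  have b7 := g.f123 0 (by omega)
  unfold om1
  rw [div_mul_eq_mul_div, div_mul_eq_mul_div, div_eq_div_iff (g'.om1d_ne _ _ (by omega)) (g.om1d_ne _ _ (by omega))]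
  unfold om1n om1d
  simp only [← add_assoc, add_right_comm _ 1 x, add_right_comm _ 1 u]
  simp only [PP_succ' q (P*O*J) _ b7, PP_succ' q P _ b3]
  rw [show q*P*O*J = q*(P*O*J) by ring]
  simp only [PP_succ, Fb_shift]
  ring

/-- passing to (J, q O, q P) at N-1 -/
theorem om1_sh23 {q J O P : ℂ} {N : ℕ} (g : Gf q J O P (N+1)) (g' : Gf q J (q*O) (q*P) N) (x u : ℕ) (h : x+u ≤ N) :
    om1 q (q*P) (q*O) J x u * (Fb q 1 (x+u+1) * Fb q P 1 * Fb q (O*J) (x+x+1) * Fb q O 1 * Fb q (P*O*J) (x+u+1+1+1) * q^x) = om1 q P O J x (u+1) *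
      (Fb q 1 (u+1) * Fb q (O*J) (x+x+1+1) * Fb q O (x+1) * Fb q (P*O*J) (x+x+u+1+1+1) * Fb q (O*J) (x+1)) := by
  have g := g.symm
  have g' := g'.symm
  have b3 := g.f1 0 (by omega)
  have b7 := g.f123 0 (by omega)
  have b77 := g.f123 1 (by omega)
  have d1 := g.f2 0 (by omega)
  have d2 := g.f23 0 (by omega)
  unfold om1
  rw [div_mul_eq_mul_div, div_mul_eq_mul_div, div_eq_div_iff (g'.om1d_ne _ _ (by omega)) (g.om1d_ne _ _ (by omega))]
  unfold om1n om1d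
  rw [show q*P*(q*O)*J = q*(q*(P*O*J)) by ring, mul_assoc q O]
  have e : Fb q (q*(P*O*J)) 1 ≠ 0 := by rw [Fb_shift]; exact b77
  simp only [← add_assoc, add_right_comm _ 1 x, add_right_comm _ 1 u]
  simp only [PP_succ' q P _ b3, PP_succ' q (P*O*J) _ b7]
  obtain ⟨v1, e1, e2⟩ := PP_pair q O x d1
  obtain ⟨v2, e3, e4⟩ := PP_pair q (O*J) x d2
  obtain ⟨v3, e5, e6⟩ := PP_pair q (q*(P*O*J)) (x+x+u+1) e
  obtain ⟨v4, e7, e8⟩ := PP_pair q (q*(P*O*J)) (x+u+1) e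
  simp only [e1,e2,e3,e4,e5,e6,e7,e8, mul_pow, Fb_shift, PP_succ' q (O*J) _ d2, PP_succ, PP_succ q (O*J)]
  ring


theorem fbd (q c : ℂ) (n : ℕ) : Fb q c n = 1 - c*q^n := by unfold Fb; rfl

theorem ffI' {q J O P : ℂ} {N : ℕ} (g : Gf q J O P (N+1)) (n x u : ℕ) (hn : n ≤ N) (hx : x + u = N+1) :
    Fb q (J*O) (x+x+1) * Fb q O 1 * Fb q (J*O*P) (N+3) * Fb q 1 (N+1) * ff q J O P (N+1) (n+1) x =
    Fb q (J*O) (x+1) * Fb q O (x+1) * Fb q (J*O*P) (x+N+3) * Fb q 1 u * ff q J (q*O) (q*P) N n x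
    - q*O*Fb q 1 x * Fb q J x * Fb q P (u+1) * Fb q (J*O) (x+N+2) * ff q J (q*O) (q*P) N n (x-1) := by
  have := ffI g n x hn _ _ _ _ _ rfl rfl rfl rfl rfl
  have hq := g.hq
  have h1 := g.h1
  have h2 := g.h2
  generalize ff q J O P (N+1) (n+1) x = f, ff q J (q*O) (q*P) N n x = f1, ff q J (q*O) (q*P) N n (x-1) = f2 at *
  simp only [fbd]
  have e1 : q^(N+1) = q^x*q^u := by rw [← hx]; ring
  have e2 : q^N = q^x*q^u/q := by rw [← e1, pow_succ]; field_simp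
  have hX : q^x ≠ 0 := by simp [hq]
  have hU : q^u ≠ 0 := by simp [hq]
  simp only [pow_add, e2, pow_one] at this ⊢
  generalize q^x = X, q^u = U at *
  field_simp at this
  apply mul_left_cancel₀ (mul_ne_zero hX (mul_ne_zero h1 h2))
  apply mul_left_cancel₀ (mul_ne_zero (mul_ne_zero hX hU) hq)
  field_simp
  linear_combination this

theorem ffT1' {q J O P : ℂ} {N : ℕ} (g : Gf q J O P (N+1)) (n x u : ℕ) (hn : n ≤ N) (hx : x + u = N+1) :
    Fb q (J*O) (x+x+1) * Fb q 1 (N+1) * ff q J O P (N+1) n x =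
    q^x * Fb q 1 u * Fb q (J*O) (x+1) * ff q (q*J) O P N n x
    + Fb q (J*O) (x+N+2) * Fb q 1 x * ff q (q*J) O P N n (x-1) := by
  have := ffT1 g n x hn
  have hq := g.hq
  generalize ff q J O P (N+1) n x = f, ff q (q*J) O P N n x = f1, ff q (q*J) O P N n (x-1) = f2 at *
  simp only [fbd]
  have e1 : q^(N+1) = q^x*q^u := by rw [← hx]; ring
  have e2 : q^N = q^x*q^u/q := by rw [← e1, pow_succ]; field_simp
  have hX : q^x ≠ 0 := by simp [hq]
  have hU : q^u ≠ 0 := by simp [hq]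
  simp only [pow_add, e2, pow_one] at this ⊢
  generalize q^x = X, q^u = U at *
  field_simp at this
  field_simp
  linear_combination this

theorem ffT2' {q J O P : ℂ} {N : ℕ} (g : Gf q J O P N) (n x u : ℕ) (hn : n ≤ N) (hx : x + u = N) :
    Fb q (J*O) (x+x+1) * Fb q (J*O*P) (N+2) * ff q J O P N n x =
    Fb q (J*O*P) (x+N+2) * Fb q (J*O) (x+1) * ff q (q*J) O P N n x
    + J*O*q^(x+1)*Fb q P (u+1) * Fb q 1 x * ff q (q*J) O P N n (x-1) := by
  have := ffT2 g n x hn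
  have hq := g.hq
  generalize ff q J O P N n x = f, ff q (q*J) O P N n x = f1, ff q (q*J) O P N n (x-1) = f2 at *
  simp only [fbd]
  subst hx
  have hX : q^x ≠ 0 := by simp [hq]
  simp only [pow_add, pow_one] at this ⊢
  generalize q^x = X, q^u = U at *
  field_simp at this
  linear_combination -this

theorem ff_fs' {q J O P : ℂ} {N : ℕ} (g : Gf q J O P (N+1)) (m x : ℕ) (hm : m ≤ N+1) :
    ff q J O P (N+1) m (x+1) - ff q J O P (N+1) m x =
     q^(N+1)*Fb q (J*O) (x+x+1+1) * Fb q 1 m * Fb q (O*P) (m+1) / (q^x*q^m*Fb q O 1 * Fb q (J*O*P) (N+3) * Fb q 1 (N+1))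
       * (-1) * ff q J (q*O) (q*P) N (m-1) x := by
  have hq := g.hq
  rcases m with _ | m
  · simp [ff_zero, fbd]
  rw [ff_fs g m x (by omega)]
  simp only [Nat.add_sub_cancel]
  congr 1
  have b1 := g.f0 N (by omega)
  have b2 := g.f2 0 (by omega)
  have b3 := g.f123 (N+2) (by omega)
  have e : 1 - (q^(N+1))⁻¹ = - Fb q 1 (N+1) / q^(N+1) := by rw [fbd]; field_simp; ring
  have e1 : 1 - (q^(m+1))⁻¹ = - Fb q 1 (m+1) / q^(m+1) := by rw [fbd]; field_simp; ring
  have e2 : J*O*q^(x+1) - (q^(x+1))⁻¹ = - Fb q (J*O) (x+x+1+1)/q^(x+1) := by rw [fbd]; field_simp; ring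
  rw [e, e1, e2, show 1-q*O = Fb q O 1 by rw [fbd]; ring, show 1-J*O*P*q^(N+3) = Fb q (J*O*P) (N+3) by rw [fbd],
    show 1-O*P*q^(m+2) = Fb q (O*P) (m+1+1) by rw [fbd]]
  generalize Fb q (J*O*P) (N+3) = v1, Fb q 1 (N+1) = v2, Fb q O 1 = v3, Fb q (J*O) (x+x+1+1) = v4, Fb q (O*P) (m+1+1) = v5, Fb q 1 (m+1) = v6 at *
  field_simp
  ring

theorem Gf.sh23 {q J O P : ℂ} {N : ℕ} (g : Gf q J O P (N+1)) : Gf q J (q*O) (q*P) N where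
  hq := g.hq
  h1 := g.h1
  h2 := mul_ne_zero g.hq g.h2
  h3 := mul_ne_zero g.hq g.h3
  hQ k h h' := g.hQ k h (by omega)
  n1 k h h' := g.n1 k h (by omega)
  n2 k h h' := by rw [show q*O*q^k = O*q^(k+1) by ring]; exact g.n2 _ (by omega) (by omega)
  n3 k h h' := by rw [show q*P*q^k = P*q^(k+1) by ring]; exact g.n3 _ (by omega) (by omega)
  n12 k h h' := by rw [show J*(q*O)*q^k = J*O*q^(k+1) by ring]; exact g.n12 _ (by omega) (by omega)
  n23 k h h' := by rw [show q*O*(q*P)*q^k = O*P*q^(k+2) by ring]; exact g.n23 _ (by omega) (by omega)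
  n123 k h h' := by rw [show J*(q*O)*(q*P)*q^k = J*O*P*q^(k+2) by ring]; exact g.n123 _ (by omega) (by omega)
theorem Gf.sh3 {q J O P : ℂ} {N : ℕ} (g : Gf q J O P (N+1)) : Gf q J O (q*P) N where
  hq := g.hq
  h1 := g.h1
  h2 := g.h2
  h3 := mul_ne_zero g.hq g.h3
  hQ k h h' := g.hQ k h (by omega)
  n1 k h h' := g.n1 k h (by omega)
  n2 k h h' := g.n2 _ (by omega) (by omega)
  n3 k h h' := by rw [show q*P*q^k = P*q^(k+1) by ring]; exact g.n3 _ (by omega) (by omega)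
  n12 k h h' := g.n12 _ (by omega) (by omega)
  n23 k h h' := by rw [show O*(q*P)*q^k = O*P*q^(k+1) by ring]; exact g.n23 _ (by omega) (by omega)
  n123 k h h' := by rw [show J*O*(q*P)*q^k = J*O*P*q^(k+1) by ring]; exact g.n123 _ (by omega) (by omega)


theorem fb10 (q : ℂ) : Fb q 1 0 = 0 := by rw [fbd]; simp

theorem OA {q J O P : ℂ} {N : ℕ} (g : Gf q J O P (N+1)) (x u : ℕ) (h : x+u = N) :
   om1 q P O J x (u+1) * (Fb q (J*O) (x+1) * Fb q O (x+1) * Fb q (J*O*P) (x+N+3) * Fb q 1 (u+1)) * Fb q (J*O) (x+x+1+1)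
    = om1 q (q*P) (q*O) J x u * Fb q P 1 * q^x * (Fb q (J*O) (x+x+1) * (Fb q O 1 * Fb q (J*O*P) (N+3) * Fb q 1 (N+1))) := by
  have := om1_sh23 g g.sh23 x u (by omega)
  rw [mul_comm O J, show P*O*J = J*O*P by ring, show x+x+u+1+1+1 = x+N+3 by omega, show x+u+1+1+1 = N+3 by omega,
    show x+u+1 = N+1 by omega] at this
  linear_combination -this

theorem OB {q J O P : ℂ} {N : ℕ} (g : Gf q J O P (N+1)) (x u : ℕ) (h : x+u = N) :
   om1 q P O J (x+1) u * (q*O*Fb q 1 (x+1) * Fb q J (x+1) * Fb q P (u+1) * Fb q (J*O) (x+1+N+2)) * Fb q (J*O) (x+x+1+1)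
    = om1 q (q*P) (q*O) J x u * Fb q P 1 * q^x * (Fb q (J*O) (x+1+(x+1)+1) * (Fb q O 1 * Fb q (J*O*P) (N+3) * Fb q 1 (N+1))) := by
  have h1 := OA g x u h
  have h2 := om1_succ_n g.symm x u (by omega)
  rw [mul_comm O J, show P*O*J = J*O*P by ring, show x+x+u+1+1+1 = x+N+3 by omega] at h2
  have b := g.f12 (x+x) (by omega)
  rw [show x+1+N+2 = x+N+3 by omega, show x+1+(x+1)+1 = x+x+1+1+1 by omega]
  apply mul_left_cancel₀ b
  linear_combination Fb q (J*O) (x+x+1+1+1) * h1 + Fb q (J*O) (x+x+1+1) * h2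

theorem Ostep {q J O P : ℂ} {N : ℕ} (g : Gf q J O P (N+1)) (n : ℕ) (hn : n ≤ N) (h : ℕ → ℂ) :
    ∑ x ∈ range (N+1+1), om1 q P O J x (N+1-x) * ff q J O P (N+1) (n+1) x * h x =
    ∑ x ∈ range (N+1), om1 q (q*P) (q*O) J x (N-x) * ff q J (q*O) (q*P) N n x *
      (Fb q P 1 * q^x * (h x - h (x+1)) / Fb q (J*O) (x+x+1+1)) := by
  have b1 := g.f0 N (by omega)
  have b2 := g.f2 0 (by omega)
  have b3 := g.f123 (N+2) (by omega)
  have key : ∀ x ∈ range (N+1+1), om1 q P O J x (N+1-x) * ff q J O P (N+1) (n+1) x * h x =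
     om1 q P O J x (N+1-x) * (Fb q (J*O) (x+1) * Fb q O (x+1) * Fb q (J*O*P) (x+N+3) * Fb q 1 (N+1-x))
      / (Fb q (J*O) (x+x+1) * (Fb q O 1 * Fb q (J*O*P) (N+3) * Fb q 1 (N+1))) *  ff q J (q*O) (q*P) N n x * h x
     - om1 q P O J x (N+1-x) * (q*O*Fb q 1 x * Fb q J x * Fb q P (N+1-x+1) * Fb q (J*O) (x+N+2))
      / (Fb q (J*O) (x+x+1) * (Fb q O 1 * Fb q (J*O*P) (N+3) * Fb q 1 (N+1))) *  ff q J (q*O) (q*P) N n (x-1) * h x := by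
    intro x hx
    have hx : x ≤ N+1 := by simpa [Nat.lt_succ_iff] using hx
    have := ffI' g n x (N+1-x) hn (by omega)
    have b := g.f12 (x+x) (by omega)
    have : ff q J O P (N+1) (n+1) x = (Fb q (J*O) (x+1) * Fb q O (x+1) * Fb q (J*O*P) (x+N+3) * Fb q 1 (N+1-x) * ff q J (q*O) (q*P) N n x
    - q*O*Fb q 1 x * Fb q J x * Fb q P (N+1-x+1) * Fb q (J*O) (x+N+2) * ff q J (q*O) (q*P) N n (x-1)) / (Fb q (J*O) (x+x+1) * (Fb q O 1 * Fb q (J*O*P) (N+3) * Fb q 1 (N+1))) := by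
      rw [← this, eq_div_iff]
      · ring
      · exact mul_ne_zero b (mul_ne_zero (mul_ne_zero b2 b3) b1)
    rw [this]; ring
  rw [sum_congr rfl key, sum_sub_distrib, sum_range_succ, sum_range_succ' _ (N+1)]
  simp only [Nat.sub_self, fb10, mul_zero, zero_mul, zero_div, add_zero, sub_zero]
  rw [← sum_sub_distrib]
  apply sum_congr rfl
  intro x hx
  have hx : x ≤ N := by simpa [Nat.lt_succ_iff] using hx
  obtain ⟨u, rfl⟩ : ∃ u, N = x+u := ⟨N-x, by omega⟩
  have h1 := OA g x u rfl
  have h2 := OB g x u rfl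
  have b4 := g.f12 (x+x) (by omega)
  have b5 := g.f12 (x+x+1) (by omega)
  have b6 := g.f12 (x+1+(x+1)) (by omega)
  rw [show x+u+1-x = u+1 by omega, show x+u+1-(x+1) = u by omega, show x+u-x = u by omega, show x+1-1 = x by omega]
  rw [← eq_div_iff b5] at h1 h2
  rw [h1, h2]
  have hne := mul_ne_zero (mul_ne_zero b2 b3) b1
  simp only [zero_add] at hne
  rw [show x+u+2+1 = x+u+3 by omega] at hne
  generalize Fb q O 1 * Fb q (J*O*P) (x+u+3) * Fb q 1 (x+u+1) = K, Fb q (J*O) (x+x+1) = K1, Fb q (J*O) (x+1+(x+1)+1) = K2 at *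
  field_simp

theorem Ored {q J O P : ℂ} {N : ℕ} (g : Gf q J O P (N+1)) (n m : ℕ) (hn : n ≤ N) (hm : m ≤ N+1) :
    ∑ x ∈ range (N+1+1), om1 q P O J x (N+1-x) * ff q J O P (N+1) (n+1) x * ff q J O P (N+1) m x =
     Fb q P 1 * q^(N+1) * Fb q 1 m * Fb q (O*P) (m+1) / (q^m*Fb q O 1 * Fb q (J*O*P) (N+3) * Fb q 1 (N+1)) *
    ∑ x ∈ range (N+1), om1 q (q*P) (q*O) J x (N-x) * ff q J (q*O) (q*P) N n x * ff q J (q*O) (q*P) N (m-1) x := by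
  have hq := g.hq
  rw [Ostep g n hn, mul_sum]
  apply sum_congr rfl
  intro x hx
  have hx : x ≤ N := by simpa [Nat.lt_succ_iff] using hx
  have := ff_fs' g m x hm
  have b5 := g.f12 (x+x+1) (by omega)
  rw [← neg_sub (ff q J O P (N+1) m (x+1)), this]
  have b1 := g.f0 N (by omega)
  have b2 := g.f2 0 (by omega)
  have b3 := g.f123 (N+2) (by omega)
  rw [zero_add] at b2
  rw [show N+2+1 = N+3 by omega] at b3
  generalize Fb q (J*O*P) (N+3) = v1, Fb q 1 (N+1) = v2, Fb q O 1 = v3, Fb q (J*O) (x+x+1+1) = v4, Fb q (O*P) (m+1) = v5, Fb q 1 m = v6, Fb q P 1 = v7 at *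
  have : q^x ≠ 0 := by simp [hq]
  field_simp


theorem om1_0 {q J O P : ℂ} {N : ℕ} (g : Gf q J O P N) :
    om1 q J O P 0 N = Fb q (O*P) 1 * PP q J N / PP q (O*P) (N+1) := by
  unfold om1
  rw [div_eq_div_iff (g.om1d_ne _ _ (by omega)) (g.P23 _ (by omega))]
  unfold om1n om1d
  simp only [zero_add, PP_zero, pow_zero]
  ring

theorem om1_up {q J O P : ℂ} {N : ℕ} (g : Gf q J O P (N+1)) (n u : ℕ) (h : n+u = N) :
    om1 q J O P (n+1) u * (q*O*Fb q P 1 * q * Fb q 1 (n+1) * Fb q (O*P) (n+1+1)) =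
    om1 q J (q*O) (q*P) n u * (q^(n+1)*Fb q O 1 * Fb q (J*O*P) (N+3) * Fb q 1 (N+1)) := by
  have b3 := g.f3 0 (by omega)
  have b7 := g.f123 0 (by omega)
  have b77 := g.f123 1 (by omega)
  have d1 := g.f2 0 (by omega)
  have d2 := g.f23 0 (by omega)
  have d3 := g.f23 1 (by omega)
  unfold om1
  rw [div_mul_eq_mul_div, div_mul_eq_mul_div, div_eq_div_iff (g.om1d_ne _ _ (by omega)) (g.sh23.om1d_ne _ _ (by omega))]
  unfold om1n om1d
  subst h
  rw [show J*(q*O)*(q*P) = q*(q*(J*O*P)) by ring, show q*O*(q*P) = q*(q*(O*P)) by ring]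
  have e : Fb q (q*(J*O*P)) 1 ≠ 0 := by rw [Fb_shift]; exact b77
  have e' : Fb q (q*(O*P)) 1 ≠ 0 := by rw [Fb_shift]; exact d3
  simp only [← add_assoc, add_right_comm _ 1 n, add_right_comm _ 1 u]
  rw [show n+u+3 = n+u+1+1+1 by rfl]
  simp only [PP_succ' q P _ b3, PP_succ' q O _ d1, PP_succ' q (J*O*P) _ b7, PP_succ' q (q*(J*O*P)) _ e]
  simp only [PP_succ' q (O*P) _ d2, PP_succ' q (q*(O*P)) _ e']
  rw [PP_succ _ _ (n+u)]
  obtain ⟨v, e3, e4⟩ := PP_pair q (q*(O*P)) n e'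
  simp only [e3, e4, mul_pow, Fb_shift, PP_succ, pow_succ]
  ring

theorem Zstep {q J O P : ℂ} {N : ℕ} (g : Gf q J O P (N+1)) :
    ∑ x ∈ range (N+1+1), om1 q P O J x (N+1-x) =
    Fb q (O*P) 2 / (O*q*Fb q J (N+1)) * ∑ x ∈ range (N+1), om1 q (q*P) O J x (N-x) := by
  have hq := g.hq
  have h2 := g.h2
  have b1 := g.f0 N (by omega)
  have b2 := g.f1 N (by omega)
  have b3 := g.f3 0 (by omega)
  rw [zero_add] at b3
  have tel : ∀ K, K ≤ N+1 → ∑ x ∈ range K, om1 q P O J x (N+1-x) =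
     Fb q (O*P) 2 / (O*q*Fb q J (N+1)) * ∑ x ∈ range K, om1 q (q*P) O J x (N-x)
      - om1 q P O J K (N+1-K) * (Fb q 1 K * Fb q J K * Fb q (J*O) (K+N+2) * Fb q P (N+1-K+1)) /
       (Fb q 1 (N+1) * Fb q J (N+1) * Fb q P 1 * Fb q (J*O) (K+K+1)) := by
    intro K
    induction K with
    | zero => intro _; simp [fb10]
    | succ x ih =>
      intro hx
      rw [sum_range_succ, sum_range_succ _ x, ih (by omega), mul_add]
      obtain ⟨u, rfl⟩ : ∃ u, N = x+u := ⟨N-x, by omega⟩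
      rw [show x+u+1-x = u+1 by omega, show x+u+1-(x+1) = u by omega, show x+u-x = u by omega]
      have h1 := om1_sh3 g g.sh3 x u le_rfl
      have h3 := om1_succ_n g.symm x u (by omega)
      have b4 := g.f12 (x+x) (by omega)
      have b5 := g.f12 (x+1+(x+1)) (by omega)
      have b6 := g.f12 (x+x+u+1+1) (by omega)
      have b7 := g.f3 u (by omega)
      have b8 := g.f0 x (by omega)
      have b9 := g.f1 x (by omega)
      rw [mul_comm O J] at h1 h3
      rw [show P*O*J = J*O*P by ring] at h3
      rw [show x+1+(x+u)+2 = x+x+u+1+1+1 by omega, show x+(x+u)+2 = x+x+u+1+1 by omega]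
      rw [show x+1+(x+1)+1 = x+x+1+1+1 by omega] at *
      have h3' : om1 q P O J (x+1) u * (Fb q 1 (x+1) * Fb q J (x+1) * Fb q (J*O) (x+x+u+1+1+1) * Fb q P (u+1)) /
       (Fb q 1 (x+u+1) * Fb q J (x+u+1) * Fb q P 1 * Fb q (J*O) (x+x+1+1+1))
       = om1 q P O J x (u+1) * (Fb q 1 (u+1) * Fb q O (x+1) * Fb q (J*O*P) (x+x+u+1+1+1) * Fb q (J*O) (x+1)) / 
        (Fb q 1 (x+u+1) * Fb q J (x+u+1) * Fb q P 1 * (q*O*Fb q (J*O) (x+x+1))) := by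
        rw [div_eq_div_iff]
        · linear_combination Fb q 1 (x+u+1) * Fb q J (x+u+1) * Fb q P 1 * h3
        · exact mul_ne_zero (mul_ne_zero (mul_ne_zero b1 b2) b3) b5
        · exact mul_ne_zero (mul_ne_zero (mul_ne_zero b1 b2) b3) (mul_ne_zero (mul_ne_zero hq h2) b4)
      rw [h3']
      rw [← eq_div_iff (mul_ne_zero b1 b3)] at h1
      rw [h1]
      clear h1 h3 h3' b5 b6 b7 b8 b9 ih hx
      generalize om1 q P O J x (u+1) = w
      have key : Fb q (J*O) (x+x+1) * (Fb q 1 (x+u+1) * Fb q J (x+u+1) * Fb q P 1 *(q*O)) =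
         Fb q (O*P) 2 * Fb q 1 (u+1) * Fb q (J*O) (x+x+u+1+1) * Fb q (J*O) (x+x+1)
         - Fb q 1 (u+1) * Fb q O (x+1) * Fb q (J*O*P) (x+x+u+1+1+1) * Fb q (J*O) (x+1)
         + q*O*Fb q 1 x * Fb q J x * Fb q (J*O) (x+x+u+1+1) * Fb q P (u+1+1) := by
        simp only [fbd]; ring
      generalize Fb q (J*O) (x+x+1) = v1, Fb q 1 (x+u+1) = v2, Fb q J (x+u+1) = v3, Fb q P 1 = v4, Fb q (O*P) 2 = v5, Fb q 1 (u+1) = v6, Fb q (J*O) (x+x+u+1+1) = v7, Fb q (J*O*P) _ = v8, Fb q (J*O) (x+1) = v9, Fb q O (x+1) = v10 at *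
      field_simp
      linear_combination (w) * key
  rw [sum_range_succ, tel (N+1) le_rfl]
  have b4 := g.f12 (N+1+(N+1)) (by omega)
  rw [show N+1-(N+1) = 0 by omega, zero_add]
  rw [show N+1+N+2 = N+1+(N+1)+1 by omega]
  generalize Fb q (J*O) (N+1+(N+1)+1) = v1 at *
  field_simp
  ring

theorem Zval (N : ℕ) : ∀ {q J O P : ℂ} (g : Gf q J O P N), 
    (∑ x ∈ range (N+1), om1 q P O J x (N-x)) * (q*O)^N = 1 / om1 q J O P 0 N := by
  induction N with
  | zero => 
    intro q J O P g
    have := g.f23 0 (by omega)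
    have h2 := g.f12 0 (by omega)
    rw [mul_comm] at h2
    simp [om1_0 g, om1_0 g.symm, PP_succ, PP_zero]
    simp at this h2
    field_simp
  | succ N ih =>
    intro q J O P g
    have hq := g.hq
    have h2 := g.h2
    have := ih g.sh3
    rw [om1_0 g.sh3] at this
    rw [Zstep g, om1_0 g]
    have hp := g.P1 N (by omega)
    have b0 := g.f23 0 (by omega)
    have b1 := g.f1 N (by omega)
    have b2 := g.f23 1 (by omega)
    rw [PP_succ' _ _ _ b0, PP_succ q J]
    rw [show O*(q*P) = q*(O*P) by ring, Fb_shift] at this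
    rw [pow_succ, show ∀ a b d e f : ℂ, a * b * (d*(e*f)) = a*e*f*(b*d) by intros; ring, this]
    simp only [zero_add] at *
    generalize Fb q (O*P) 1 = v1 at *
    rw [show (1+1)=2 by rfl] at *
    generalize Fb q (O*P) 2 = v2, Fb q J (N+1) = v3, PP q J N = v4 at *
    field_simp

theorem Oth (N : ℕ) : ∀ {q J O P : ℂ} (g : Gf q J O P N) (n m : ℕ) (hn : n ≤ N) (hm : m ≤ N),
    (∑ x ∈ range (N+1), om1 q P O J x (N-x) * ff q J O P N n x * ff q J O P N m x) * (q*O)^N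
     = if n = m then 1 / om1 q J O P n (N-n) else 0 := by
  induction N with
  | zero => 
    intro q J O P g n m hn hm
    obtain rfl : n = 0 := by omega
    obtain rfl : m = 0 := by omega
    have := Zval 0 g
    simpa [ff_zero] using this
  | succ N ih =>
    intro q J O P g n m hn hm
    rcases n with _ | n
    · rcases m with _ | m
      · have := Zval _ g
        simpa [ff_zero] using this
      · have := Ored g m 0 (by omega) (by omega)
        rw [fb10] at this
        simp only [mul_zero, zero_mul, zero_div] at this
        rw [if_neg (by omega)]
        simp only [mul_right_comm _ (ff q J O P (N+1) 0 _)] 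
        rw [this, zero_mul]
    · rw [Ored g n m (by omega) hm]
      rcases m with _ | m
      · rw [fb10]; simp
      · have := ih g.sh23 n m (by omega) (by omega)
        have hq := g.hq
        have h2 := g.h2
        have e : q^N ≠ 0 := by simp [hq]
        have b1 := g.f0 N (by omega)
        have b2 := g.f2 0 (by omega)
        have b3 := g.f123 (N+2) (by omega)
        rw [zero_add] at b2
        rw [show N+2+1 = N+3 by omega] at b3
        simp only [Nat.add_sub_cancel]
        rw [mul_assoc, pow_succ (q*O), show (q*O)^N = (q*(q*O))^N / q^N by rw [mul_pow q (q*O)]; field_simp,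
          show ∀ a b d e : ℂ, a*(b/d*e) = a*b/d*e by intros; ring, this]
        by_cases hnm : n = m
        · subst hnm
          simp only [if_true]
          have := om1_up g n (N-n) (by omega)
          have hx := g.om1_ne (n+1) (N-n) (by omega)
          have hy := g.sh23.om1_ne n (N-n) (by omega)
          rw [show N+1-(n+1) = N-n by omega]
          generalize om1 q J O P (n+1) (N-n) = w, om1 q J (q*O) (q*P) n (N-n) = w', Fb q (J*O*P) (N+3) = v1, Fb q 1 (N+1) = v2, Fb q O 1 = v3, Fb q 1 (n+1) = v6, Fb q P 1 = v7, Fb q (O*P) (n+1+1) = v5 at *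
          field_simp
          linear_combination q^N * this
        · rw [if_neg hnm, if_neg (by omega)]; simp


structure Gen (q o J O P S : ℂ) (N : ℕ) : Prop where
  hq : q ≠ 0
  rel : o*J*O*P*S*q^(2*N+3) = 1
  hQ : ∀ k, 1 ≤ k → k ≤ N → 1 - q^k ≠ 0
  gen : ∀ e0 e1 e2 e3 e4 : ℕ, e0 ≤ 1 → e1 ≤ 1 → e2 ≤ 1 → e3 ≤ 1 → e4 ≤ 1 →
      1 ≤ e0 + e1 + e2 + e3 + e4 → e0 + e1 + e2 + e3 + e4 ≤ 4 →
      ∀ k, 1 ≤ k → k ≤ 2*N+5 → 1 - o^e0 * J^e1 * O^e2 * P^e3 * S^e4 * q^k ≠ 0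

theorem Gen.h0 {q o J O P S : ℂ} {N : ℕ} (g : Gen q o J O P S N) : o ≠ 0 := by
  rintro rfl; have := g.rel; simp at this
theorem Gen.h1 {q o J O P S : ℂ} {N : ℕ} (g : Gen q o J O P S N) : J ≠ 0 := by
  rintro rfl; have := g.rel; simp at this
theorem Gen.h2 {q o J O P S : ℂ} {N : ℕ} (g : Gen q o J O P S N) : O ≠ 0 := by
  rintro rfl; have := g.rel; simp at this
theorem Gen.h3 {q o J O P S : ℂ} {N : ℕ} (g : Gen q o J O P S N) : P ≠ 0 := by
  rintro rfl; have := g.rel; simp at this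
theorem Gen.h4 {q o J O P S : ℂ} {N : ℕ} (g : Gen q o J O P S N) : S ≠ 0 := by
  rintro rfl; have := g.rel; simp at this

theorem Gen.sw {q o J O P S : ℂ} {N : ℕ} (g : Gen q o J O P S N) : Gen q S J P O o N where
  hq := g.hq
  rel := by linear_combination g.rel
  hQ := g.hQ
  gen e0 e1 e2 e3 e4 h0 h1 h2 h3 h4 ha hb k hk hk' := by
    have := g.gen e4 e1 e3 e2 e0 h4 h1 h3 h2 h0 (by omega) (by omega) k hk hk'
    rwa [show S^e0*J^e1*P^e2*O^e3*o^e4 = o^e4*J^e1*O^e3*P^e2*S^e0 by ring]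

theorem Gen.s04 {q o J O P S : ℂ} {N : ℕ} (g : Gen q o J O P S (N+1)) : Gen q (q*o) J O P (q*S) N where
  hq := g.hq
  rel := by have := g.rel; linear_combination this
  hQ k h h' := g.hQ k h (by omega)
  gen e0 e1 e2 e3 e4 h0 h1 h2 h3 h4 ha hb k hk hk' := by
    have := g.gen e0 e1 e2 e3 e4 h0 h1 h2 h3 h4 ha hb (k+e0+e4) (by omega) (by omega)
    rwa [show (q*o)^e0*J^e1*O^e2*P^e3*(q*S)^e4*q^k = o^e0*J^e1*O^e2*P^e3*S^e4*q^(k+e0+e4) by ring]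
theorem Gen.s03 {q o J O P S : ℂ} {N : ℕ} (g : Gen q o J O P S (N+1)) : Gen q (q*o) J O (q*P) S N where
  hq := g.hq
  rel := by have := g.rel; linear_combination this
  hQ k h h' := g.hQ k h (by omega)
  gen e0 e1 e2 e3 e4 h0 h1 h2 h3 h4 ha hb k hk hk' := by
    have := g.gen e0 e1 e2 e3 e4 h0 h1 h2 h3 h4 ha hb (k+e0+e3) (by omega) (by omega)
    rwa [show (q*o)^e0*J^e1*O^e2*(q*P)^e3*S^e4*q^k = o^e0*J^e1*O^e2*P^e3*S^e4*q^(k+e0+e3) by ring]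
theorem Gen.s24 {q o J O P S : ℂ} {N : ℕ} (g : Gen q o J O P S (N+1)) : Gen q o J (q*O) P (q*S) N :=
  g.sw.s03.sw
theorem Gen.s02 {q o J O P S : ℂ} {N : ℕ} (g : Gen q o J O P S (N+1)) : Gen q (q*o) J (q*O) P S N where
  hq := g.hq
  rel := by have := g.rel; linear_combination this
  hQ k h h' := g.hQ k h (by omega)
  gen e0 e1 e2 e3 e4 h0 h1 h2 h3 h4 ha hb k hk hk' := by
    have := g.gen e0 e1 e2 e3 e4 h0 h1 h2 h3 h4 ha hb (k+e0+e2) (by omega) (by omega)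
    rwa [show (q*o)^e0*J^e1*(q*O)^e2*P^e3*S^e4*q^k = o^e0*J^e1*O^e2*P^e3*S^e4*q^(k+e0+e2) by ring]
theorem Gen.s34 {q o J O P S : ℂ} {N : ℕ} (g : Gen q o J O P S (N+1)) : Gen q o J O (q*P) (q*S) N :=
  g.sw.s02.sw
theorem Gen.s23 {q o J O P S : ℂ} {N : ℕ} (g : Gen q o J O P S (N+1)) : Gen q o J (q*O) (q*P) S N where
  hq := g.hq
  rel := by have := g.rel; linear_combination this
  hQ k h h' := g.hQ k h (by omega)
  gen e0 e1 e2 e3 e4 h0 h1 h2 h3 h4 ha hb k hk hk' := by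
    have := g.gen e0 e1 e2 e3 e4 h0 h1 h2 h3 h4 ha hb (k+e2+e3) (by omega) (by omega)
    rwa [show o^e0*J^e1*(q*O)^e2*(q*P)^e3*S^e4*q^k = o^e0*J^e1*O^e2*P^e3*S^e4*q^(k+e2+e3) by ring]

theorem Gf.mono {q J O P : ℂ} {N M : ℕ} (g : Gf q J O P N) (h : M ≤ N) : Gf q J O P M where
  hq := g.hq
  h1 := g.h1
  h2 := g.h2
  h3 := g.h3
  hQ k h h' := g.hQ k h (by omega)
  n1 k h h' := g.n1 k h (by omega)
  n2 k h h' := g.n2 k h (by omega)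
  n3 k h h' := g.n3 k h (by omega)
  n12 k h h' := g.n12 k h (by omega)
  n23 k h h' := g.n23 k h (by omega)
  n123 k h h' := g.n123 k h (by omega)

theorem Gen.a {q o J O P S : ℂ} {N : ℕ} (g : Gen q o J O P S N) : Gf q J O P N where
  hq := g.hq
  h1 := g.h1
  h2 := g.h2
  h3 := g.h3
  hQ k h h' := g.hQ k h (by omega)
  n1 k h h' := by simpa using g.gen 0 1 0 0 0 (by simp) (by simp) (by simp) (by simp) (by simp) (by simp) (by simp) k h (by omega)
  n2 k h h' := by simpa using g.gen 0 0 1 0 0 (by simp) (by simp) (by simp) (by simp) (by simp) (by simp) (by simp) k h (by omega)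
  n3 k h h' := by simpa using g.gen 0 0 0 1 0 (by simp) (by simp) (by simp) (by simp) (by simp) (by simp) (by simp) k h (by omega)
  n12 k h h' := by simpa using g.gen 0 1 1 0 0 (by simp) (by simp) (by simp) (by simp) (by simp) (by simp) (by simp) k h (by omega)
  n23 k h h' := by simpa using g.gen 0 0 1 1 0 (by simp) (by simp) (by simp) (by simp) (by simp) (by simp) (by simp) k h (by omega)
  n123 k h h' := by simpa using g.gen 0 1 1 1 0 (by simp) (by simp) (by simp) (by simp) (by simp) (by simp) (by simp) k h (by omega)
/-- triple (S,O,J) -/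
theorem Gen.c {q o J O P S : ℂ} {N : ℕ} (g : Gen q o J O P S N) : Gf q S O J N :=
  (show Gen q P J O S o N from ⟨g.hq, by linear_combination g.rel, g.hQ, fun e0 e1 e2 e3 e4 h0 h1 h2 h3 h4 ha hb k hk hk' => by
    have := g.gen e4 e1 e2 e0 e3 h4 h1 h2 h0 h3 (by omega) (by omega) k hk hk'
    rwa [show P^e0*J^e1*O^e2*S^e3*o^e4 = o^e4*J^e1*O^e2*P^e0*S^e3 by ring]⟩).a.symm
/-- triple (P,o,S) -/
theorem Gen.b {q o J O P S : ℂ} {N : ℕ} (g : Gen q o J O P S N) : Gf q P o S N :=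
  (show Gen q J P o S O N from ⟨g.hq, by linear_combination g.rel, g.hQ, fun e0 e1 e2 e3 e4 h0 h1 h2 h3 h4 ha hb k hk hk' => by
    have := g.gen e2 e0 e4 e1 e3 h2 h0 h4 h1 h3 (by omega) (by omega) k hk hk'
    rwa [show J^e0*P^e1*o^e2*S^e3*O^e4 = o^e2*J^e0*O^e4*P^e1*S^e3 by ring]⟩).a

def W1n (q o J O P S : ℂ) (a j u v : ℕ) : ℂ :=
  Fb q (J*O) (a+a+1) * PP q O a * PP q (J*O) a * PP q P u * PP q S v * PP q 1 (j+u)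
    * PP q (o*P*S) (j+j+u+1) * PP q (J*O*S) (a+a+v+1) * PP q 1 (a+v)
def W1d (q o J O P S : ℂ) (a j u v : ℕ) : ℂ :=
  PP q J a * PP q 1 a * PP q 1 u * PP q 1 v * PP q (o*P*S) (j+u+1) * PP q (o*S) (j+j+u+1)
   * PP q (J*O) (a+a+v+1) * PP q (J*O*S) (a+v+1)
def W1 (q o J O P S : ℂ) (a j u v : ℕ) : ℂ := W1n q o J O P S a j u v / W1d q o J O P S a j u v

theorem Gen.P034 {q o J O P S : ℂ} {N : ℕ} (g : Gen q o J O P S N) (n : ℕ) (hn : n ≤ 2*N+5) : PP q (o*P*S) n ≠ 0 := by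
  have := g.b.P123 n hn; rwa [mul_comm P] at this
theorem Gen.P04 {q o J O P S : ℂ} {N : ℕ} (g : Gen q o J O P S N) (n : ℕ) (hn : n ≤ 2*N+5) : PP q (o*S) n ≠ 0 :=
  g.b.P23 n hn
theorem Gen.P124 {q o J O P S : ℂ} {N : ℕ} (g : Gen q o J O P S N) (n : ℕ) (hn : n ≤ 2*N+5) : PP q (J*O*S) n ≠ 0 := by
  have := g.c.symm.P123 n hn; exact this
theorem Gen.f034 {q o J O P S : ℂ} {N : ℕ} (g : Gen q o J O P S N) (n : ℕ) (hn : n+1 ≤ 2*N+5) : Fb q (o*P*S) (n+1) ≠ 0 := by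
  have := g.b.f123 n hn; rwa [mul_comm P] at this
theorem Gen.f04 {q o J O P S : ℂ} {N : ℕ} (g : Gen q o J O P S N) (n : ℕ) (hn : n+1 ≤ 2*N+5) : Fb q (o*S) (n+1) ≠ 0 :=
  g.b.f23 n hn
theorem Gen.f124 {q o J O P S : ℂ} {N : ℕ} (g : Gen q o J O P S N) (n : ℕ) (hn : n+1 ≤ 2*N+5) : Fb q (J*O*S) (n+1) ≠ 0 :=
  g.c.symm.f123 n hn

theorem Gen.W1d_ne {q o J O P S : ℂ} {N : ℕ} (g : Gen q o J O P S N) (a j u v : ℕ) (h : a+v ≤ N) (h' : j+u ≤ N) :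
    W1d q o J O P S a j u v ≠ 0 := by
  unfold W1d
  have a1 := q1 q g.hQ a (by omega)
  have a2 := q1 q g.hQ u (by omega)
  have a3 := q1 q g.hQ v (by omega)
  have a4 := g.P034 (j+u+1) (by omega)
  have a5 := g.P04 (j+j+u+1) (by omega)
  have a6 := g.a.P12 (a+a+v+1) (by omega)
  have a7 := g.P124 (a+v+1) (by omega)
  have a8 := g.a.P1 a (by omega)
  simp [*]

theorem W_JA {q o J O P S : ℂ} {N : ℕ} (g : Gen q o J O P S (N+1)) (a j u v : ℕ) (h : a+v ≤ N) (h' : j+u ≤ N) :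
    W1 q (q*o) J O P (q*S) a j u v * (Fb q S 1 * Fb q 1 (j+u+1) * Fb q (o*P*S) (j+u+3) * Fb q 1 (a+v+1)) =
    W1 q o J O P S a (j+1) u (v+1) * (Fb q 1 (v+1) * Fb q (J*O) (a+a+v+2) * Fb q (o*S) 1 * Fb q (o*S) 2) := by
  unfold W1
  rw [div_mul_eq_mul_div, div_mul_eq_mul_div, div_eq_div_iff (g.s04.W1d_ne _ _ _ _ h h') (g.W1d_ne _ _ _ _ (by omega) (by omega))]
  have b4 := g.c.f1 0 (by omega)
  have b1 := g.f034 0 (by omega)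
  have b2 := g.f034 1 (by omega)
  have b3 := g.f04 0 (by omega)
  have b5 := g.f04 1 (by omega)
  have b6 := g.f124 0 (by omega)
  unfold W1n W1d
  rw [show q*o*P*(q*S) = q*(q*(o*P*S)) by ring, show q*o*(q*S) = q*(q*(o*S)) by ring, show J*O*(q*S) = q*(J*O*S) by ring]
  have e : Fb q (q*(o*P*S)) 1 ≠ 0 := by rw [Fb_shift]; exact b2
  have e' : Fb q (q*(o*S)) 1 ≠ 0 := by rw [Fb_shift]; exact b5
  rw [show j+u+3 = j+u+1+1+1 by rfl, show a+a+v+2 = a+a+v+1+1 by rfl]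
  simp only [← add_assoc, add_right_comm _ 1 a, add_right_comm _ 1 u, add_right_comm _ 1 v, add_right_comm _ 1 j]
  simp only [PP_succ' q S _ b4, PP_succ' q (o*P*S) _ b1, PP_succ' q (q*(o*P*S)) _ e, PP_succ' q (o*S) _ b3, PP_succ' q (q*(o*S)) _ e', PP_succ' q (J*O*S) _ b6]
  simp only [PP_succ, Fb_shift]
  ring

theorem W_JB {q o J O P S : ℂ} {N : ℕ} (g : Gen q o J O P S (N+1)) (a j u v : ℕ) (h : a+v ≤ N) (h' : j+u ≤ N) :
    W1 q (q*o) J O P (q*S) a j u v * (Fb q S 1 * Fb q 1 (j+u+1) * Fb q (o*P*S) (j+u+3) * Fb q (J*O*S) (a+v+2)) =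
    W1 q o J O P S a (j+1) u v * (Fb q S (v+1) * Fb q (J*O*S) (a+a+v+2) * Fb q (o*S) 1 * Fb q (o*S) 2) := by
  unfold W1
  rw [div_mul_eq_mul_div, div_mul_eq_mul_div, div_eq_div_iff (g.s04.W1d_ne _ _ _ _ h h') (g.W1d_ne _ _ _ _ (by omega) (by omega))]
  have b4 := g.c.f1 0 (by omega)
  have b1 := g.f034 0 (by omega)
  have b2 := g.f034 1 (by omega)
  have b3 := g.f04 0 (by omega)
  have b5 := g.f04 1 (by omega)
  have b6 := g.f124 0 (by omega)
  unfold W1n W1d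
  rw [show q*o*P*(q*S) = q*(q*(o*P*S)) by ring, show q*o*(q*S) = q*(q*(o*S)) by ring, show J*O*(q*S) = q*(J*O*S) by ring]
  have e : Fb q (q*(o*P*S)) 1 ≠ 0 := by rw [Fb_shift]; exact b2
  have e' : Fb q (q*(o*S)) 1 ≠ 0 := by rw [Fb_shift]; exact b5
  rw [show j+u+3 = j+u+1+1+1 by rfl, show a+a+v+2 = a+a+v+1+1 by rfl, show a+v+2 = a+v+1+1 by rfl]
  simp only [← add_assoc, add_right_comm _ 1 a, add_right_comm _ 1 u, add_right_comm _ 1 v, add_right_comm _ 1 j]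
  simp only [PP_succ' q (o*P*S) _ b1, PP_succ' q (q*(o*P*S)) _ e, PP_succ' q (o*S) _ b3, PP_succ' q (q*(o*S)) _ e']
  obtain ⟨v1, e1, e2⟩ := PP_pair q S v b4
  obtain ⟨v2, e3, e4⟩ := PP_pair q (J*O*S) (a+a+v+1) b6
  obtain ⟨v3, e5, e6⟩ := PP_pair q (J*O*S) (a+v+1) b6
  simp only [e1, e2, e3, e4, e5, e6]
  simp only [PP_succ, Fb_shift]
  ring

theorem W_Y {q o J O P S : ℂ} {N : ℕ} (g : Gen q o J O P S (N+1)) (a u v : ℕ) (h : a+v ≤ N) (h' : u ≤ N) :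
    W1 q (q*o) J O (q*P) S a 0 u v * Fb q P 1 = W1 q o J O P S a 0 (u+1) v * Fb q (o*S) 1 := by
  unfold W1
  rw [div_mul_eq_mul_div, div_mul_eq_mul_div, div_eq_div_iff (g.s03.W1d_ne _ _ _ _ h (by omega)) (g.W1d_ne _ _ _ _ (by omega) (by omega))]
  have b4 := g.a.f3 0 (by omega)
  have b3 := g.f04 0 (by omega)
  unfold W1n W1d
  rw [show q*o*S = q*(o*S) by ring]
  simp only [← add_assoc, zero_add]
  simp only [PP_succ' q P _ b4, PP_succ' q (o*S) _ b3]
  simp only [PP_succ q 1, Fb_shift]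
  ring

theorem W_XA {q o J O P S : ℂ} {N : ℕ} (g : Gen q o J O P S (N+1)) (a u v : ℕ) (h : a+v ≤ N) (h' : u ≤ N) :
    W1 q o J O P S a 0 (u+1) (v+1) * (Fb q (J*O) (a+1) * Fb q O (a+1) * Fb q (J*O*S) (a+a+v+3) * Fb q 1 (v+1) * Fb q (J*O) (a+a+2) * Fb q (o*S) 1) =
    W1 q o J (q*O) P (q*S) a 0 u v * (Fb q S 1 * (Fb q O 1 * Fb q (J*O*S) (a+v+3) * Fb q 1 (a+v+1)) * Fb q P (u+1) * Fb q (J*O) (a+a+1)) := by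
  unfold W1
  rw [div_mul_eq_mul_div, div_mul_eq_mul_div, div_eq_div_iff (g.W1d_ne _ _ _ _ (by omega) (by omega)) (g.s24.W1d_ne _ _ _ _ (by omega) (by omega))]
  have b4 := g.c.f1 0 (by omega)
  have b5 := g.a.f2 0 (by omega)
  have b7 := g.a.f12 0 (by omega)
  have b3 := g.f04 0 (by omega)
  have b6 := g.f124 0 (by omega)
  have b8 := g.f124 1 (by omega)
  unfold W1n W1d
  rw [show J*(q*O)*(q*S) = q*(q*(J*O*S)) by ring, show o*(q*S) = q*(o*S) by ring, show J*(q*O) = q*(J*O) by ring]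
  have e : Fb q (q*(J*O*S)) 1 ≠ 0 := by rw [Fb_shift]; exact b8
  rw [show a+a+v+3 = a+a+v+1+1+1 by rfl, show a+v+3 = a+v+1+1+1 by rfl]
  simp only [← add_assoc, zero_add]
  simp only [PP_succ' q S _ b4, PP_succ' q (o*S) _ b3, PP_succ' q (J*O) _ b7, PP_succ' q (J*O*S) _ b6, PP_succ' q (q*(J*O*S)) _ e]
  obtain ⟨v1, e1, e2⟩ := PP_pair q O a b5
  obtain ⟨v2, e3, e4⟩ := PP_pair q (J*O) a b7
  simp only [e1, e2, e3, e4]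
  simp only [PP_succ, Fb_shift]
  ring

theorem W_succ {q o J O P S : ℂ} {N : ℕ} (g : Gen q o J O P S N) (a u v : ℕ) (h : a+v+1 ≤ N) (h' : u+1 ≤ N) :
    W1 q o J O P S (a+1) 0 u v * (Fb q (J*O) (a+a+1) * Fb q J (a+1) * Fb q 1 (a+1) * Fb q P (u+1) * Fb q S (v+1) * Fb q (J*O) (a+a+v+3)) =
    W1 q o J O P S a 0 (u+1) (v+1) * (Fb q (J*O) (a+a+3) * Fb q O (a+1) * Fb q (J*O) (a+1) * Fb q 1 (v+1) * Fb q (o*S) (u+2) * Fb q (J*O*S) (a+a+v+3)) := by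
  unfold W1
  rw [div_mul_eq_mul_div, div_mul_eq_mul_div, div_eq_div_iff (g.W1d_ne _ _ _ _ (by omega) (by omega)) (g.W1d_ne _ _ _ _ (by omega) (by omega))]
  unfold W1n W1d
  rw [show a+a+v+3 = a+a+v+1+1+1 by rfl, show a+a+3 = a+a+1+1+1 by rfl]
  simp only [← add_assoc, zero_add, add_right_comm _ 1 a, add_right_comm _ 1 v]
  simp only [PP_succ]
  ring

theorem W_IA {q o J O P S : ℂ} {N : ℕ} (g : Gen q o J O P S (N+1)) (a u v : ℕ) (h : a+v ≤ N) (h' : u ≤ N) :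
    W1 q o J O P S a 0 (u+1) (v+1) * (Fb q O (a+1) * Fb q (J*O) (a+a+2) * Fb q (J*O) (a+1) * Fb q 1 (v+1) * Fb q (o*S) (u+2)) =
    W1 q o J (q*O) (q*P) S a 0 u v * (Fb q O 1 * Fb q (J*O) (a+a+1) * Fb q P 1 * Fb q S (v+1) * Fb q 1 (a+v+1)) := by
  unfold W1
  rw [div_mul_eq_mul_div, div_mul_eq_mul_div, div_eq_div_iff (g.W1d_ne _ _ _ _ (by omega) (by omega)) (g.s23.W1d_ne _ _ _ _ (by omega) (by omega))]
  have b4 := g.a.f3 0 (by omega)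
  have b5 := g.a.f2 0 (by omega)
  have b7 := g.a.f12 0 (by omega)
  have b6 := g.f124 0 (by omega)
  unfold W1n W1d
  rw [show J*(q*O)*S = q*(J*O*S) by ring, show J*(q*O) = q*(J*O) by ring]
  simp only [← add_assoc, zero_add]
  simp only [PP_succ' q P _ b4, PP_succ' q (J*O) _ b7, PP_succ' q (J*O*S) _ b6]
  obtain ⟨v1, e1, e2⟩ := PP_pair q O a b5
  obtain ⟨v2, e3, e4⟩ := PP_pair q (J*O) a b7
  simp only [e1, e2, e3, e4]
  simp only [PP_succ, Fb_shift]
  ring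

theorem W_BA {q o J O P S : ℂ} {N : ℕ} (g : Gen q o J O P S (N+1)) (a u v : ℕ) (h : a+v ≤ N) (h' : u ≤ N) :
    W1 q o J O (q*P) (q*S) a 0 u v * (Fb q P 1 * Fb q S 1 * Fb q 1 (a+v+1)) =
    W1 q o J O P S a 0 (u+1) (v+1) * (Fb q 1 (v+1) * Fb q (o*S) 1 * Fb q (J*O) (a+a+v+2)) := by
  unfold W1
  rw [div_mul_eq_mul_div, div_mul_eq_mul_div, div_eq_div_iff (g.s34.W1d_ne _ _ _ _ (by omega) (by omega)) (g.W1d_ne _ _ _ _ (by omega) (by omega))]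
  have b4 := g.a.f3 0 (by omega)
  have b5 := g.c.f1 0 (by omega)
  have b3 := g.f04 0 (by omega)
  have b6 := g.f124 0 (by omega)
  unfold W1n W1d
  rw [show J*O*(q*S) = q*(J*O*S) by ring, show o*(q*S) = q*(o*S) by ring]
  simp only [← add_assoc, zero_add]
  simp only [PP_succ' q P _ b4, PP_succ' q S _ b5, PP_succ' q (o*S) _ b3, PP_succ' q (J*O*S) _ b6]
  simp only [PP_succ, Fb_shift]
  ring

theorem W_BB {q o J O P S : ℂ} {N : ℕ} (g : Gen q o J O P S (N+1)) (a u v : ℕ) (h : a+v ≤ N) (h' : u ≤ N) :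
    W1 q (q*o) J (q*O) P S a 0 u v * (Fb q O 1 * Fb q (J*O) (a+a+1) * Fb q P (u+1) * Fb q S (v+1) * Fb q 1 (a+v+1)) =
    W1 q o J O P S a 0 (u+1) (v+1) * (Fb q O (a+1) * Fb q (J*O) (a+a+2) * Fb q (J*O) (a+1) * Fb q 1 (v+1) * Fb q (o*S) 1) := by
  unfold W1
  rw [div_mul_eq_mul_div, div_mul_eq_mul_div, div_eq_div_iff (g.s02.W1d_ne _ _ _ _ (by omega) (by omega)) (g.W1d_ne _ _ _ _ (by omega) (by omega))]
  have b5 := g.a.f2 0 (by omega)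
  have b7 := g.a.f12 0 (by omega)
  have b6 := g.f124 0 (by omega)
  have b3 := g.f04 0 (by omega)
  unfold W1n W1d
  rw [show J*(q*O)*S = q*(J*O*S) by ring, show J*(q*O) = q*(J*O) by ring, show q*o*S = q*(o*S) by ring]
  simp only [← add_assoc, zero_add]
  simp only [PP_succ' q (J*O) _ b7, PP_succ' q (J*O*S) _ b6, PP_succ' q (o*S) _ b3]
  obtain ⟨v1, e1, e2⟩ := PP_pair q O a b5
  obtain ⟨v2, e3, e4⟩ := PP_pair q (J*O) a b7
  simp only [e1, e2, e3, e4]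
  simp only [PP_succ, Fb_shift]
  ring


def tm (q o J O P S : ℂ) (T : ℕ → ℂ) (N i j x y a : ℕ) : ℂ :=
  if a + j ≤ N ∧ a + y ≤ N then
    T a * W1 q o J O P S a j (N-j-a) (N-y-a) * ff q J O P (N-j) i a
      * ff q P o S (N-a) j y * ff q S O J (N-y) a x
  else 0
def SS (q o J O P S : ℂ) (T : ℕ → ℂ) (N i j x y : ℕ) : ℂ :=
  ∑ a ∈ range (N+1), tm q o J O P S T N i j x y a

theorem tm_eq (q o J O P S : ℂ) (T : ℕ → ℂ) (N i j x y a u v M L K : ℕ) (h1 : a+j+u=N) (h2 : a+y+v=N) 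
    (h3 : j + M = N) (h4 : a + L = N) (h5 : y + K = N) :
    tm q o J O P S T N i j x y a = T a * W1 q o J O P S a j u v * ff q J O P M i a
      * ff q P o S L j y * ff q S O J K a x := by
  unfold tm
  rw [if_pos (by omega)]
  rw [show N-j-a = u by omega, show N-y-a = v by omega, show N-j = M by omega, show N-a = L by omega, show N-y=K by omega]
theorem tm_no (q o J O P S : ℂ) (T : ℕ → ℂ) (N i j x y a : ℕ) (h1 : N < a+j ∨ N < a+y) :
    tm q o J O P S T N i j x y a = 0 := by
  unfold tm
  rw [if_neg (by omega)]

theorem rel_fb {q o J O P S : ℂ} {N : ℕ} (g : Gen q o J O P S N) (d e : ℂ) (m n : ℕ) (hd : d*e = o*J*O*P*S)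
   (hm : m + n = 2*N+3) : Fb q d m * (e*q^n) = - Fb q e n := by
  have := g.rel
  rw [← hd, ← hm, pow_add] at this
  simp only [fbd]; linear_combination -this

theorem J_1 {q o J O P S : ℂ} {N : ℕ} (g : Gen q o J O P S (N+1)) (a j u v x n : ℕ) (h : a+v ≤ N) (h' : j+u ≤ N)
    (hn : x + n = a+v+1) :
    W1 q o J O P S a (j+1) u (v+1) * (Fb q 1 (v+1) * Fb q (J*O) (a+a+v+2) * Fb q (o*S) 1 * Fb q (o*S) 2)
     * Fb q (O*S) (x+x+1) * ff q S O J (a+v+1) a x =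
     W1 q (q*o) J O P (q*S) a j u v * Fb q S 1 * (Fb q 1 (j+u+1) * Fb q (o*P*S) (j+u+3)) *
     (q^x * Fb q 1 n * Fb q (O*S) (x+1) * ff q (q*S) O J (a+v) a x + 
       Fb q (O*S) (x+(a+v)+2) * Fb q 1 x * ff q (q*S) O J (a+v) a (x-1)) := by
  have h1 := W_JA g a j u v h h'
  have h2 := ffT1' (g.c.mono (show a+v+1 ≤ N+1 by omega)) a x n (by omega) hn
  rw [mul_comm S O] at h2
  generalize Fb q (o*S) 1 = z1, Fb q (o*S) 2 = z2 at *
  linear_combination -Fb q (O*S) (x+x+1) * ff q S O J (a+v+1) a x * h1 + W1 q (q*o) J O P (q*S) a j u v * Fb q S 1 * (Fb q 1 (j+u+1) * Fb q (o*P*S) (j+u+3)) * h2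

theorem J_2 {q o J O P S : ℂ} {N : ℕ} (g : Gen q o J O P S (N+1)) (a j u v x n : ℕ) (h : a+v ≤ N) (h' : j+u ≤ N)
    (hn : x + n = a+v) :
    W1 q o J O P S a (j+1) u v * (Fb q S (v+1) * Fb q (J*O*S) (a+a+v+2) * Fb q (o*S) 1 * Fb q (o*S) 2)
     * Fb q (O*S) (x+x+1) * ff q S O J (a+v) a x =
     W1 q (q*o) J O P (q*S) a j u v * Fb q S 1 * (Fb q 1 (j+u+1) * Fb q (o*P*S) (j+u+3)) *
     (Fb q (J*O*S) (x+(a+v)+2) * Fb q (O*S) (x+1) * ff q (q*S) O J (a+v) a x + 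
       O*S*q^(x+1)* Fb q J (n+1) * Fb q 1 x * ff q (q*S) O J (a+v) a (x-1)) := by
  have h1 := W_JB g a j u v h h'
  have h2 := ffT2' (g.c.mono (show a+v ≤ N+1 by omega)) a x n (by omega) hn
  rw [show S*O*J = J*O*S by ring, mul_comm S O] at h2
  generalize Fb q (o*S) 1 = z1, Fb q (o*S) 2 = z2 at *
  linear_combination -Fb q (O*S) (x+x+1) * ff q S O J (a+v) a x * h1 + W1 q (q*o) J O P (q*S) a j u v * Fb q S 1 * (Fb q 1 (j+u+1) * Fb q (o*P*S) (j+u+3)) * h2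

theorem J_tm {q o J O P S : ℂ} {N : ℕ} (g : Gen q o J O P S (N+1)) (T T' : ℕ → ℂ) (hT : ∀ a, T a = T' a * q^a)
    (i j x y n a : ℕ) (hn : x + y + n = N+1) (ha : a + j ≤ N) :
    Fb q (o*P) (y+y+1) * Fb q o 1 * Fb q (o*S) 1 * Fb q (o*S) 2 * Fb q (O*S) (x+x+1) * (J*O*S*q^(x+n+2)) *
      tm q o J O P S T (N+1) i (j+1) x y a =
    Fb q S 1 * (
      -(S*q*Fb q (o*P) (y+1)*Fb q o (y+1) * (q^x*Fb q 1 n * Fb q (O*S) (x+1))) * tm q (q*o) J O P (q*S) T' N i j x y a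
      -(S*q*Fb q (o*P) (y+1)*Fb q o (y+1) * (Fb q (O*S) (x+x+n+1) * Fb q 1 x)) * tm q (q*o) J O P (q*S) T' N i j (x-1) y a
      + q*o*Fb q 1 y * Fb q P y * (Fb q (J*O*S) (x+x+n+2) * Fb q (O*S) (x+1)) * tm q (q*o) J O P (q*S) T' N i j x (y-1) a
      + q*o*Fb q 1 y * Fb q P y * (O*S*q^(x+1)*Fb q J (n+1) * Fb q 1 x) * tm q (q*o) J O P (q*S) T' N i j (x-1) (y-1) a) := by
  by_cases hy : N+1 < a + y
  · rw [tm_no _ _ _ _ _ _ _ _ _ _ _ _ _ (by omega), tm_no _ _ _ _ _ _ _ N _ _ _ y _ (by omega), tm_no _ _ _ _ _ _ _ N _ _ _ y _ (by omega),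
     tm_no _ _ _ _ _ _ _ N _ _ _ (y-1) _ (by omega), tm_no _ _ _ _ _ _ _ N _ _ _ (y-1) _ (by omega)]
    ring
  obtain ⟨v, hv⟩ : ∃ v, a+y+v = N+1 := ⟨N+1-(a+y), by omega⟩
  obtain ⟨u, hu⟩ : ∃ u, a+j+u = N := ⟨N-(a+j), by omega⟩
  have hI := ffI' (g.b.mono (show j+u+1 ≤ N+1 by omega)) j y v (by omega) (by omega)
  rw [show P*o*S = o*P*S by ring, mul_comm P o] at hI
  have r1 := rel_fb g (o*P*S) (J*O) (y+(j+u)+3) (a+a+v+1) (by ring) (by omega)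
  have r2 := rel_fb g (o*P) (J*O*S) (y+(j+u)+2) (a+a+v+2) (by ring) (by omega)
  rw [tm_eq q o J O P S T (N+1) i (j+1) x y a u v (N-j) (j+u+1) (x+n) (by omega) (by omega) (by omega) (by omega) (by omega), hT]
  have hD : Fb q 1 (j+u+1) * Fb q (o*P*S) (j+u+3) ≠ 0 := mul_ne_zero (g.a.f0 _ (by omega)) (g.f034 (j+u+2) (by omega))
  apply mul_left_cancel₀ hD
  have e1 : Fb q 1 v * W1 q o J O P S a (j+1) u v * (Fb q (J*O) (a+a+v+1) * Fb q (o*S) 1 * Fb q (o*S) 2)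
     * Fb q (O*S) (x+x+1) * ff q S O J (x+n) a x * (T' a * ff q J O P (N-j) i a * ff q P (q*o) (q*S) (j+u) j y) = 
      Fb q S 1 * (Fb q 1 (j+u+1) * Fb q (o*P*S) (j+u+3)) * (q^x*Fb q 1 n * Fb q (O*S) (x+1) * tm q (q*o) J O P (q*S) T' N i j x y a 
      + (Fb q (O*S) (x+x+n+1) * Fb q 1 x) * tm q (q*o) J O P (q*S) T' N i j (x-1) y a) := by
    rcases v with _ | v
    · rw [tm_no _ _ _ _ _ _ _ N _ _ _ y _ (by omega), tm_no _ _ _ _ _ _ _ N _ _ _ y _ (by omega), fb10]; ring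
    rw [tm_eq q (q*o) J O P (q*S) T' N i j x y a u v (N-j) (j+u) (a+v) (by omega) (by omega) (by omega) (by omega) (by omega),
      tm_eq q (q*o) J O P (q*S) T' N i j (x-1) y a u v (N-j) (j+u) (a+v) (by omega) (by omega) (by omega) (by omega) (by omega)]
    have := J_1 g a j u v x n (by omega) (by omega) (by omega)
    rw [show x+(a+v)+2 = x+x+n+1 by omega] at this
    rw [show x+n = a+v+1 by omega, show a+a+(v+1)+1 = a+a+v+2 by rfl]
    linear_combination (T' a * ff q J O P (N-j) i a * ff q P (q*o) (q*S) (j+u) j y) * this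
  have e2 : Fb q 1 y * (W1 q o J O P S a (j+1) u v * (Fb q S (v+1) * Fb q (J*O*S) (a+a+v+2) * Fb q (o*S) 1 * Fb q (o*S) 2)
     * Fb q (O*S) (x+x+1) * ff q S O J (x+n) a x * (T' a * ff q J O P (N-j) i a * ff q P (q*o) (q*S) (j+u) j (y-1))) = 
      Fb q 1 y * (Fb q S 1 * (Fb q 1 (j+u+1) * Fb q (o*P*S) (j+u+3)) * ((Fb q (J*O*S) (x+x+n+2) * Fb q (O*S) (x+1)) * tm q (q*o) J O P (q*S) T' N i j x (y-1) a
      + (O*S*q^(x+1)*Fb q J (n+1) * Fb q 1 x) * tm q (q*o) J O P (q*S) T' N i j (x-1) (y-1) a)) := by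
    rcases y with _ | y
    · rw [fb10]; ring
    congr 1
    rw [show y+1-1 = y by rfl]
    rw [tm_eq q (q*o) J O P (q*S) T' N i j x y a u v (N-j) (j+u) (x+n) (by omega) (by omega) (by omega) (by omega) (by omega),
      tm_eq q (q*o) J O P (q*S) T' N i j (x-1) y a u v (N-j) (j+u) (x+n) (by omega) (by omega) (by omega) (by omega) (by omega)]
    have := J_2 g a j u v x n (by omega) (by omega) (by omega)
    rw [show x+(a+v)+2 = x+x+n+2 by omega, show a+v = x+n by omega] at this
    linear_combination (T' a * ff q J O P (N-j) i a * ff q P (q*o) (q*S) (j+u) j y) * this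
  rw [show x+n = a+v by omega] at *
  have hp : q^(a+a+v+2) = q^(a+v+2)*q^a := by ring
  have hp1 : q^(a+a+v+1)*q = q^(a+v+2)*q^a := by ring
  rw [hp] at r2
  generalize Fb q (o*S) 1 = z1, Fb q (o*S) 2 = z2, Fb q (o*P) (y+y+1) = z3, Fb q (o*P) (y+1) = z4, Fb q o (y+1) = z5, Fb q 1 v = z6, Fb q (o*P*S) (y+(j+u)+3) = z7, Fb q (o*P) (y+(j+u)+2) = z8, tm q (q*o) J O P (q*S) T' N i j x y a = m1, tm q (q*o) J O P (q*S) T' N i j (x-1) y a = m2, tm q (q*o) J O P (q*S) T' N i j x (y-1) a = m3, tm q (q*o) J O P (q*S) T' N i j (x-1) (y-1) a = m4, Fb q (J*O) (a+a+v+1) = w1, Fb q (J*O*S) (a+a+v+2) = w2, W1 q o J O P S a (j+1) u v = W, ff q J O P (N-j) i a = F1, ff q P (q*o) (q*S) (j+u) j y = F2, ff q P (q*o) (q*S) (j+u) j (y-1) = F3, ff q S O J (a+v) a x = F4, Fb q (O*S) (x+x+1) = z9, Fb q 1 (j+u+1) = d1, Fb q (o*P*S) (j+u+3) = d2, Fb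 q o 1 = d3, Fb q P y = d4, Fb q 1 y = d5, Fb q S (v+1) = d6, ff q P o S (j+u+1) (j+1) y = F0, q^(a+a+v+1) = p1, q^(a+v+2) = p2, q^a = p3, T' a = t at *
  linear_combination W*t*F1*F4*z1*z2*z9*J*O*S*p2*p3*hI 
    + W*t*F1*F4*z1*z2*z9*z4*z5*z6*F2*S*q*r1 
    - W*t*F1*F4*z1*z2*z9*q*o*d5*d4*d6*F3*r2 - S*q*z4*z5*e1 + q*o*d4*e2 - W*t*F1*F4*z1*z2*z9*z4*z5*z6*F2*S*z7*J*O* hp1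

theorem J_rec {q o J O P S : ℂ} {N : ℕ} (g : Gen q o J O P S (N+1)) (T T' : ℕ → ℂ) (hT : ∀ a, T a = T' a * q^a)
    (i j x y n : ℕ) (hn : x + y + n = N+1) (hj : j ≤ N) :
    Fb q (o*P) (y+y+1) * Fb q o 1 * Fb q (o*S) 1 * Fb q (o*S) 2 * Fb q (O*S) (x+x+1) * (J*O*S*q^(x+n+2)) *
      SS q o J O P S T (N+1) i (j+1) x y =
    Fb q S 1 * (
      -(S*q*Fb q (o*P) (y+1)*Fb q o (y+1) * (q^x*Fb q 1 n * Fb q (O*S) (x+1))) * SS q (q*o) J O P (q*S) T' N i j x y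
      -(S*q*Fb q (o*P) (y+1)*Fb q o (y+1) * (Fb q (O*S) (x+x+n+1) * Fb q 1 x)) * SS q (q*o) J O P (q*S) T' N i j (x-1) y
      + q*o*Fb q 1 y * Fb q P y * (Fb q (J*O*S) (x+x+n+2) * Fb q (O*S) (x+1)) * SS q (q*o) J O P (q*S) T' N i j x (y-1)
      + q*o*Fb q 1 y * Fb q P y * (O*S*q^(x+1)*Fb q J (n+1) * Fb q 1 x) * SS q (q*o) J O P (q*S) T' N i j (x-1) (y-1)) := by
  unfold SS
  rw [sum_range_succ, tm_no _ _ _ _ _ _ _ (N+1) _ _ _ _ (N+1) (by omega), add_zero]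
  simp only [mul_sum, ← sum_add_distrib, ← sum_sub_distrib]
  apply sum_congr rfl
  intro a ha
  rw [mem_range] at ha
  by_cases h : a + j ≤ N
  · rw [J_tm g T T' hT i j x y n a hn h, mul_add, mul_add, mul_sub]
  · simp only [tm_no _ _ _ _ _ _ _ _ _ _ _ _ a (Or.inl (show N < a + j by omega)),tm_no _ _ _ _ _ _ _ _ _ _ _ _ a (Or.inl (show N+1 < a + (j+1) by omega))]
    ring


theorem Y_rec {q o J O P S : ℂ} {N : ℕ} (g : Gen q o J O P S (N+1)) (T : ℕ → ℂ)
    (i x y m : ℕ) (hm : i + m = N+1) :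
    Fb q (o*S) 1 * Fb q (O*P) (i+i+1) * Fb q 1 (N+1) * SS q o J O P S T (N+1) i 0 x (y+1) =
    Fb q P 1 * (q^i*Fb q 1 m * Fb q (O*P) (i+1) * SS q (q*o) J O (q*P) S T N i 0 x y
      + Fb q (O*P) (i+N+2) * Fb q 1 i * SS q (q*o) J O (q*P) S T N (i-1) 0 x y) := by
  unfold SS
  rw [sum_range_succ, tm_no _ _ _ _ _ _ _ (N+1) _ _ _ _ (N+1) (by omega), add_zero]
  simp only [mul_sum, ← sum_add_distrib, ← sum_sub_distrib]
  apply sum_congr rfl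
  intro a ha
  rw [mem_range] at ha
  by_cases h : N < a + y
  · simp only [tm_no _ _ _ _ _ _ _ _ _ _ _ _ a (Or.inr h),tm_no _ _ _ _ _ _ _ _ _ _ _ _ a (Or.inr (show N+1 < a + (y+1) by omega))]
    ring
  obtain ⟨u, rfl⟩ : ∃ u, N = a + u := ⟨N-a, by omega⟩
  obtain ⟨v, rfl⟩ : ∃ v, u = y + v := ⟨u-y, by omega⟩
  rw [tm_eq q o J O P S T (a+(y+v)+1) i 0 x (y+1) a (y+v+1) v (a+(y+v)+1) (y+v+1) (a+v) (by omega) (by omega) (by omega) (by omega) (by omega),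
    tm_eq q (q*o) J O (q*P) S T (a+(y+v)) i 0 x y a (y+v) v (a+(y+v)) (y+v) (a+v) (by omega) (by omega) (by omega) (by omega) (by omega),
    tm_eq q (q*o) J O (q*P) S T (a+(y+v)) (i-1) 0 x y a (y+v) v (a+(y+v)) (y+v) (a+v) (by omega) (by omega) (by omega) (by omega) (by omega)]
  have h1 := W_Y g a (y+v) v (by omega) (by omega)
  have h2 := ffT1' g.a.symm a i m (by omega) hm
  rw [ff_dual q _ _ _ _ _ _ g.hq, ff_dual q (q*P) _ _ _ _ _ g.hq, ff_dual q (q*P) _ _ _ _ _ g.hq, mul_comm P O] at h2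
  simp only [ff_zero]
  linear_combination T a * ff q S O J (a+v) a x * (-ff q J O P (a+(y+v)+1) i a * Fb q (O*P) (i+i+1) * Fb q 1 (a+(y+v)+1) * h1 
    + W1 q (q*o) J O (q*P) S a 0 (y+v) v * Fb q P 1 * h2)

theorem SS0 (q o J O P S : ℂ) (T : ℕ → ℂ) (N i x y K : ℕ) (hK : y + K = N) :
    SS q o J O P S T N i 0 x y = ∑ a ∈ range (K+1), T a * W1 q o J O P S a 0 (N-a) (K-a) * ff q J O P N i a * ff q S O J K a x := by
  unfold SS
  rw [show N+1 = (K+1) + y by omega, sum_range_add, sum_eq_zero (s := range y), add_zero]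
  · apply sum_congr rfl
    intro a ha
    rw [mem_range] at ha
    rw [tm_eq q o J O P S T N i 0 x y a (N-a) (K-a) N (N-a) K (by omega) (by omega) (by omega) (by omega) (by omega), ff_zero]
    ring
  · intro a ha
    exact tm_no _ _ _ _ _ _ _ _ _ _ _ _ _ (by omega)

theorem tele (A B h : ℕ → ℂ) (n : ℕ) (hA : A n = 0) (hB : B 0 = 0) :
   ∑ a ∈ range (n+1), (A a * h a - B a * h (a-1)) = ∑ a ∈ range n, (A a - B (a+1)) * h a := by
  rw [sum_sub_distrib, sum_range_succ, hA, sum_range_succ' (fun a => B a * h (a-1)), hB]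
  simp [sub_mul]

theorem XPM {q J O P : ℂ} {N : ℕ} (g : Gf q J O P (N+1)) (i a u m : ℕ) (hm : i + m = N+1) (hu : a + u = N) :
    (q^i * (Fb q P (u+1) * ff q J O P (N+1) i a - Fb q (J*O*P) (N+3+a) * ff q J O P (N+1) i (a+1)) *
      (Fb q O 1 * Fb q 1 (N+1) * Fb q (O*P) (i+i+1)) =
    -(Fb q (J*O) (a+a+2) * q^(u+1) * (P*q^i*q^i*Fb q O (i+1) * Fb q 1 m * Fb q (O*P) (i+1) * ff q J (q*O) P N i a
     - Fb q P i * Fb q (O*P) (N+2+i) * Fb q 1 i * ff q J (q*O) P N (i-1) a))) ∧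
    ((J*O*q^(a+a+2) * Fb q P (u+1) * ff q J O P (N+1) i a - Fb q (J*O*P) (N+3+a) * ff q J O P (N+1) i (a+1)) *
      (Fb q O 1 * Fb q 1 (N+1) * Fb q (O*P) (i+i+1)) =
    -(Fb q (J*O) (a+a+2) * (Fb q O (i+1) * Fb q 1 m * Fb q (O*P) (i+1) * ff q J (q*O) P N i a
     - q * O * Fb q P i * Fb q (O*P) (N+2+i) * Fb q 1 i * ff q J (q*O) P N (i-1) a))) := by
  obtain ⟨h1, h2⟩ := ffX g i a (by omega) (by omega) _ _ _ _ _ rfl rfl rfl rfl rfl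
  have n1 := g.f23 (i+i) (by omega)
  have hq := g.hq
  have g1 := g.h1
  have g2 := g.h2
  have g3 := g.h3
  have em : q^m = q*q^a*q^u/q^i := by
    rw [eq_div_iff (pow_ne_zero _ hq), ← pow_add, add_comm m, hm, ← hu]; ring
  subst hu
  have eAB : (q^i)⁻¹ - O*P*q^(i+1) = Fb q (O*P) (i+i+1) / q^i := by
    rw [fbd]; field_simp; ring
  have eBA : O*P*q^(i+1) - (q^i)⁻¹ = -Fb q (O*P) (i+i+1) / q^i := by
    rw [fbd]; field_simp; ring
  rw [eAB, eBA] at h1 h2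
  have hd := fbd q (O*P) (i+i+1)
  generalize ff q J O P (a+u+1) i a = f1, ff q J O P (a+u+1) i (a+1) = f2, ff q J (q*O) P (a+u) i a = f3, ff q J (q*O) P (a+u) (i-1) a = f4, Fb q (O*P) (i+i+1) = d at *
  simp only [fbd, em]
  simp only [pow_add, pow_one, one_mul] at *
  have hi := pow_ne_zero i hq
  have ha := pow_ne_zero a hq
  have hu := pow_ne_zero u hq
  clear em eAB eBA hm g
  generalize q^i = Qi, q^a = Qa, q^u = Qu at *
  constructor
  · rw [← sub_eq_zero] at h1 h2 ⊢
    set k1 := -(Qi*(Qa*Qu*q)*d/(J*O*(Qa*q^2))) with hk1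
    set k2 := Qi*(Qa*Qu*q)*Qa*d with hk2
    have e := congrArg₂ (· + ·) (congrArg (k1 * ·) h1) (congrArg (k2 * ·) h2)
    simp only [mul_zero, add_zero] at e
    rw [← e, hk1, hk2]
    clear e h1 h2 hk1 hk2 k1 k2
    field_simp
    ring
  · rw [← sub_eq_zero] at h1 h2 ⊢
    set k1 := -((Qa*Qu*q)*d*Qa) with hk1
    set k2 := (Qa*Qu*q)*Qa*d with hk2
    have e := congrArg₂ (· + ·) (congrArg (k1 * ·) h1) (congrArg (k2 * ·) h2)
    simp only [mul_zero, add_zero] at e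
    rw [← e, hk1, hk2]
    clear e h1 h2 hk1 hk2 k1 k2
    field_simp
    ring


theorem W_XB {q o J O P S : ℂ} {N : ℕ} (g : Gen q o J O P S (N+1)) (a u v : ℕ) (h : a+v ≤ N) (h' : u ≤ N) :
   W1 q o J O P S (a+1) 0 u v * (Fb q 1 (a+1) * Fb q J (a+1) * Fb q S (v+1) * Fb q (J*O) (a+a+v+3) * Fb q (J*O) (a+a+2) * Fb q (o*S) 1) =
   W1 q o J (q*O) P (q*S) a 0 u v * (Fb q S 1 * Fb q (o*S) (u+2) * Fb q (J*O) (a+a+3) * (Fb q O 1 * Fb q (J*O*S) (a+v+3) * Fb q 1 (a+v+1))) := by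
  have h1 := W_succ g a u v (by omega) (by omega)
  have h2 := W_XA g a u v (by omega) (by omega)
  have d1 := g.a.f12 (a+a) (by omega)
  have d2 := g.a.f3 u (by omega)
  apply mul_left_cancel₀ (mul_ne_zero d1 d2)
  linear_combination Fb q (J*O) (a+a+2) * Fb q (o*S) 1 * h1 + Fb q (o*S) (u+2) * Fb q (J*O) (a+a+3) * h2

theorem W_IB {q o J O P S : ℂ} {N : ℕ} (g : Gen q o J O P S (N+1)) (a u v : ℕ) (h : a+v ≤ N) (h' : u ≤ N) :
   W1 q o J O P S (a+1) 0 u v * (Fb q 1 (a+1) * Fb q J (a+1) * Fb q P (u+1) * Fb q (J*O) (a+a+v+3) * Fb q (J*O) (a+a+2)) =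
   W1 q o J (q*O) (q*P) S a 0 u v * (Fb q O 1 * Fb q P 1 * Fb q 1 (a+v+1) * Fb q (J*O*S) (a+a+v+3) * Fb q (J*O) (a+a+3)) := by
  have h1 := W_succ g a u v (by omega) (by omega)
  have h2 := W_IA g a u v (by omega) (by omega)
  have d1 := g.a.f12 (a+a) (by omega)
  have d2 := g.c.f1 v (by omega)
  apply mul_left_cancel₀ (mul_ne_zero d1 d2)
  linear_combination Fb q (J*O) (a+a+2) * h1 + Fb q (J*O*S) (a+a+v+3) * Fb q (J*O) (a+a+3) * h2

theorem X_core {q o J O P S : ℂ} {N : ℕ} (g : Gen q o J O P S (N+1)) (T : ℕ → ℂ)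
    (i x y K : ℕ) (hK : y + K = N) (hx : x ≤ K) :
    Fb q (o*S) 1 * SS q o J O P S T (N+1) i 0 (x+1) y =
    Fb q S 1 * ∑ a ∈ range (K+1), ff q (q*S) (q*O) J K a x * (W1 q o J (q*O) P (q*S) a 0 (N-a) (K-a) / Fb q (J*O) (a+a+2)
      * (T a * Fb q P (N-a+1) * ff q J O P (N+1) i a - q*O*T (a+1)*Fb q (o*S) (N-a+2) * ff q J O P (N+1) i (a+1))) := by
  have hK3 : Fb q O 1 * Fb q (J*O*S) (K+3) * Fb q 1 (K+1) ≠ 0 :=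
    mul_ne_zero (mul_ne_zero (g.a.f2 0 (by omega)) (g.f124 (K+2) (by omega))) (g.a.f0 _ (by omega))
  have h04 := g.f04 0 (by omega)
  rw [zero_add] at h04
  set A : ℕ → ℂ := fun a => T a*W1 q o J O P S a 0 (N+1-a) (K+1-a) * ff q J O P (N+1) i a *(Fb q (J*O) (a+1)*Fb q O (a+1)*Fb q (J*O*S) (a+K+3)*Fb q 1 (K+1-a))/Fb q (J*O) (a+a+1) with hA
  set B : ℕ → ℂ := fun a => T a*W1 q o J O P S a 0 (N+1-a) (K+1-a) * ff q J O P (N+1) i a *(q*O*Fb q 1 a*Fb q J a*Fb q S (K+1-a+1)*Fb q (J*O) (a+K+2))/Fb q (J*O) (a+a+1) with hB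
  have key : (Fb q O 1 * Fb q (J*O*S) (K+3) * Fb q 1 (K+1)) * SS q o J O P S T (N+1) i 0 (x+1) y = 
     ∑ a ∈ range (K+1+1), (A a * ff q (q*S) (q*O) J K a x - B a * ff q (q*S) (q*O) J K (a-1) x) := by
    rw [SS0 q o J O P S T (N+1) i (x+1) y (K+1) (by omega), mul_sum]
    apply sum_congr rfl
    intro a ha
    rw [mem_range] at ha
    have h1 := ffI' (g.c.symm.mono (show K+1 ≤ N+1 by omega)) x a (K+1-a) (by omega) (by omega)
    have d1 := g.a.f12 (a+a) (by omega)
    rw [ff_dual q J O S _ _ _ g.hq, ff_dual q J (q*O) (q*S) _ _ _ g.hq, ff_dual q J (q*O) (q*S) _ _ _ g.hq] at h1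
    simp only [hA, hB]
    rw [div_mul_eq_mul_div, div_mul_eq_mul_div, ← sub_div, eq_div_iff d1]
    linear_combination T a * W1 q o J O P S a 0 (N+1-a) (K+1-a) * ff q J O P (N+1) i a * h1
  rw [tele A B (fun a => ff q (q*S) (q*O) J K a x) (K+1) (by simp [hA, fb10]) (by simp [hB, fb10])] at key
  apply mul_left_cancel₀ hK3
  rw [mul_left_comm, key, mul_sum, mul_left_comm, mul_sum, mul_sum]
  apply sum_congr rfl
  intro a ha
  rw [mem_range] at ha
  obtain ⟨v, rfl⟩ : ∃ v, K = a + v := ⟨K-a, by omega⟩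
  obtain ⟨u, rfl⟩ : ∃ u, N = a + u := ⟨N-a, by omega⟩
  have d1 := g.a.f12 (a+a) (by omega)
  have d2 := g.a.f12 (a+a+1) (by omega)
  have d3 := g.a.f12 (a+a+2) (by omega)
  have x1 := W_XA g a u v (by omega) (by omega)
  have x2 := W_XB g a u v (by omega) (by omega)
  simp only [hA, hB]
  clear key hA hB A B
  rw [show a+u+1-a = u+1 by omega, show a+v+1-a = v+1 by omega, show a+u+1-(a+1) = u by omega, show a+v+1-(a+1) = v by omega, show a+1+(a+1)+1 = a+a+3 by ring,
    show a+1+(a+v)+2 = a+a+v+3 by ring, show a+(a+v)+3 = a+a+v+3 by ring, show a+u-a = u by omega, show a+v-a = v by omega]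
  rw [show a+a+1+1 = a+a+2 by rfl] at d2
  rw [show a+a+2+1 = a+a+3 by rfl] at d3
  generalize ff q (q*S) (q*O) J (a+v) a x = f1, ff q J O P (a+u+1) i a = f2, ff q J O P (a+u+1) i (a+1) = f3, W1 q o J O P S a 0 (u+1) (v+1) = w1, W1 q o J O P S (a+1) 0 u v = w2, W1 q o J (q*O) P (q*S) a 0 u v = w3, Fb q (J*O) (a+a+1) = e1, Fb q (J*O) (a+a+2) = e2, Fb q (J*O) (a+a+3) = e3, Fb q (J*O*S) (a+a+v+3) = e4, Fb q (J*O) (a+a+v+3) = e5, Fb q (J*O) (a+1) = e6, Fb q (J*O*S) (a+v+3) = e8, Fb q 1 (a+v+1) = e9, Fb q (o*S) 1 = e10, Fb q (o*S) (u+2) = e11, Fb q 1 (v+1) = e12, Fb q 1 (a+1) = e13, Fb q J (a+1) = e14, Fb q O 1 = e15, Fb q O (a+1) = e16, Fb q P (u+1) = e17, Fb q S 1 = e18, Fb q S (v+1) = e19, T a = t1, T (a+1) = t2 at *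
  rw [show e10*((t1*w1*f2*(e6*e16*e4*e12)/e1 - t2*w2*f3*(q*O*e13*e14*e19*e5)/e3)*f1) =
    (w1*(e6*e16*e4*e12*e2*e10)/(e1*e2) * t1*f2 - w2*(e13*e14*e19*e5*e2*e10)/(e3*e2)*t2*q*O*f3)*f1 by field_simp, x1, x2]
  field_simp

theorem I_core {q o J O P S : ℂ} {N : ℕ} (g : Gen q o J O P S (N+1)) (T : ℕ → ℂ) (i : ℕ) (hi : i ≤ N) :
    Fb q (J*O*P) (N+3) * SS q o J O P S T (N+1) (i+1) 0 0 0 =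
    Fb q P 1 * ∑ a ∈ range (N+1), ff q J (q*O) (q*P) N i a * (W1 q o J (q*O) (q*P) S a 0 (N-a) (N-a) / Fb q (J*O) (a+a+2)
      * (- T a * Fb q S (N-a+1) / (o*S*q^(N-a+2))  - q*O*T (a+1)*Fb q (J*O*S) (a+N+3))) := by
  have hK3 : Fb q O 1 * Fb q 1 (N+1) ≠ 0 :=
    mul_ne_zero (g.a.f2 0 (by omega)) (g.a.f0 _ (by omega))
  set A : ℕ → ℂ := fun a => T a*W1 q o J O P S a 0 (N+1-a) (N+1-a) *(Fb q (J*O) (a+1)*Fb q O (a+1)*Fb q (J*O*P) (a+N+3)*Fb q 1 (N+1-a))/Fb q (J*O) (a+a+1) with hA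
  set B : ℕ → ℂ := fun a => T a*W1 q o J O P S a 0 (N+1-a) (N+1-a) *(q*O*Fb q 1 a*Fb q J a*Fb q P (N+1-a+1)*Fb q (J*O) (a+N+2))/Fb q (J*O) (a+a+1) with hB
  have key : (Fb q O 1 * Fb q 1 (N+1)) * (Fb q (J*O*P) (N+3) * SS q o J O P S T (N+1) (i+1) 0 0 0) = 
     ∑ a ∈ range (N+1+1), (A a * ff q J (q*O) (q*P) N i a - B a * ff q J (q*O) (q*P) N i (a-1)) := by
    rw [SS0 q o J O P S T (N+1) (i+1) 0 0 (N+1) (by omega), mul_sum, mul_sum]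
    apply sum_congr rfl
    intro a ha
    rw [mem_range] at ha
    have h1 := ffI' g.a i a (N+1-a) (by omega) (by omega)
    have d1 := g.a.f12 (a+a) (by omega)
    simp only [hA, hB]
    rw [div_mul_eq_mul_div, div_mul_eq_mul_div, ← sub_div, eq_div_iff d1, ff_zero' q S O J _ _ g.hq]
    linear_combination T a * W1 q o J O P S a 0 (N+1-a) (N+1-a) * h1
  rw [tele A B (fun a => ff q J (q*O) (q*P) N i a) (N+1) (by simp [hA, fb10]) (by simp [hB, fb10])] at key
  apply mul_left_cancel₀ hK3
  rw [key, mul_left_comm, mul_sum, mul_sum]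
  apply sum_congr rfl
  intro a ha
  rw [mem_range] at ha
  obtain ⟨u, rfl⟩ : ∃ u, N = a + u := ⟨N-a, by omega⟩
  have d1 := g.a.f12 (a+a) (by omega)
  have d2 := g.a.f12 (a+a+1) (by omega)
  have d3 := g.a.f12 (a+a+2) (by omega)
  have x1 := W_IA g a u u (by omega) (by omega)
  have x2 := W_IB g a u u (by omega) (by omega)
  have r := rel_fb g (J*O*P) (o*S) (a+a+u+3) (u+2) (by ring) (by omega)
  have d4 : o*S*q^(u+2) ≠ 0 := mul_ne_zero (mul_ne_zero g.h0 g.h4) (pow_ne_zero _ g.hq)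
  simp only [hA, hB]
  clear key hA hB A B
  rw [show a+u+1-a = u+1 by omega,  show a+u+1-(a+1) = u by omega, show a+1+(a+1)+1 = a+a+3 by ring,
    show a+1+(a+u)+2 = a+a+u+3 by ring, show a+(a+u)+3 = a+a+u+3 by ring, show a+u-a = u by omega]
  rw [show a+a+1+1 = a+a+2 by rfl] at d2
  rw [show a+a+2+1 = a+a+3 by rfl] at d3
  rw [← eq_div_iff d4] at r
  rw [r]
  generalize ff q J (q*O) (q*P) (a+u) i a = f1, W1 q o J O P S a 0 (u+1) (u+1) = w1, W1 q o J O P S (a+1) 0 u u = w2, W1 q o J (q*O) (q*P) S a 0 u u = w3, Fb q (J*O) (a+a+1) = e1, Fb q (J*O) (a+a+2) = e2, Fb q (J*O) (a+a+3) = e3, Fb q (J*O*S) (a+a+u+3) = e4, Fb q (J*O) (a+a+u+3) = e5, Fb q (J*O) (a+1) = e6, Fb q 1 (a+u+1) = e9, Fb q (o*S) (u+2) = e11, Fb q 1 (u+1) = e12, Fb q 1 (a+1) = e13, Fb q J (a+1) = e14, Fb q O 1 = e15, Fb q O (a+1) = e16, Fb q P (u+1) = e17, Fb q P 1 = e18,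 Fb q S (u+1) = e19, T a = t1, T (a+1) = t2, o*S*q^(u+2) = p at *
  clear r
  rw [show (t1*w1*(e6*e16*(-e11/p)*e12)/e1 - t2*w2*(q*O*e13*e14*e17*e5)/e3)*f1 =
    (-(w1*(e16*e2*e6*e12*e11)/(e1*e2*p) * t1) - w2*(e13*e14*e17*e5*e2)/(e3*e2)*t2*q*O)*f1 by field_simp, x1, x2]
  field_simp


def qt (q : ℂ) : ℕ → ℂ
  | 0 => 1
  | n+1 => qt q n * q^(n+1)
theorem qt_ne (q : ℂ) (hq : q ≠ 0) (n : ℕ) : qt q n ≠ 0 := by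
  induction n with
  | zero => simp [qt]
  | succ n ih => exact mul_ne_zero ih (pow_ne_zero _ hq)
theorem qt_succ (q : ℂ) (n : ℕ) : qt q (n+1) = qt q n * q^(n+1) := rfl

def Tp (q J P : ℂ) (N a : ℕ) : ℂ := (-(J*P*q^N))^a * qt q a
def Tm (q O P : ℂ) (N a : ℕ) : ℂ := (-(P*q^N/O))^a / qt q a

theorem Tp_N (q J P : ℂ) (N a : ℕ) : Tp q J P (N+1) a = Tp q J P N a * q^a := by
  unfold Tp; rw [show -(J*P*q^(N+1)) = -(J*P*q^N)*q by ring, mul_pow]; ring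
theorem Tp_3 (q J P : ℂ) (N : ℕ) : Tp q J (q*P) N = Tp q J P (N+1) := by
  ext a; unfold Tp; rw [show -(J*(q*P)*q^N) = -(J*P*q^(N+1)) by ring]
theorem Tm_N (q O P : ℂ) (N a : ℕ) : Tm q O P (N+1) a = Tm q O P N a * q^a := by
  unfold Tm; rw [show -(P*q^(N+1)/O) = -(P*q^N/O)*q by ring, mul_pow]; ring
theorem Tm_3 (q O P : ℂ) (N : ℕ) : Tm q O (q*P) N = Tm q O P (N+1) := by
  ext a; unfold Tm; rw [show -(q*P*q^N/O) = -(P*q^(N+1)/O) by ring]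
theorem Tm_2 (q O P : ℂ) (hq : q ≠ 0) (N a : ℕ) : Tm q O P (N+1) a = Tm q (q*O) P N a * (q^a*q^a) := by
  unfold Tm
  rw [show -(P*q^(N+1)/O) = -(P*q^N/(q*O))*(q*q) by field_simp; ring, mul_pow, mul_pow]; ring
theorem Tm_23 (q O P : ℂ) (hq : q ≠ 0) (N a : ℕ) : Tm q O P (N+1) a = Tm q (q*O) (q*P) N a * q^a := by
  rw [Tm_2 _ _ _ hq, Tm_3, Tm_N]; ring
theorem Tp_s (q J P : ℂ) (N a : ℕ) : Tp q J P N (a+1) = -(J*P*q^(N+a+1)) * Tp q J P N a := by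
  unfold Tp; rw [qt_succ]; ring
theorem Tm_s (q O P : ℂ) (hq : q ≠ 0) (h2 : O ≠ 0) (N a : ℕ) : Tm q O P N (a+1) * (O * q^(a+1)) = -(P*q^N) * Tm q O P N a := by
  unfold Tm; rw [qt_succ]
  have := qt_ne q hq a
  rw [pow_succ (-(P*q^N/O)) a]
  generalize (-(P*q^N/O))^a = z
  field_simp

theorem Xp_rec {q o J O P S : ℂ} {N : ℕ} (g : Gen q o J O P S (N+1)) (i x y m : ℕ) (hm : i + m = N+1) (hx : x + y ≤ N) :
    Fb q (o*S) 1 * (Fb q O 1 * Fb q 1 (N+1) * Fb q (O*P) (i+i+1)) * q^i * SS q o J O P S (Tp q J P (N+1)) (N+1) i 0 (x+1) y =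
    -(Fb q S 1 * q^(N+1) * (P*q^i*q^i*Fb q O (i+1) * Fb q 1 m * Fb q (O*P) (i+1) * SS q o J (q*O) P (q*S) (Tp q J P N) N i 0 x y
     - Fb q P i * Fb q (O*P) (N+2+i) * Fb q 1 i * SS q o J (q*O) P (q*S) (Tp q J P N) N (i-1) 0 x y)) := by
  obtain ⟨K, hK⟩ : ∃ K, y + K = N := ⟨N-y, by omega⟩
  have h := X_core g (Tp q J P (N+1)) i x y K hK (by omega)
  rw [mul_assoc (Fb q (o*S) 1), mul_assoc (Fb q (o*S) 1), mul_comm _ (SS q o J O P S _ _ _ _ _ _), ← mul_assoc, h, SS0 _ _ _ _ _ _ _ N i x y K hK, SS0 _ _ _ _ _ _ _ N (i-1) x y K hK]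
  simp only [mul_sum, sum_mul, ← sum_sub_distrib, ← sum_neg_distrib]
  apply sum_congr rfl
  intro a ha
  rw [mem_range] at ha
  obtain ⟨u, hu⟩ : ∃ u, a + u = N := ⟨N-a, by omega⟩
  obtain ⟨h1, -⟩ := XPM g.a i a u m hm hu
  have d2 := g.a.f12 (a+a+1) (by omega)
  have r := rel_fb g (J*O*P) (o*S) (N+3+a) (u+2) (by ring) (by omega)
  rw [show N-a = u by omega, Tp_s, Tp_N]
  have e1 : q*O*(J*P*q^(N+1+a+1))*Fb q (o*S) (u+2) = - Fb q (J*O*P) (N+3+a) := by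
    have hr := g.rel
    rw [show 2*(N+1)+3 = (N+3+a)+(u+2) by omega, pow_add] at hr
    linear_combination q*O*(J*P*q^(N+1+a+1)) * r - Fb q (J*O*P) (N+3+a) * hr
  have e2 : q^(N+1) = q^a*q^(u+1) := by rw [← hu]; ring
  rw [e2]
  rw [show a+a+1+1 = a+a+2 by rfl] at d2
  generalize q^(N+1+a+1) = p, W1 q o J (q*O) P (q*S) a 0 u (K-a) = w, ff q (q*S) (q*O) J K a x = f, ff q J (q*O) P N i a = f1, ff q J (q*O) P N (i-1) a = f2, ff q J O P (N+1) i a = f3, ff q J O P (N+1) i (a+1) = f4, Fb q (J*O) (a+a+2) = d at *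
  rw [← sub_eq_zero]
  rw [← sub_eq_zero] at e1 h1
  generalize Fb q (o*S) (u+2) = z1, Fb q (J*O*P) (N+3+a) = z2, Fb q (O*P) (i+i+1) = z3, Fb q 1 (N+1) = z4, Fb q O 1 = z5, Fb q P (u+1) = z6, Fb q O (i+1) = z7, Fb q 1 m = z8, Fb q (O*P) (i+1) = z9, Fb q (O*P) (N+2+i) = z10, Fb q 1 i = z11, Fb q P i = z12, Tp q J P N a = t, Fb q S 1 = z13, q^a = qa, q^i = qi, q^(u+1) = qu at *
  have := congrArg₂ (fun X Y => z13*f*w*t*qa/d * (X + qi*z5*z4*z3*f4*Y)) h1 e1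
  simp only [mul_zero, add_zero] at this
  rw [← this]
  field_simp
  ring

theorem Xm_rec {q o J O P S : ℂ} {N : ℕ} (g : Gen q o J O P S (N+1)) (i x y m : ℕ) (hm : i + m = N+1) (hx : x + y ≤ N) :
    Fb q (o*S) 1 * (Fb q O 1 * Fb q 1 (N+1) * Fb q (O*P) (i+i+1)) * (J*O*q^2) * SS q o J O P S (Tm q O P (N+1)) (N+1) i 0 (x+1) y =
    -(Fb q S 1 * (Fb q O (i+1) * Fb q 1 m * Fb q (O*P) (i+1) * SS q o J (q*O) P (q*S) (Tm q (q*O) P N) N i 0 x y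
     - q*O*Fb q P i * Fb q (O*P) (N+2+i) * Fb q 1 i * SS q o J (q*O) P (q*S) (Tm q (q*O) P N) N (i-1) 0 x y)) := by
  obtain ⟨K, hK⟩ : ∃ K, y + K = N := ⟨N-y, by omega⟩
  have h := X_core g (Tm q O P (N+1)) i x y K hK (by omega)
  rw [mul_assoc (Fb q (o*S) 1), mul_assoc (Fb q (o*S) 1), mul_comm _ (SS q o J O P S _ _ _ _ _ _), ← mul_assoc, h, SS0 _ _ _ _ _ _ _ N i x y K hK, SS0 _ _ _ _ _ _ _ N (i-1) x y K hK]
  simp only [mul_sum, sum_mul, ← sum_sub_distrib, ← sum_neg_distrib]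
  apply sum_congr rfl
  intro a ha
  rw [mem_range] at ha
  obtain ⟨u, hu⟩ : ∃ u, a + u = N := ⟨N-a, by omega⟩
  obtain ⟨-, h1⟩ := XPM g.a i a u m hm hu
  have d2 := g.a.f12 (a+a+1) (by omega)
  have r := rel_fb g (J*O*P) (o*S) (N+3+a) (u+2) (by ring) (by omega)
  have ht := Tm_s q O P g.hq g.h2 (N+1) a
  have hqa := pow_ne_zero a g.hq
  rw [Tm_2 _ _ _ g.hq (a := a)] at ht
  rw [show N-a = u by omega, Tm_2 _ _ _ g.hq (a := a)]
  have e1 : J*O*q^2*(q*O*Tm q O P (N+1) (a+1)*Fb q (o*S) (u+2)) = Fb q (J*O*P) (N+3+a) * Tm q (q*O) P N a := by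
    have hr := g.rel
    rw [show 2*(N+1)+3 = (N+3+a)+(u+2) by omega, pow_add] at hr
    apply mul_left_cancel₀ hqa
    apply mul_left_cancel₀ hqa
    have hp : q^(a+1) = q^a*q := by ring
    have hp1 : q^(N+3+a) = q^(N+1)*q^2*q^a := by ring
    rw [hp] at ht
    rw [hp1] at hr
    generalize Tm q (q*O) P N a = t, Tm q O P (N+1) (a+1) = t', q^a = qa, q^(u+2) = qu, q^(N+1) = qN, Fb q (J*O*P) (N+3+a) = z at *
    linear_combination qa * J*O*q^2*Fb q (o*S) (u+2) * ht - qa^3*J*O*P*q^2*t*qN * r + z*t*qa^2*hr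
  rw [show a+a+1+1 = a+a+2 by rfl] at d2
  rw [show a+a+2 = a+a+2 by rfl, show q^(a+a+2) = q^a*q^a*q^2 by ring] at h1
  generalize Tm q (q*O) P N a = t, Tm q O P (N+1) (a+1) = t', W1 q o J (q*O) P (q*S) a 0 u (K-a) = w, ff q (q*S) (q*O) J K a x = f, ff q J (q*O) P N i a = f1, ff q J (q*O) P N (i-1) a = f2, ff q J O P (N+1) i a = f3, ff q J O P (N+1) i (a+1) = f4, Fb q (J*O) (a+a+2) = d at *
  rw [← sub_eq_zero]
  rw [← sub_eq_zero] at e1 h1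
  generalize Fb q (o*S) (u+2) = z1, Fb q (J*O*P) (N+3+a) = z2, Fb q (O*P) (i+i+1) = z3, Fb q 1 (N+1) = z4, Fb q O 1 = z5, Fb q P (u+1) = z6, Fb q O (i+1) = z7, Fb q 1 m = z8, Fb q (O*P) (i+1) = z9, Fb q (O*P) (N+2+i) = z10, Fb q 1 i = z11, Fb q P i = z12, Fb q S 1 = z13, q^a = qa at *
  have := congrArg₂ (fun X Y => z13*f*w/d * (t*X - z5*z4*z3*f4*Y)) h1 e1
  simp only [mul_zero, sub_zero] at this
  rw [← this]
  field_simp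
  ring

theorem Ip_rec {q o J O P S : ℂ} {N : ℕ} (g : Gen q o J O P S (N+1)) (i : ℕ) (hi : i ≤ N) :
    Fb q (J*O*P) (N+3) * SS q o J O P S (Tp q J P (N+1)) (N+1) (i+1) 0 0 0 =
    Fb q P 1 * (J*O*P*S*q^(2*N+4)) * SS q o J (q*O) (q*P) S (Tp q J (q*P) N) N i 0 0 0 := by
  rw [I_core g _ i hi, SS0 _ _ _ _ _ _ _ N i 0 0 N (by omega)]
  simp only [mul_sum, sum_mul]
  apply sum_congr rfl
  intro a ha
  rw [mem_range] at ha
  obtain ⟨u, hu⟩ : ∃ u, a + u = N := ⟨N-a, by omega⟩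
  have d2 := g.a.f12 (a+a+1) (by omega)
  have d4 : o*S*q^(u+2) ≠ 0 := mul_ne_zero (mul_ne_zero g.h0 g.h4) (pow_ne_zero _ g.hq)
  have hr := g.rel
  rw [Tp_3, Tp_s, show N-a = u by omega, ff_zero' q S (q*O) J _ _ g.hq]
  have e : 1/(o*S*q^(u+2)) = J*O*P*q^(N+3+a) := by
    rw [div_eq_iff d4]
    rw [show 2*(N+1)+3 = (N+3+a)+(u+2) by omega, pow_add] at hr
    linear_combination -hr
  have e1 : (- Tp q J P (N+1) a * Fb q S (u+1) / (o*S*q^(u+2))  - q*O*(-(J*P*q^(N+1+a+1)) *Tp q J P (N+1) a)*Fb q (J*O*S) (a+N+3)) =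
     Fb q (J*O) (a+a+2) * (J*O*P*S*q^(2*N+4)) * Tp q J P (N+1) a := by
    rw [div_eq_mul_one_div, e]
    simp only [fbd]
    rw [← hu]
    ring
  rw [e1]
  rw [show a+a+1+1 = a+a+2 by rfl] at d2
  generalize Fb q (J*O) (a+a+2) = d, ff q J (q*O) (q*P) N i a = f1, W1 q o J (q*O) (q*P) S a 0 u u = w, Tp q J P (N+1) a = t, q^(2*N+4) = p, Fb q P 1 = z at *
  field_simp

theorem Im_rec {q o J O P S : ℂ} {N : ℕ} (g : Gen q o J O P S (N+1)) (i : ℕ) (hi : i ≤ N) :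
    Fb q (J*O*P) (N+3) * SS q o J O P S (Tm q O P (N+1)) (N+1) (i+1) 0 0 0 =
    Fb q P 1 * (P*q^(N+1)) * SS q o J (q*O) (q*P) S (Tm q (q*O) (q*P) N) N i 0 0 0 := by
  rw [I_core g _ i hi, SS0 _ _ _ _ _ _ _ N i 0 0 N (by omega)]
  simp only [mul_sum, sum_mul]
  apply sum_congr rfl
  intro a ha
  rw [mem_range] at ha
  obtain ⟨u, hu⟩ : ∃ u, a + u = N := ⟨N-a, by omega⟩
  have d2 := g.a.f12 (a+a+1) (by omega)
  have d4 : o*S*q^(u+2) ≠ 0 := mul_ne_zero (mul_ne_zero g.h0 g.h4) (pow_ne_zero _ g.hq)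
  have hr := g.rel
  have hqa := pow_ne_zero a g.hq
  have ht := Tm_s q O P g.hq g.h2 (N+1) a
  rw [Tm_23 _ _ _ g.hq (a := a)] at ht
  rw [show N-a = u by omega, Tm_23 _ _ _ g.hq (a := a), ff_zero' q S (q*O) J _ _ g.hq]
  have e : 1/(o*S*q^(u+2)) = J*O*P*q^(N+3+a) := by
    rw [div_eq_iff d4]
    rw [show 2*(N+1)+3 = (N+3+a)+(u+2) by omega, pow_add] at hr
    linear_combination -hr
  have ht' : q*O*Tm q O P (N+1) (a+1) = -(P*q^(N+1))*Tm q (q*O) (q*P) N a := by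
    apply mul_left_cancel₀ hqa
    linear_combination ht
  rw [ht']
  have e1 : (- (Tm q (q*O) (q*P) N a * q^a) * Fb q S (u+1) / (o*S*q^(u+2))  - -(P*q^(N+1))*Tm q (q*O) (q*P) N a *Fb q (J*O*S) (a+N+3)) =
     Fb q (J*O) (a+a+2) * (P*q^(N+1)) * Tm q (q*O) (q*P) N a := by
    rw [div_eq_mul_one_div, e]
    simp only [fbd]
    rw [← hu]
    ring
  rw [e1]
  rw [show a+a+1+1 = a+a+2 by rfl] at d2
  generalize Fb q (J*O) (a+a+2) = d, ff q J (q*O) (q*P) N i a = f1, W1 q o J (q*O) (q*P) S a 0 u u = w, Tm q (q*O) (q*P) N a = t, q^(N+1) = p, Fb q P 1 = z at *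
  field_simp


theorem SS00 {q o J O P S : ℂ} (hq : q ≠ 0) (T : ℕ → ℂ) (N : ℕ) :
    SS q o J O P S T N 0 0 0 0 = ∑ a ∈ range (N+1), T a * W1 q o J O P S a 0 (N-a) (N-a) := by
  rw [SS0 _ _ _ _ _ _ _ N 0 0 0 N (by omega)]
  apply sum_congr rfl
  intro a _
  rw [ff_zero, ff_zero' _ _ _ _ _ _ hq]; ring

theorem base_gen {q o J O P S : ℂ} {N : ℕ} (g : Gen q o J O P S (N+1)) (T T34 T02 r : ℕ → ℂ) (U V : ℂ)
    (hr : r (N+1) = -1)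
    (H : ∀ a u : ℕ, a + u = N → 
      T a*Fb q (J*O) (a+a+1)*Fb q P (u+1)*Fb q S (u+1)*Fb q 1 (N+1)*Fb q J (N+1) = 
      U*T34 a*Fb q 1 (u+1)*Fb q (J*O) (a+a+u+2)*Fb q (J*O) (a+a+1)*Fb q P (u+1)*Fb q S (u+1)
      + V*T02 a*(Fb q O (a+1)*Fb q (J*O) (a+1)*Fb q 1 (u+1))*Fb q (J*O) (a+a+2)
      + r (a+1)*T (a+1)*(Fb q O (a+1)*Fb q (J*O) (a+1)*Fb q 1 (u+1))*Fb q (o*S) (u+2)*Fb q (J*O*S) (a+a+u+3)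
      - r a*T a*Fb q 1 a*Fb q J a*Fb q (J*O) (a+a+u+2)*Fb q P (u+1)*Fb q S (u+1)) :
    Fb q (o*S) 1 * Fb q J (N+1) * SS q o J O P S T (N+1) 0 0 0 0 =
    U * Fb q P 1 * Fb q S 1 * SS q o J O (q*P) (q*S) T34 N 0 0 0 0 
    + V * Fb q O 1 * SS q (q*o) J (q*O) P S T02 N 0 0 0 0 := by
  have h1 : Fb q 1 (N+1) ≠ 0 := g.a.f0 _ (by omega)
  apply mul_left_cancel₀ h1
  rw [SS00 g.hq, SS00 g.hq, SS00 g.hq]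
  set A : ℕ → ℂ := fun a => r a * T a * W1 q o J O P S a 0 (N+1-a) (N+1-a) * Fb q 1 a * Fb q J a * Fb q (J*O) (N+2+a) / Fb q (J*O) (a+a+1) with hA
  have hA0 : A 0 = 0 := by simp [hA, fb10]
  have d3 := g.a.f12 (N+1+(N+1)) (by omega)
  have hA1 : A (N+1) = -(T (N+1) * W1 q o J O P S (N+1) 0 (N+1-(N+1)) (N+1-(N+1)) * Fb q 1 (N+1) * Fb q J (N+1)) := by
    simp only [hA]
    rw [hr, show N+2+(N+1) = N+1+(N+1)+1 by omega]
    field_simp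
  have ht := sum_range_sub A (N+1)
  rw [hA0, hA1] at ht
  rw [sum_range_succ (fun a => T a * W1 q o J O P S a 0 (N+1-a) (N+1-a))]
  have key : Fb q (o*S) 1 * (Fb q 1 (N+1) * Fb q J (N+1) * ∑ a ∈ range (N+1), T a * W1 q o J O P S a 0 (N+1-a) (N+1-a) - ∑ a ∈ range (N+1), (A (a+1) - A a)) = 
    Fb q 1 (N+1) * (U * Fb q P 1 * Fb q S 1 * (∑ a ∈ range (N+1), T34 a * W1 q o J O (q*P) (q*S) a 0 (N-a) (N-a)) + V * Fb q O 1 * ∑ a ∈ range (N+1), T02 a * W1 q (q*o) J (q*O) P S a 0 (N-a) (N-a)) := by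
    simp only [mul_sum, ← sum_add_distrib, ← sum_sub_distrib]
    apply sum_congr rfl
    intro a ha
    rw [mem_range] at ha
    obtain ⟨u, hu⟩ : ∃ u, a + u = N := ⟨N-a, by omega⟩
    have HH := H a u hu
    simp only [hA]
    rw [show N-a = u by omega, show N+1-a = u+1 by omega, show N+1-(a+1) = u by omega]
    have w1 := W_BA g a u u (by omega) (by omega)
    have w2 := W_BB g a u u (by omega) (by omega)
    have w3 := W_succ g a u u (by omega) (by omega)
    have e1 := g.a.f12 (a+a) (by omega)
    have e2 := g.a.f12 (a+a+2) (by omega)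
    have e3 := g.a.f3 u (by omega)
    have e4 := g.c.f1 u (by omega)
    rw [show a+u+1 = N+1 by omega] at w1 w2
    rw [show N+2+a = a+a+u+2 by omega, show N+2+(a+1) = a+a+u+3 by omega, show a+1+(a+1)+1 = a+a+3 by omega]
    rw [show a+a+2+1 = a+a+3 by omega] at e2
    generalize W1 q o J O (q*P) (q*S) a 0 u u = x1, W1 q (q*o) J (q*O) P S a 0 u u = x2, W1 q o J O P S (a+1) 0 u u = x3, W1 q o J O P S a 0 (u+1) (u+1) = x, Fb q 1 (N+1) = y1, Fb q (J*O) (a+a+u+2) = y2, Fb q (J*O) (a+a+u+3) = y3, Fb q (J*O) (a+a+1) = y4, Fb q (J*O) (a+a+2) = y5, Fb q (J*O) (a+a+3) = y6, Fb q P (u+1) = y7, Fb q S (u+1) = y8, Fb q 1 (u+1) = y9, Fb q (J*O) (a+1) = y10, Fb q O (a+1) = y11, Fb q J (a+1) = y12, Fb q 1 (a+1) = y13, Fb q P 1 = y14, Fb q S 1 = y15, Fb q O 1 = y16, Fb q J (N+1) = y17, Fb q J a = y18, Fb q 1 a = y19, Fb q (o*S) 1 = y20, Fb q (o*S) (u+2)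 = y21, Fb q (J*O*S) (a+a+u+3) = y22, r (a+1) = r1, T (a+1) = T1, r a = r0, T a = T0, T34 a = TA, T02 a = TB at *
    have E : y4*y6*y7*y8 ≠ 0 := by simp [*]
    rw [← sub_eq_zero]
    apply mul_left_cancel₀ E
    rw [mul_zero]
    rw [← sub_eq_zero] at w1 w2 w3 HH
    have J : y20*x*y6*(T0*y4*y7*y8*y1*y17 - (U*TA*y9*y2*y4*y7*y8 + V*TB*(y11*y10*y9)*y5 + r1*T1*(y11*y10*y9)*y21*y22 - r0*T0*y19*y18*y2*y7*y8)) - U*TA*y4*y6*y7*y8*(x1 * (y14 * y15 * y1) - x * (y9 * y20 * y2)) - V*TB*y6*(x2 * (y16 * y4 * y7 * y8 * y1) - x * (y11 * y5 * y10 * y9 * y20)) - y20*r1*T1*(x3 * (y4 * y12 * y13 * y7 * y8 * y3) - x * (y6 * y11 * y10 * y9 * y21 * y22)) = 0 := by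
      rw [HH, w1, w2, w3]; ring
    rw [← J]
    field_simp
    ring
  rw [ht] at key
  linear_combination key

theorem base_p {q o J O P S : ℂ} {N : ℕ} (g : Gen q o J O P S (N+1)) :
    Fb q (o*S) 1 * Fb q J (N+1) * SS q o J O P S (Tp q J P (N+1)) (N+1) 0 0 0 0 =
    Fb q P 1 * Fb q S 1 * SS q o J O (q*P) (q*S) (Tp q J (q*P) N) N 0 0 0 0 
    - J*P*S*q^(3*(N+1))*Fb q o 1 * Fb q O 1 * SS q (q*o) J (q*O) P S (Tp q J P N) N 0 0 0 0 := by
  have := base_gen g (Tp q J P (N+1)) (Tp q J (q*P) N) (Tp q J P N) (fun a => -q^(N+1-a)) 1 (-(J*P*S*q^(3*(N+1))*Fb q o 1)) (by simp) ?_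
  · rw [this]; ring
  intro a u hu
  have hr := g.rel
  rw [Tp_3, Tp_s, Tp_N]
  generalize Tp q J P N a = t
  simp only [fbd]
  rw [show N+1-a = u+1 by omega, show N+1-(a+1) = u by omega]
  subst hu
  rw [show 2*(a+u+1)+3 = a+a+u+u+5 by omega] at hr
  linear_combination J*q^(a+a+a+u+1)*t*((1-O*q^(a+1))*(1-J*O*q^(a+1))*(1-1*q^(u+1)))*(1-S*q^(u+1))*hr

theorem base_m {q o J O P S : ℂ} {N : ℕ} (g : Gen q o J O P S (N+1)) :
    O*q*Fb q (o*S) 1 * Fb q J (N+1) * SS q o J O P S (Tm q O P (N+1)) (N+1) 0 0 0 0 =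
    Fb q P 1 * Fb q S 1 * SS q o J O (q*P) (q*S) (Tm q O (q*P) N) N 0 0 0 0 
    - P*S*q^(2*N+2)*Fb q o 1 * Fb q O 1 * SS q (q*o) J (q*O) P S (Tm q (q*O) P N) N 0 0 0 0 := by
  have h2 := g.h2
  have hq := g.hq
  have := base_gen g (Tm q O P (N+1)) (Tm q O (q*P) N) (Tm q (q*O) P N) (fun a => -1) (1/(O*q)) (-(P*S/O*q^(2*N+1)*Fb q o 1)) (by simp) ?_
  · rw [mul_assoc, mul_assoc, ← mul_assoc (Fb q (o*S) 1), this]; field_simp; ring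
  intro a u hu
  have hr := g.rel
  have ht := Tm_s q O P g.hq g.h2 (N+1) a
  rw [Tm_3, Tm_2 _ _ _ hq (a := a)]
  rw [Tm_2 _ _ _ hq (a := a)] at ht
  have ht' : Tm q O P (N+1) (a+1) = -(P*q^u)*(Tm q (q*O) P N a * (q^a*q^a))/O := by
    rw [eq_div_iff h2]
    apply mul_right_cancel₀ (pow_ne_zero (a+1) hq)
    rw [mul_assoc, ht, ← hu]; ring
  rw [ht']
  generalize Tm q (q*O) P N a = t
  simp only [fbd]
  subst hu
  rw [show 2*(a+u+1)+3 = a+a+u+u+5 by omega] at hr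
  have h : O*q ≠ 0 := mul_ne_zero h2 hq
  rw [← sub_eq_zero]
  rw [← sub_eq_zero] at hr
  have := congrArg (fun X => q^(a+a)/(O*q)*t*((1-O*q^(a+1))*(1-J*O*q^(a+1))*(1-1*q^(u+1)))*(1-S*q^(u+1))*X) hr
  simp only [mul_zero] at this
  rw [← this]
  field_simp
  ring


def Rr (q o O P S : ℂ) (N i j x y : ℕ) : ℂ :=
  (o*O*q^(N+1))^x / (P*S*q^(N+1))^y * ((-(P*S/O))^N * qt q N) * ((-O)^i * qt q i) * ((-(1/S))^j / qt q j)

theorem Rr_J {q o O P S : ℂ} (hq : q ≠ 0) (h2 : O ≠ 0) (h4 : S ≠ 0) (N i j x y : ℕ) :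
    Rr q o O P S (N+1) i (j+1) x y * O = P * Rr q (q*o) O P (q*S) N i j x y := by
  unfold Rr
  rw [show o*O*q^(N+1+1) = q*o*O*q^(N+1) by ring, show P*S*q^(N+1+1) = P*(q*S)*q^(N+1) by ring,
    show -(P*(q*S)/O) = -(P*S/O)*q by ring, show (-(1/(q*S))) = (-(1/S))/q by field_simp, mul_pow _ q N, div_pow _ q j,
    qt_succ, qt_succ]
  have := qt_ne q hq j
  generalize qt q j = z1 at *
  rw [pow_succ (-(P*S/O)) N, pow_succ (-(1/S)) j, pow_succ q N, pow_succ q j]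
  generalize (q*o*O*(q^N*q))^x = z2
  generalize (P*(q*S)*(q^N*q))^y = z3
  generalize (-(P*S/O))^N = z4
  generalize (-(1/S))^j = z5
  have := pow_ne_zero N hq
  have := pow_ne_zero j hq
  generalize q^N = z6, q^j = z7 at *
  field_simp

theorem Rr_x (q o O P S : ℂ) (N i j x y : ℕ) :
    Rr q o O P S N i j (x+1) y = (o*O*q^(N+1)) * Rr q o O P S N i j x y := by
  unfold Rr; ring
theorem Rr_y {q o O P S : ℂ} (hq : q ≠ 0) (h3 : P ≠ 0) (h4 : S ≠ 0) (N i j x y : ℕ) :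
    (P*S*q^(N+1)) * Rr q o O P S N i j x (y+1) = Rr q o O P S N i j x y := by
  unfold Rr; rw [pow_succ (P*S*q^(N+1)) y]
  have : P*S*q^(N+1) ≠ 0 := mul_ne_zero (mul_ne_zero h3 h4) (pow_ne_zero _ hq)
  generalize P*S*q^(N+1) = z at *
  field_simp
theorem Rr_i (q o O P S : ℂ) (N i j x y : ℕ) :
    Rr q o O P S N (i+1) j x y = (-(O*q^(i+1))) * Rr q o O P S N i j x y := by
  unfold Rr; rw [qt_succ]; ring

theorem Rr_Y {q o O P S : ℂ} (hq : q ≠ 0) (h2 : O ≠ 0) (h3 : P ≠ 0) (h4 : S ≠ 0) (N i x y : ℕ) :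
    Rr q o O P S (N+1) i 0 x (y+1) * (O*q^(N+1)) = - Rr q (q*o) O (q*P) S N i 0 x y := by
  have h : Rr q o O P S (N+1) i 0 x y * O = -(P*S*q)*Rr q (q*o) O (q*P) S N i 0 x y := by
    unfold Rr
    rw [show o*O*q^(N+1+1) = q*o*O*q^(N+1) by ring, show P*S*q^(N+1+1) = q*P*S*q^(N+1) by ring,
      show -(q*P*S/O) = -(P*S/O)*q by ring, mul_pow _ q N, qt_succ]
    rw [pow_succ (-(P*S/O)) N, pow_succ q N]
    generalize (q*o*O*(q^N*q))^x = z2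
    generalize (q*P*S*(q^N*q))^y = z3
    generalize (-(P*S/O))^N = z4
    field_simp
  have hz : P*S*q ≠ 0 := mul_ne_zero (mul_ne_zero h3 h4) hq
  apply mul_left_cancel₀ hz
  rw [← Rr_y hq h3 h4 (N+1)] at h
  linear_combination h

theorem Rr_X {q o J O P S : ℂ} {N : ℕ} (g : Gen q o J O P S (N+1)) (i x y : ℕ) :
    Rr q o O P S (N+1) i 0 (x+1) y * (J*O*q^2*q^i) = - Rr q o (q*O) P (q*S) N i 0 x y := by
  have hq := g.hq
  have h2 := g.h2
  have h : Rr q o O P S (N+1) i 0 x y * (O*q^i) = -(P*S*q^(N+1))*Rr q o (q*O) P (q*S) N i 0 x y := by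
    unfold Rr
    rw [show o*O*q^(N+1+1) = o*(q*O)*q^(N+1) by ring, show P*S*q^(N+1+1) = P*(q*S)*q^(N+1) by ring,
      show -(P*(q*S)/(q*O)) = -(P*S/O) by field_simp, show -(q*O) = -O*q by ring, mul_pow _ q i, qt_succ]
    rw [pow_succ (-(P*S/O)) N, pow_succ q N]
    generalize (o*(q*O)*(q^N*q))^x = z2
    generalize (P*(q*S)*(q^N*q))^y = z3
    generalize (-(P*S/O))^N = z4
    field_simp
  rw [Rr_x]
  have hr := g.rel
  linear_combination o*J*O*q^(N+4)*h - Rr q o (q*O) P (q*S) N i 0 x y * hr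

theorem Rr_I {q o O P S : ℂ} (hq : q ≠ 0) (h2 : O ≠ 0) (N i : ℕ) :
    Rr q o O P S (N+1) (i+1) 0 0 0 = P*S*q^(N+2) * Rr q o (q*O) (q*P) S N i 0 0 0 := by
  unfold Rr
  rw [show -(q*P*S/(q*O)) = -(P*S/O) by field_simp, show -(q*O) = -O*q by ring, mul_pow _ q i, qt_succ, qt_succ]
  rw [pow_succ (-(P*S/O)) N]
  generalize (-(P*S/O))^N = z4
  simp only [pow_zero, div_one, one_mul]
  field_simp
  ring

theorem Rr_B34 {q o O P S : ℂ} (hq : q ≠ 0) (h2 : O ≠ 0) (N : ℕ) :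
    Rr q o O P S (N+1) 0 0 0 0 * (O*q^N) = -(P*S*q)*Rr q o O (q*P) (q*S) N 0 0 0 0 := by
  unfold Rr
  rw [show -(q*P*(q*S)/O) = -(P*S/O)*(q*q) by ring, mul_pow _ (q*q) N, mul_pow q q N, qt_succ]
  rw [pow_succ (-(P*S/O)) N, pow_succ q N]
  generalize (-(P*S/O))^N = z4
  simp only [pow_zero, div_one, one_mul]
  field_simp

theorem Rr_B02 {q o O P S : ℂ} (hq : q ≠ 0) (h2 : O ≠ 0) (N : ℕ) :
    Rr q o O P S (N+1) 0 0 0 0 * O = -(P*S*q^(2*N+1))*Rr q (q*o) (q*O) P S N 0 0 0 0 := by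
  unfold Rr
  rw [show -(P*S/(q*O)) = -(P*S/O)/q by field_simp, div_pow, qt_succ]
  rw [pow_succ (-(P*S/O)) N]
  generalize (-(P*S/O))^N = z4
  simp only [pow_zero, div_one, one_mul]
  field_simp
  ring

def SymP (q o J O P S : ℂ) (N i j x y : ℕ) : Prop :=
  SS q o J O P S (Tm q O P N) N i j x y * (PP q O x * PP q o y * PP q O i * PP q o j) =
  Rr q o O P S N i j x y * SS q S J P O o (Tp q J O N) N i j y x * (PP q P y * PP q S x * PP q P i * PP q S j)

theorem Sym_B {q o J O P S : ℂ} {N : ℕ} (g : Gen q o J O P S (N+1))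
   (I1 : SymP q o J O (q*P) (q*S) N 0 0 0 0) (I2 : SymP q (q*o) J (q*O) P S N 0 0 0 0) :
   SymP q o J O P S (N+1) 0 0 0 0 := by
  have hr := g.rel
  have k1 := Rr_B34 (o:=o) (P:=P) (S:=S) g.hq g.h2 N
  have k2 := Rr_B02 (o:=o) (P:=P) (S:=S) g.hq g.h2 N
  have b1 := base_m g
  have b2 := base_p g.sw
  unfold SymP at *
  simp only [PP_zero, mul_one] at *
  rw [I1, I2] at b1
  rw [mul_comm S o] at b2
  have hK : O*q*Fb q (o*S) 1 * Fb q J (N+1)*q^N ≠ 0 := by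
    refine mul_ne_zero (mul_ne_zero (mul_ne_zero (mul_ne_zero g.h2 g.hq) (g.f04 0 (by omega))) (g.a.f1 _ (by omega))) (pow_ne_zero _ g.hq)
  apply mul_left_cancel₀ hK
  generalize SS q o J O P S (Tm q O P (N+1)) (N+1) 0 0 0 0 = s1, SS q S J P O o (Tp q J O (N+1)) (N+1) 0 0 0 0 = s2, SS q (q*S) J (q*P) O o (Tp q J O N) N 0 0 0 0 = s3, SS q S J P (q*O) (q*o) (Tp q J (q*O) N) N 0 0 0 0 = s4, Rr q o O P S (N+1) 0 0 0 0 = r1, Rr q o O (q*P) (q*S) N 0 0 0 0 = r2, Rr q (q*o) (q*O) P S N 0 0 0 0 = r3, Fb q (o*S) 1 = f04, Fb q J (N+1) = f1, Fb q o 1 = f0, Fb q O 1 = f2, Fb q P 1 = f3, Fb q S 1 = f4 at *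
  linear_combination q^N*b1 - r1*O*q*q^N*b2 - q^N*q*s4*f0*f2*k2 + q^(3*(N+1))*q*s3*f3*f4*o*J*O*k1 - q^N*r2*s3*f3*f4*hr

theorem Sym_I {q o J O P S : ℂ} {N : ℕ} (g : Gen q o J O P S (N+1)) (i : ℕ) (hi : i ≤ N)
   (I1 : SymP q o J (q*O) (q*P) S N i 0 0 0) :
   SymP q o J O P S (N+1) (i+1) 0 0 0 := by
  have hr := g.rel
  have k1 := Rr_I (o:=o) (P:=P) (S:=S) g.hq g.h2 N i
  have b1 := Im_rec g i hi
  have b2 := Ip_rec g.sw i hi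
  have p2 := PP_succ' q O i (g.a.f2 0 (by omega))
  have p3 := PP_succ' q P i (g.a.f3 0 (by omega))
  unfold SymP at *
  simp only [PP_zero, mul_one, one_mul] at *
  rw [show J*P*O = J*O*P by ring] at b2
  rw [k1, p2, p3]
  have hK : Fb q (J*O*P) (N+3) ≠ 0 := g.a.f123 _ (by omega)
  apply mul_left_cancel₀ hK
  linear_combination Fb q O 1 * PP q (q*O) i * b1 - P*S*q^(N+2) * Rr q o (q*O) (q*P) S N i 0 0 0*Fb q P 1 * PP q (q*P) i*b2 + Fb q P 1 * Fb q O 1 * P*q^(N+1) * I1 - P*q^(N+1)*Fb q P 1 * Fb q O 1 *  Rr q o (q*O) (q*P) S N i 0 0 0*PP q (q*P) i*SS q S J (q*P) (q*O) o (Tp q J (q*O) N) N i 0 0 0 * hr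

theorem Sym_Y {q o J O P S : ℂ} {N : ℕ} (g : Gen q o J O P S (N+1)) (i x y : ℕ) (hi : i ≤ N+1) (hx : x + y ≤ N)
   (IH : ∀ i ≤ N, SymP q (q*o) J O (q*P) S N i 0 x y) :
   SymP q o J O P S (N+1) i 0 x (y+1) := by
  obtain ⟨m, hm⟩ : ∃ m, i + m = N+1 := ⟨N+1-i, by omega⟩
  have hY := Y_rec g (Tm q O P (N+1)) i x y m hm
  have hX := Xp_rec g.sw i y x m hm (by omega)
  have rr := Rr_Y (o:=o) (i := i) (x:=x) (y:=y) g.hq g.h2 g.h3 g.h4 N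
  have h31 : Fb q P 1 ≠ 0 := g.a.f3 0 (by omega)
  have pa := PP_succ' q o y (g.b.f2 0 (by omega))
  have pb := PP_succ' q P y h31
  rw [← Tm_3] at hY
  have E1 : Fb q 1 m * (SS q (q*o) J O (q*P) S (Tm q O (q*P) N) N i 0 x y *(PP q O x * PP q (q*o) y * PP q O i)*Fb q P 1) = 
    Fb q 1 m * (Rr q (q*o) O (q*P) S N i 0 x y * SS q S J (q*P) O (q*o) (Tp q J O N) N i 0 y x * (PP q (q*P) y * PP q S x * PP q P i * Fb q P (i+1))) := by
    rcases Nat.eq_zero_or_pos m with h0 | h0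
    · rw [h0, fb10]; ring
    have := IH i (by omega)
    unfold SymP at this
    simp only [PP_zero, mul_one] at this
    have k3 := PP_succ' q P i h31
    rw [PP_succ] at k3
    linear_combination Fb q 1 m * Fb q P 1 * this - Fb q 1 m * Rr q (q*o) O (q*P) S N i 0 x y * SS q S J (q*P) O (q*o) (Tp q J O N) N i 0 y x * (PP q (q*P) y * PP q S x) * k3
  have E2 : Fb q 1 i * (SS q (q*o) J O (q*P) S (Tm q O (q*P) N) N (i-1) 0 x y *(PP q O x * PP q (q*o) y * PP q O i)*Fb q P 1*(-(O*q^i))) = 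
    Fb q 1 i * (Fb q O i * Rr q (q*o) O (q*P) S N i 0 x y * SS q S J (q*P) O (q*o) (Tp q J O N) N (i-1) 0 y x * (PP q (q*P) y * PP q S x * PP q P i)) := by
    rcases i with _ | i
    · rw [fb10]; ring
    have := IH i (by omega)
    unfold SymP at this
    simp only [PP_zero, mul_one] at this
    rw [PP_succ' q P i h31, PP_succ, Rr_i, Nat.add_sub_cancel]
    linear_combination Fb q 1 (i+1) * Fb q P 1 * Fb q O (i+1) * (-(O*q^(i+1))) * this
  unfold SymP
  simp only [PP_zero, mul_one]
  rw [pa, pb]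
  rw [mul_comm S o, mul_comm P O, show N+2+i = i+N+2 by omega] at hX
  have hK : Fb q (o*S) 1 * Fb q (O*P) (i+i+1) * Fb q 1 (N+1) * q^i * Fb q P 1 * (O*q^(N+1)) ≠ 0 := by
    refine mul_ne_zero (mul_ne_zero (mul_ne_zero (mul_ne_zero (mul_ne_zero (g.f04 0 (by omega)) (g.a.f23 _ (by omega))) (g.a.f0 _ (by omega))) (pow_ne_zero _ g.hq)) h31) (mul_ne_zero g.h2 (pow_ne_zero _ g.hq))
  apply mul_left_cancel₀ hK
  generalize Rr q o O P S (N+1) i 0 x (y+1) = R, Rr q (q*o) O (q*P) S N i 0 x y = r at *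
  rw [Tm_3] at *
  generalize SS q o J O P S (Tm q O P (N+1)) (N+1) i 0 x (y+1) = s1, SS q S J P O o (Tp q J O (N+1)) (N+1) i 0 (y+1) x = s2, SS q (q*o) J O (q*P) S (Tm q O P (N+1)) N i 0 x y = s3, SS q (q*o) J O (q*P) S (Tm q O P (N+1)) N (i-1) 0 x y = s4, SS q S J (q*P) O (q*o) (Tp q J O N) N i 0 y x = s5, SS q S J (q*P) O (q*o) (Tp q J O N) N (i-1) 0 y x = s6, Fb q 1 i = z1, Fb q 1 m = z2, Fb q P 1 = z3, Fb q (o*S) 1 = z4, Fb q (O*P) (i+i+1) = z5, Fb q 1 (N+1) = z6, Fb q (O*P) (i+1) = z7, Fb q (O*P) (i+N+2) = z8, Fb q o 1 = z9, Fb q P (i+1) = z10, Fb q O i = z11, q^i = qi, q^(N+1) = qN, PP q O x = p1, PP q (q*o) y = p2, PP q O i = p3, PP q (q*P) y = p4, PP q S x = p5, PP q P i = p6 at *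
  linear_combination qi*z3*O*qN*p1*z9*p2*p3*hY + qi*O*qN*z9*z3*qi*z7*E1 - qN*z9*z3*z8*E2 - z4*(z3*z6*z5)*qi*s2*z3*p4*p5*p6*rr + r*z3*p4*p5*p6*hX

theorem Sym_X {q o J O P S : ℂ} {N : ℕ} (g : Gen q o J O P S (N+1)) (i x y : ℕ) (hi : i ≤ N+1) (hx : x + y ≤ N)
   (IH : ∀ i ≤ N, SymP q o J (q*O) P (q*S) N i 0 x y) :
   SymP q o J O P S (N+1) i 0 (x+1) y := by
  obtain ⟨m, hm⟩ : ∃ m, i + m = N+1 := ⟨N+1-i, by omega⟩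
  have hY := Y_rec g.sw (Tp q J O (N+1)) i y x m hm
  have hX := Xm_rec g i x y m hm (by omega)
  have rr := Rr_X g i x y
  have h21 : Fb q O 1 ≠ 0 := g.a.f2 0 (by omega)
  have pa := PP_succ' q S x (g.c.f1 0 (by omega))
  have pb := PP_succ' q O x h21
  rw [← Tp_3] at hY
  have E1 : Fb q 1 m * (SS q o J (q*O) P (q*S) (Tm q (q*O) P N) N i 0 x y *(PP q (q*O) x * PP q o y * PP q O i*Fb q O (i+1))) = 
    Fb q 1 m * (Rr q o (q*O) P (q*S) N i 0 x y * SS q (q*S) J P (q*O) o (Tp q J (q*O) N) N i 0 y x * (PP q P y * PP q (q*S) x * PP q P i * Fb q O 1)) := by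
    rcases Nat.eq_zero_or_pos m with h0 | h0
    · rw [h0, fb10]; ring
    have := IH i (by omega)
    unfold SymP at this
    simp only [PP_zero, mul_one] at this
    have k3 := PP_succ' q O i h21
    rw [PP_succ] at k3
    linear_combination Fb q 1 m * Fb q O 1 * this + Fb q 1 m * SS q o J (q*O) P (q*S) (Tm q (q*O) P N) N i 0 x y *(PP q (q*O) x * PP q o y) * k3
  have E2 : Fb q 1 i * (Fb q P i * SS q o J (q*O) P (q*S) (Tm q (q*O) P N) N (i-1) 0 x y *(PP q (q*O) x * PP q o y * PP q O i)*(-(q*O*q^i))) = 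
    Fb q 1 i * (Rr q o (q*O) P (q*S) N i 0 x y * SS q (q*S) J P (q*O) o (Tp q J (q*O) N) N (i-1) 0 y x * (PP q P y * PP q (q*S) x * PP q P i * Fb q O 1)) := by
    rcases i with _ | i
    · rw [fb10]; ring
    have := IH i (by omega)
    unfold SymP at this
    simp only [PP_zero, mul_one] at this
    rw [PP_succ' q O i h21, PP_succ, Rr_i, Nat.add_sub_cancel]
    linear_combination Fb q 1 (i+1) * Fb q O 1 * Fb q P (i+1) * (-(q*O*q^(i+1))) * this
  unfold SymP
  simp only [PP_zero, mul_one]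
  rw [pa, pb]
  rw [mul_comm S o, mul_comm P O, show i+N+2 = N+2+i by omega] at hY
  have hK : Fb q (o*S) 1 * (Fb q O 1 * Fb q 1 (N+1) * Fb q (O*P) (i+i+1)) * (J*O*q^2*q^i) ≠ 0 := by
    refine mul_ne_zero (mul_ne_zero (g.f04 0 (by omega)) (mul_ne_zero (mul_ne_zero h21 (g.a.f0 _ (by omega))) (g.a.f23 _ (by omega)))) (mul_ne_zero (mul_ne_zero (mul_ne_zero g.h1 g.h2) (pow_ne_zero _ g.hq)) (pow_ne_zero _ g.hq))
  apply mul_left_cancel₀ hK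
  generalize Rr q o O P S (N+1) i 0 (x+1) y = R, Rr q o (q*O) P (q*S) N i 0 x y = r at *
  rw [Tp_3] at *
  generalize SS q o J O P S (Tm q O P (N+1)) (N+1) i 0 (x+1) y = s1, SS q S J P O o (Tp q J O (N+1)) (N+1) i 0 y (x+1) = s2, SS q o J (q*O) P (q*S) (Tm q (q*O) P N) N i 0 x y = s3, SS q o J (q*O) P (q*S) (Tm q (q*O) P N) N (i-1) 0 x y = s4, SS q (q*S) J P (q*O) o (Tp q J O (N+1)) N i 0 y x = s5, SS q (q*S) J P (q*O) o (Tp q J O (N+1)) N (i-1) 0 y x = s6, Fb q 1 i = z1, Fb q 1 m = z2, Fb q O 1 = z3, Fb q (o*S) 1 = z4, Fb q (O*P) (i+i+1) = z5, Fb q 1 (N+1) = z6, Fb q (O*P) (i+1) = z7, Fb q (O*P) (N+2+i) = z8, Fb q S 1 = z9, Fb q O (i+1) = z10, Fb q P i = z11, q^i = qi, PP q (q*O) x = p1, PP q o y = p2, PP q O i = p3, PP q P y = p4, PP q (q*S) x = p5, PP q P i = p6 at *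
  linear_combination qi*z3*p1*p2*p3*hX - qi*z3*z9*z7*E1 - z3*z9*z8*E2 - (z4*z5*z6*s2)*z3*p4*z9*p5*p6*rr + r*z3*p4*z9*p5*p6*hY


theorem Sym_J {q o J O P S : ℂ} {N : ℕ} (g : Gen q o J O P S (N+1)) (i j x y : ℕ) (hj : j ≤ N) (hx : x + y ≤ N+1)
   (IH : ∀ x y, x + y ≤ N → SymP q (q*o) J O P (q*S) N i j x y) :
   SymP q o J O P S (N+1) i (j+1) x y := by
  obtain ⟨n, hn⟩ : ∃ n, x + y + n = N+1 := ⟨N+1-(x+y), by omega⟩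
  have hJ := J_rec g _ _ (Tm_N q O P N) i j x y n hn hj
  have hJ' := J_rec g.sw _ _ (Tp_N q J O N) i j y x n (by omega) hj
  have hr := g.rel
  have hq := g.hq
  have rr := Rr_J (o:=o) (P:=P) hq g.h2 g.h4 N i j x y
  have h01 : Fb q o 1 ≠ 0 := g.b.f2 0 (by omega)
  have h41 : Fb q S 1 ≠ 0 := g.c.f1 0 (by omega)
  have pa := PP_succ' q o j h01
  have pb := PP_succ' q S j h41
  have ky : PP q o y * Fb q o (y+1) = Fb q o 1 * PP q (q*o) y := by
    rw [← PP_succ' q o y h01, PP_succ]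
  have kx : PP q S x * Fb q S (x+1) = Fb q S 1 * PP q (q*S) x := by
    rw [← PP_succ' q S x h41, PP_succ]
  have K2 : -Fb q (O*S) (x+x+n+1) * (J*P*o*q^(y+n+2)) * O = P * Fb q (J*P*o) (y+y+n+2) * (J*O*S*q^(x+n+2)) * (q*o*O*q^(N+1)) := by
    have r := rel_fb g (O*S) (J*P*o) (x+x+n+1) (y+y+n+2) (by ring) (by omega)
    apply mul_left_cancel₀ (pow_ne_zero y hq)
    rw [show 2*(N+1)+3 = y+(x+n+2)+1+(N+1) by omega] at hr
    linear_combination -O*r - O*Fb q (J*P*o) (y+y+n+2)*hr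
  have K3 : -Fb q (o*P) (y+y+n+1) * (J*O*S*q^(x+n+2)) * P = O * Fb q (J*O*S) (x+x+n+2) * (J*P*o*q^(y+n+2)) * (P*(q*S)*q^(N+1)) := by
    have r := rel_fb g (o*P) (J*O*S) (y+y+n+1) (x+x+n+2) (by ring) (by omega)
    apply mul_left_cancel₀ (pow_ne_zero x hq)
    rw [show 2*(N+1)+3 = x+(y+n+2)+1+(N+1) by omega] at hr
    linear_combination -P*r - P*Fb q (J*O*S) (x+x+n+2)*hr
  have E1 : Fb q 1 n * (SS q (q*o) J O P (q*S) (Tm q O P N) N i j x y * Fb q o (y+1) * (PP q O x * PP q o y * PP q O i * PP q (q*o) j) * Fb q S 1) =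
     Fb q 1 n * (Rr q (q*o) O P (q*S) N i j x y * SS q (q*S) J P O (q*o) (Tp q J O N) N i j y x * Fb q S (x+1) * (PP q P y * PP q S x * PP q P i * PP q (q*S) j) * Fb q o 1) := by
    rcases Nat.eq_zero_or_pos n with h0 | h0
    · rw [h0, fb10]; ring
    have := IH x y (by omega)
    unfold SymP at this
    linear_combination Fb q 1 n * Fb q o 1 * Fb q S 1 * this + Fb q 1 n * SS q (q*o) J O P (q*S) (Tm q O P N) N i j x y * (PP q O x * PP q O i * PP q (q*o) j) * Fb q S 1 * ky - Fb q 1 n * Rr q (q*o) O P (q*S) N i j x y * SS q (q*S) J P O (q*o) (Tp q J O N) N i j y x * (PP q P y * PP q P i * PP q (q*S) j) * Fb q o 1 * kx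
  have E2 : Fb q 1 x * (SS q (q*o) J O P (q*S) (Tm q O P N) N i j (x-1) y * Fb q o (y+1) * (PP q O x * PP q o y * PP q O i * PP q (q*o) j) * Fb q S 1 * (q*o*O*q^(N+1))) =
     Fb q 1 x * Fb q O x * (Rr q (q*o) O P (q*S) N i j x y * SS q (q*S) J P O (q*o) (Tp q J O N) N i j y (x-1) * (PP q P y * PP q S x * PP q P i * PP q (q*S) j) * Fb q o 1) := by
    rcases x with _ | x
    · rw [fb10]; ring
    have := IH x y (by omega)
    unfold SymP at this
    rw [PP_succ' q S x h41, PP_succ, Rr_x, Nat.add_sub_cancel]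
    linear_combination Fb q 1 (x+1) * Fb q O (x+1) * Fb q o 1 * Fb q S 1 * (q*o*O*q^(N+1)) * this + Fb q 1 (x+1) * SS q (q*o) J O P (q*S) (Tm q O P N) N i j x y * (PP q O x * Fb q O (x+1) * PP q O i * PP q (q*o) j) * Fb q S 1 * (q*o*O*q^(N+1)) * ky
  have E3 : Fb q 1 y * Fb q P y * (SS q (q*o) J O P (q*S) (Tm q O P N) N i j x (y-1) * (PP q O x * PP q o y * PP q O i * PP q (q*o) j) * Fb q S 1) =
     Fb q 1 y * ((P*(q*S)*q^(N+1)) * Rr q (q*o) O P (q*S) N i j x y * SS q (q*S) J P O (q*o) (Tp q J O N) N i j (y-1) x * Fb q S (x+1) * (PP q P y * PP q S x * PP q P i * PP q (q*S) j) * Fb q o 1) := by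
    rcases y with _ | y
    · rw [fb10]; ring
    have := IH x y (by omega)
    unfold SymP at this
    rw [PP_succ' q o y h01, PP_succ, Rr_y hq g.h3 (mul_ne_zero hq g.h4), Nat.add_sub_cancel]
    linear_combination Fb q 1 (y+1) * Fb q P (y+1) * Fb q o 1 * Fb q S 1 * this - Fb q 1 (y+1) * Rr q (q*o) O P (q*S) N i j x y * SS q (q*S) J P O (q*o) (Tp q J O N) N i j y x * (PP q P y * Fb q P (y+1) * PP q P i * PP q (q*S) j) * Fb q o 1 * kx
  have E4 : Fb q 1 x * Fb q 1 y * Fb q P y * (SS q (q*o) J O P (q*S) (Tm q O P N) N i j (x-1) (y-1) * (PP q O x * PP q o y * PP q O i * PP q (q*o) j) * Fb q S 1 * (q*o*O*q^(N+1))) =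
     Fb q 1 x * Fb q 1 y * Fb q O x * ((P*(q*S)*q^(N+1)) * Rr q (q*o) O P (q*S) N i j x y * SS q (q*S) J P O (q*o) (Tp q J O N) N i j (y-1) (x-1) * (PP q P y * PP q S x * PP q P i * PP q (q*S) j) * Fb q o 1) := by
    rcases x with _ | x
    · rw [fb10]; ring
    rcases y with _ | y
    · rw [fb10]; ring
    have := IH x y (by omega)
    unfold SymP at this
    rw [PP_succ' q S x h41, PP_succ' q o y h01, PP_succ, PP_succ, Rr_y hq g.h3 (mul_ne_zero hq g.h4), Rr_x, Nat.add_sub_cancel, Nat.add_sub_cancel]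
    linear_combination Fb q 1 (x+1) * Fb q 1 (y+1) * Fb q O (x+1) * Fb q P (y+1) * Fb q o 1 * Fb q S 1 * (q*o*O*q^(N+1)) * this
  unfold SymP
  rw [pa, pb]
  rw [mul_comm S o, mul_comm S O, mul_comm P o] at hJ'
  have hK : Fb q (o*P) (y+y+1) * Fb q (o*S) 1 * Fb q (o*S) 2 * Fb q (O*S) (x+x+1) * (J*O*S*q^(x+n+2)) * (J*P*o*q^(y+n+2)) * O * (q*o*O*q^(N+1)) ≠ 0 := by
    have h1 := g.h1
    have h2 := g.h2
    have h3 := g.h3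
    have h4 := g.h4
    have h0 := g.h0
    have f1 : Fb q (o*P) (y+y+1) ≠ 0 := by
      have := g.b.f12 (y+y) (by omega)
      rwa [mul_comm P o] at this
    have f2 : Fb q (O*S) (x+x+1) ≠ 0 := by
      have := g.c.f12 (x+x) (by omega)
      rwa [mul_comm S O] at this
    have f3 : Fb q (o*S) 1 ≠ 0 := g.f04 0 (by omega)
    have f4 : Fb q (o*S) 2 ≠ 0 := g.f04 1 (by omega)
    have := fun n => pow_ne_zero n hq
    simp [*]
  apply mul_left_cancel₀ hK
  clear hK pa pb ky kx IH
  generalize Rr q o O P S (N+1) i (j+1) x y = R, Rr q (q*o) O P (q*S) N i j x y = r, SS q o J O P S (Tm q O P (N+1)) (N+1) i (j+1) x y = s, SS q S J P O o (Tp q J O (N+1)) (N+1) i (j+1) y x = s', SS q (q*o) J O P (q*S) (Tm q O P N) N i j x y = s1, SS q (q*o) J O P (q*S) (Tm q O P N) N i j (x-1) y = s2, SS q (q*o) J O P (q*S) (Tm q O P N) N i j x (y-1) = s3, SS q (q*o) J O P (q*S) (Tm q O P N) N i j (x-1) (y-1) = s4, SS q (q*S) J P O (q*o) (Tp q J O N)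 N i j y x = s5, SS q (q*S) J P O (q*o) (Tp q J O N) N i j y (x-1) = s6, SS q (q*S) J P O (q*o) (Tp q J O N) N i j (y-1) x = s7, SS q (q*S) J P O (q*o) (Tp q J O N) N i j (y-1) (x-1) = s8 at *
  rw [show PP q O x * PP q o y * PP q O i * (Fb q o 1 * PP q (q*o) j) = (PP q O x * PP q o y * PP q O i * PP q (q*o) j) * Fb q o 1 by ring,
    show PP q P y * PP q S x * PP q P i * (Fb q S 1 * PP q (q*S) j) = (PP q P y * PP q S x * PP q P i * PP q (q*S) j) * Fb q S 1 by ring]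
  generalize PP q O x * PP q o y * PP q O i * PP q (q*o) j = M, PP q P y * PP q S x * PP q P i * PP q (q*S) j = Q at *
  generalize hA : J*O*S*q^(x+n+2) = A at *
  generalize hA' : J*P*o*q^(y+n+2) = A' at *
  generalize hal : q*o*O*q^(N+1) = al at *
  generalize hbe : P*(q*S)*q^(N+1) = be at *
  have L1 : S*q^x*A'*O = P*o*q^y*A := by rw [← hA, ← hA']; ring
  have L4 : o*(O*S*q^(x+1))*A'*O*be = P*S*(o*P*q^(y+1))*A*al := by rw [← hA, ← hA', ← hal, ← hbe]; ring
  generalize Fb q 1 x = z1, Fb q 1 y = z2, Fb q 1 n = z3, Fb q O x = z4, Fb q P y = z5, Fb q o 1 = z6, Fb q S 1 = z7, Fb q S (x+1) = z8, Fb q o (y+1) = z9, Fb q (o*P) (y+y+1) = z10, Fb q (o*S) 1 = z11, Fb q (o*S) 2 = z12, Fb q (O*S) (x+x+1) = z13, Fb q (o*P) (y+1) = z14, Fb q (O*S) (x+1) = z15, Fb q (O*S) (x+x+n+1) = z16, Fb q (o*P) (y+y+n+1) = z17, Fb q (J*O*S) (x+x+n+2) = z18, Fb q (J*P*o) (y+y+n+2)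 = z19, Fb q J (n+1) = z20 at *
  clear hA hA' hal hbe hn hr hx hj
  generalize q^x = qx, q^y = qy, q^(x+1) = qx1, q^(y+1) = qy1 at *
  linear_combination M*A'*O*al*hJ - z10*z11*z12*z13*A*A'*al*s'*Q*z7*rr - P*r*Q*A*al*hJ' - S*q*z14*qx*z15*A'*O*al*E1 - S*q*z14*z16*A'*O*E2 + q*o*z15*z18*A'*O*al*E3 + q*o*(O*S*qx1)*z20*A'*O*E4 - q*z14*z15*z3*r*s5*Q*z8*z6*al*L1 + S*q*z14*z1*z4*r*s6*Q*z6*K2 - q*o*z15*z2*r*s7*z8*Q*z6*al*K3 + q*z20*z1*z2*z4*r*s8*Q*z6*L4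

theorem SymT : ∀ (N : ℕ) {q o J O P S : ℂ} (_ : Gen q o J O P S N) (i j x y : ℕ), i + j ≤ N → x + y ≤ N →
    SymP q o J O P S N i j x y := by
  intro N
  induction N with
  | zero =>
    intro q o J O P S g i j x y h1 h2
    obtain rfl : i = 0 := by omega
    obtain rfl : j = 0 := by omega
    obtain rfl : x = 0 := by omega
    obtain rfl : y = 0 := by omega
    unfold SymP
    rw [SS00 g.hq, SS00 g.hq]
    have hw : ∀ {d0 d1 d2 d3 d4 : ℂ}, Gen q d0 d1 d2 d3 d4 0 → W1 q d0 d1 d2 d3 d4 0 0 0 0 = 1 / Fb q (d0*d4) 1 := by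
      intro d0 d1 d2 d3 d4 g
      have := PP_succ q (d0*d4) 0
      have := PP_succ q (d1*d2) 0
      have := PP_succ q (d0*d3*d4) 0
      have := PP_succ q (d1*d2*d4) 0
      have := g.f04 0 (by omega)
      have := g.a.f12 0 (by omega)
      have := g.f124 0 (by omega)
      have := g.f034 0 (by omega)
      simp [PP_zero, W1, W1n, W1d, *] at *
      field_simp
    simp only [zero_add, sum_range_one, hw g, hw g.sw, mul_comm S o]
    simp [PP_zero, Rr, qt, Tp, Tm]
  | succ N ih =>
    intro q o J O P S g i j x y h1 h2
    rcases j with _ | j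
    · rcases y with _ | y
      · rcases x with _ | x
        · rcases i with _ | i
          · exact Sym_B g (ih g.s34 _ _ _ _ (by omega) (by omega)) (ih g.s02 _ _ _ _ (by omega) (by omega))
          · exact Sym_I g i (by omega) (ih g.s23 _ _ _ _ (by omega) (by omega))
        · exact Sym_X g i x 0 (by omega) (by omega) (fun i hi => ih g.s24 _ _ _ _ (by omega) (by omega))
      · exact Sym_Y g i x y (by omega) (by omega) (fun i hi => ih g.s03 _ _ _ _ (by omega) (by omega))
    · exact Sym_J g i j x y (by omega) (by omega) (fun x y hxy => ih g.s04 _ _ _ _ (by omega) (by omega))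


theorem PP_refl (q d e : ℂ) (m : ℕ) : ∀ n : ℕ, d*e*q^(m+n+1) = 1 →
    PP q d m * PP q e n = (-d)^m * qt q m * PP q e (m+n) := by
  induction m with
  | zero => intro n _; simp [PP_zero, qt]
  | succ m ih =>
    intro n h
    have h1 := ih (n+1) (by rw [← h]; ring)
    have h2 : Fb q d (m+1) = -d*q^(m+1) * Fb q e (n+1) := by
      simp only [fbd]
      rw [show m+1+n+1 = (m+1)+(n+1) by ring, pow_add q (m+1)] at h
      linear_combination -h
    rw [PP_succ, h2, qt_succ, show m+1+n = m+(n+1) by ring, pow_succ (-d) m]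
    rw [PP_succ] at h1
    linear_combination (-d*q^(m+1)) * h1

theorem qt_add (q : ℂ) (m y : ℕ) : qt q m * (q^(m+y+1))^y = qt q y * qt q (m+y) := by
  induction y with
  | zero => simp [qt]
  | succ y ih =>
    rw [← add_assoc m y 1, qt_succ, qt_succ, pow_succ q (m+y+1), mul_pow, pow_succ _ y]
    linear_combination q^(y+1)*q^(m+y+1)*ih

def nu (q o S : ℂ) (j : ℕ) : ℂ :=
  PP q 1 j * (q*o)^j * PP q S j / (Fb q (o*S) (j+j+1) * PP q o j * PP q (o*S) j)

def LL (q o S : ℂ) (j u : ℕ) : ℂ :=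
  PP q 1 (j+u) * Fb q (o*S) (j+j+1) * PP q o j * PP q (o*S) j
   / (PP q 1 j * PP q 1 u * PP q S j * PP q (o*S) (j+j+u+1))

theorem W1_fac {q o J O P S : ℂ} {N : ℕ} (g : Gen q o J O P S N) (a j u v : ℕ) (h : a+v ≤ N) (h' : j+u ≤ N) :
    W1 q o J O P S a j u v = om1 q S O J a v * (q*O)^a * nu q o S j * om1 q P o S j u := by
  unfold W1 W1n W1d om1 om1n om1d nu
  rw [show S*O*J = J*O*S by ring, mul_comm O J, show P*o*S = o*P*S by ring]
  have e1 := g.hq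
  have e2 := g.h0
  have e3 := g.h2
  have a1 := q1 q g.hQ a (by omega)
  have a2 := q1 q g.hQ u (by omega)
  have a3 := q1 q g.hQ v (by omega)
  have a31 := q1 q g.hQ j (by omega)
  have a4 := g.P034 (j+u+1) (by omega)
  have a5 := g.P04 (j+j+u+1) (by omega)
  have a51 := g.P04 j (by omega)
  have a6 := g.a.P12 (a+a+v+1) (by omega)
  have a7 := g.P124 (a+v+1) (by omega)
  have a8 := g.a.P1 a (by omega)
  have a9 := g.b.P2 j (by omega)
  have a10 := g.b.P3 j (by omega)
  have a11 := g.f04 (j+j) (by omega)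
  have p1 : (q*o)^j ≠ 0 := by simp [*]
  have p2 : (q*O)^a ≠ 0 := by simp [*]
  generalize (q*o)^j = z1, (q*O)^a = z2, Fb q (o*S) (j+j+1) = f1, PP q (o*S) j = f2, PP q o j = f3, PP q S j = f4, PP q 1 j = f5 at *
  field_simp

def kap (q o J O P S : ℂ) (N a w : ℕ) : ℂ :=
  Fb q (J*O) (a+a+1)*PP q O a*PP q (J*O) a*PP q 1 N*PP q (o*P*S) (w+1)*S^a/
   (PP q 1 a*PP q J a*PP q 1 w*PP q (o*P*S) (2*N+2)*(q*O)^a*(-(J*O))^(N+1)*qt q (N+1))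

def sg (q o O P S : ℂ) (N y w : ℕ) : ℂ := LL q o P y w * (-(P*S*q^N/(q*O)))^y * qt q y

theorem kap_l {q o J O P S : ℂ} {N : ℕ} (g : Gen q o J O P S N) (a y v : ℕ) (h : a+y+v = N) :
    om1 q S O J a v * sg q o O P S N y (a+v) * (q*O)^y =
     kap q o J O P S N a (y+v) * om1 q S o P y v := by
  have rel := g.rel
  have R1 := PP_refl q (J*O*S) (o*P) (a+a+v+1) (y+y+v+1) (by
    rw [← rel, ← h]; ring)
  have R2 := PP_refl q (J*O*S) (o*P) (a+v+1) (y+y+(a+v)+1) (by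
    rw [← rel, ← h]; ring)
  have R3 := PP_refl q (J*O) (o*P*S) (a+a+v+1) (y+y+v+1) (by
    rw [← rel, ← h]; ring)
  rw [show a+a+v+1+(y+y+v+1) = 2*N+2 by omega] at R1 R3
  rw [show a+v+1+(y+y+(a+v)+1) = 2*N+2 by omega] at R2
  have n1 : -(J*O*S) ≠ 0 := by simp [g.h1, g.h2, g.h4]
  have n2 : -(J*O) ≠ 0 := by simp [g.h1, g.h2]
  have hm : (-(J*O*S))^(a+a+v+1)*((-(P*S*q^N/(q*O)))^y*(q*O)^y*(q*o)^y*qt q y)*((-(J*O))^(N+1)*qt q (N+1))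
     = S^a*(-(J*O))^(a+a+v+1)*(-(J*O*S))^(a+v+1)*qt q (a+v+1) := by
    have := qt_add q (a+v+1) y
    rw [show a+v+1+y = N+1 by omega] at this
    have e : (-(J*O))^(N+1) = (-(J*O))^y*(-(J*O))^(a+v+1) := by rw [← pow_add]; congr 1; omega
    have e2 : (-(J*O*S))^(a+a+v+1) = S^a*(-(J*O))^a*(-(J*O*S))^(a+v+1) := by
      rw [← mul_pow, show a+a+v+1 = a+(a+v+1) by omega, pow_add]; congr 2; ring
    have e3 : (-(J*O))^(a+a+v+1) = (-(J*O))^a*(-(J*O))^(a+v+1) := by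
      rw [← pow_add]; congr 1; omega
    rw [e, e2, e3]
    have e4 : (-(P*S*q^N/(q*O)))^y*(q*O)^y*(q*o)^y*(-(J*O))^y*(q^(N+1+1))^y = 1 := by
      rw [← mul_pow, ← mul_pow, ← mul_pow, ← mul_pow]
      convert one_pow y
      have := g.hq
      have := g.h2
      field_simp
      rw [← rel]; ring
    linear_combination S^a*(-(J*O))^a*(-(J*O))^(a+v+1)*(-(J*O*S))^(a+v+1)*(qt q (a+v+1)*e4 - ((-(P*S*q^N/(q*O)))^y*(q*O)^y*(q*o)^y*(-(J*O))^y)*this)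
  unfold sg kap om1 om1n om1d LL
  rw [show S*O*J = J*O*S by ring, mul_comm O J, show S*o*P = o*P*S by ring, show y+(a+v) = N by omega]
  have P03 : ∀ n, n ≤ 2*N+5 → PP q (o*P) n ≠ 0 := fun n hn => by
    have := g.b.P12 n hn; rwa [mul_comm] at this
  have a0 := P03 (y+y+v+1) (by omega)
  have a00 := P03 (2*N+2) (by omega)
  have a01 := P03 (y+y+(a+v)+1) (by omega)
  have a02 := g.P034 (y+y+v+1) (by omega)
  rw [eq_div_of_mul_eq a0 R1, eq_div_of_mul_eq a01 R2, eq_div_of_mul_eq a02 R3]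
  have e1 := g.hq
  have e2 := g.h0
  have e3 := g.h2
  have e4 := g.h4
  have a1 := q1 q g.hQ a (by omega)
  have a2 := q1 q g.hQ (a+v) (by omega)
  have a3 := q1 q g.hQ v (by omega)
  have a31 := q1 q g.hQ y (by omega)
  have a32 := q1 q g.hQ (y+v) (by omega)
  have a4 := g.P034 (y+v+1) (by omega)
  have a5 := g.P034 (2*N+2) (by omega)
  have a8 := g.a.P1 a (by omega)
  have a9 := g.a.P3 y (by omega)
  have z1 := qt_ne q e1 (a+v+1)
  have z2 := qt_ne q e1 (a+a+v+1)
  have z3 := qt_ne q e1 (N+1)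
  have p1 : (q*o)^y ≠ 0 := by simp [*]
  have p2 : (q*O)^a ≠ 0 := by simp [*]
  have p3 := pow_ne_zero (a+a+v+1) n1
  have p4 := pow_ne_zero (a+v+1) n1
  have p5 := pow_ne_zero (a+a+v+1) n2
  have p6 := pow_ne_zero (N+1) n2
  clear R1 R2 R3 P03 rel h
  generalize (-(J*O*S))^(a+a+v+1) = w0, (-(J*O*S))^(a+v+1) = w1, (-(J*O))^(a+a+v+1) = w2, (-(J*O))^(N+1) = w3, (-(P*S*q^N/(q*O)))^y = w4, (q*O)^y = w5, (q*O)^a = w6, (q*o)^y = w7, S^a = w8, qt q (a+v+1) = w9, qt q (a+a+v+1) = w10, qt q (N+1) = w11, qt q y = w12, PP q 1 a = w13, PP q 1 (a+v) = w14, PP q 1 v = w15, PP q 1 y = w16, PP q 1 N = w17, PP q 1 (y+v) = w18, PP q (o*P*S) (y+v+1) = w19, PP q (o*P*S) (2*N+2) = w20, PP q (o*P*S) (y+y+v+1) = w21, PP q (o*P) (2*N+2) = w22, PP q (o*P) (y+y+v+1) = w23, PP q (o*P) (y+y+(a+v)+1) = w24, PP q (o*P) y = w25, PP q J a = w26, PP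 q P y = w27, PP q O a = w28, PP q o y = w29, PP q S v = w30, PP q (J*O) a = w31, Fb q (J*O) (a+a+1) = w32, Fb q (o*P) (y+y+1) = w33 at *
  clear g
  field_simp
  linear_combination w32*w28*w30*w31*w17*w33*w29*w25*hm

def muf (q o P S : ℂ) (N j u : ℕ) : ℂ := LL q o S j u * (-(P*S*q^N))^j * qt q j

theorem mu_l {q o J O P S : ℂ} {N : ℕ} (g : Gen q o J O P S N) (a j u : ℕ) (h : a+j+u = N) :
    Tp q J P N a * Tm q O P N a * (q*O)^a * (q*O)^a * (q*o)^a * kap q o J O P S N a (j+u) * om1 q P o S j u =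
     muf q o P S N j (a+u) * om1 q P O J a u := by
  have rel := g.rel
  have R1 := PP_refl q (J*O*P) (o*S) (a+a+u+1) (j+j+u+1) (by
    rw [← rel, ← h]; ring)
  have R2 := PP_refl q (J*O*P) (o*S) (a+u+1) (j+j+(a+u)+1) (by
    rw [← rel, ← h]; ring)
  have R3 := PP_refl q (J*O) (o*P*S) (a+a+u+1) (j+j+u+1) (by
    rw [← rel, ← h]; ring)
  rw [show a+a+u+1+(j+j+u+1) = 2*N+2 by omega] at R1 R3
  rw [show a+u+1+(j+j+(a+u)+1) = 2*N+2 by omega] at R2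
  have n1 : -(J*O*P) ≠ 0 := by simp [g.h1, g.h2, g.h3]
  have n2 : -(J*O) ≠ 0 := by simp [g.h1, g.h2]
  have e1 := g.hq
  have e2 := g.h0
  have e3 := g.h2
  have e4 := g.h4
  have hm : (-(J*P*q^N))^a*(-(P*q^N/O))^a*(q*O)^a*(q*o)^a*S^a*(q*O)^a*(-(J*O*P))^(a+u+1)*qt q (a+u+1)*(-(J*O))^(a+a+u+1)
     = (-(P*S*q^N))^j*qt q j*(-(J*O))^(N+1)*qt q (N+1)*(q*o)^j*(-(J*O*P))^(a+a+u+1) := by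
    have := qt_add q (a+u+1) j
    rw [show a+u+1+j = N+1 by omega] at this
    have d1 : (-(J*O))^(N+1) = (-(J*O))^j*(-(J*O))^(a+u+1) := by rw [← pow_add]; congr 1; omega
    have d2 : (-(J*O*P))^(a+a+u+1) = (-(J*O*P))^a*(-(J*O*P))^(a+u+1) := by
      rw [← pow_add]; congr 1; omega
    have d3 : (-(J*O))^(a+a+u+1) = (-(J*O))^a*(-(J*O))^(a+u+1) := by
      rw [← pow_add]; congr 1; omega
    have d4 : (-(J*P*q^N))^a*(-(P*q^N/O))^a*(q*O)^a*(q*o)^a*S^a*(q*O)^a*(-(J*O))^a = (-(J*O*P))^a := by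
      simp only [← mul_pow]
      congr 1
      field_simp
      linear_combination -J*P*rel
    have d5 : (-(P*S*q^N))^j*(q*o)^j*(-(J*O))^j*(q^(N+1+1))^j = 1 := by
      simp only [← mul_pow]
      convert one_pow j
      rw [← rel]; ring
    rw [d1, d2, d3, ← d4]
    generalize (-(J*P*q^N))^a = x1, (-(P*q^N/O))^a = x2, (-(J*O*P))^(a+u+1) = x3, (-(J*O))^(a+u+1) = x4, (-(J*O))^a = x5, (-(J*O))^j = x6, (-(P*S*q^N))^j = x7, (q*o)^j = x8, (q*o)^a = x9, (q*O)^a = x10 at *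
    linear_combination x1*x2*x10*x9*S^a*x10*x3*x4*x5*(-qt q (a+u+1)*d5+x7*x8*x6*this)
  unfold Tp Tm muf kap om1 om1n om1d LL
  rw [show P*O*J = J*O*P by ring, mul_comm O J, show P*o*S = o*P*S by ring, show j+(a+u) = N by omega]
  have a0 := g.P04 (j+j+u+1) (by omega)
  have a00 := g.P04 (2*N+2) (by omega)
  have a01 := g.P04 (j+j+(a+u)+1) (by omega)
  have a02 := g.P034 (j+j+u+1) (by omega)
  rw [eq_div_of_mul_eq a0 R1, eq_div_of_mul_eq a01 R2, eq_div_of_mul_eq a02 R3]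
  have a1 := q1 q g.hQ a (by omega)
  have a2 := q1 q g.hQ (a+u) (by omega)
  have a3 := q1 q g.hQ u (by omega)
  have a31 := q1 q g.hQ j (by omega)
  have a32 := q1 q g.hQ (j+u) (by omega)
  have a4 := g.P034 (j+u+1) (by omega)
  have a5 := g.P034 (2*N+2) (by omega)
  have a8 := g.a.P1 a (by omega)
  have a9 := g.b.P3 j (by omega)
  have z1 := qt_ne q e1 (a+u+1)
  have z2 := qt_ne q e1 (a+a+u+1)
  have z3 := qt_ne q e1 (N+1)
  have z4 := qt_ne q e1 a
  have p1 : (q*o)^j ≠ 0 := by simp [*]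
  have p2 : (q*O)^a ≠ 0 := by simp [*]
  have p3 := pow_ne_zero (a+a+u+1) n1
  have p4 := pow_ne_zero (a+u+1) n1
  have p5 := pow_ne_zero (a+a+u+1) n2
  have p6 := pow_ne_zero (N+1) n2
  clear R1 R2 R3 rel h
  generalize (-(J*O*P))^(a+a+u+1) = w0, (-(J*O*P))^(a+u+1) = w1, (-(J*O))^(a+a+u+1) = w2, (-(J*O))^(N+1) = w3, (-(J*P*q^N))^a = w4, (-(P*q^N/O))^a = w5, (-(P*S*q^N))^j = w6, (q*O)^a = w7, (q*o)^a = w8, (q*o)^j = w9, S^a = w10, qt q (a+u+1) = w11, qt q (a+a+u+1) = w12, qt q (N+1) = w13, qt q a = w14, qt q j = w15, PP q 1 a = w16, PP q 1 (a+u) = w17, PP q 1 u = w18, PP q 1 j = w19, PP q 1 N = w20, PP q 1 (j+u) = w21, PP q (o*P*S) (j+u+1) = w22, PP q (o*P*S) (2*N+2) = w23, PP q (o*P*S) (j+j+u+1) = w24, PP q (o*S) (2*N+2) = w25, PP q (o*S) (j+j+u+1) = w26, PP q (o*S) (j+j+(a+u)+1) = w27, PP q (o*S) j = w28, PP q J a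 = w29, PP q S j = w30, PP q O a = w31, PP q o j = w32, PP q P u = w33, PP q (J*O) a = w34, Fb q (J*O) (a+a+1) = w35, Fb q (o*S) (j+j+1) = w36 at *
  clear g
  field_simp
  linear_combination w28*w31*w32*w33*w34*w35*w36*w20*hm


def XX (q o J O P S : ℂ) (T : ℕ → ℂ) (N i j y a : ℕ) : ℂ :=
  if a+j ≤ N ∧ a+y ≤ N then T a * ((q*O)^a*nu q o S j)*om1 q S O J a (N-y-a)*om1 q P o S j (N-j-a)
    *ff q J O P (N-j) i a*ff q P o S (N-a) j y else 0

theorem tm_XX {q o J O P S : ℂ} {N : ℕ} (g : Gen q o J O P S N) (T : ℕ → ℂ) (i j x y a : ℕ) :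
    tm q o J O P S T N i j x y a = XX q o J O P S T N i j y a * ff q S O J (N-y) a x := by
  unfold tm XX
  by_cases h : a+j ≤ N ∧ a+y ≤ N
  · rw [if_pos h, if_pos h, W1_fac g _ _ _ _ (by omega) (by omega)]; ring
  · rw [if_neg h, if_neg h, zero_mul]

theorem BO1 {q o J O P S : ℂ} {N : ℕ} (g : Gen q o J O P S N) (T T' : ℕ → ℂ) (i j k l y : ℕ) (hy : y ≤ N) :
    ∑ x ∈ range (N-y+1), om1 q J O S x (N-y-x) * SS q o J O P S T N i j x y * SS q o J O P S T' N k l x y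
    = ∑ a ∈ range (N+1), XX q o J O P S T N i j y a * XX q o J O P S T' N k l y a
        / (om1 q S O J a (N-y-a) * (q*O)^(N-y)) := by
  have hz : (q*O)^(N-y) ≠ 0 := by simp [g.hq, g.h2]
  have key : ∀ a b, a+y ≤ N → b+y ≤ N → ∑ x ∈ range (N-y+1), om1 q J O S x (N-y-x) * ff q S O J (N-y) a x * ff q S O J (N-y) b x
     = if a = b then 1/(om1 q S O J a (N-y-a) * (q*O)^(N-y)) else 0 := by
    intro a b ha hb
    have := Oth (N-y) (g.c.mono (M := N-y) (by omega)) a b (by omega) (by omega)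
    rw [eq_div_of_mul_eq hz this]
    split_ifs
    · rw [div_div]
    · simp
  calc _ = ∑ x ∈ range (N-y+1), ∑ a ∈ range (N+1), ∑ b ∈ range (N+1),
        XX q o J O P S T N i j y a * XX q o J O P S T' N k l y b * (om1 q J O S x (N-y-x) * ff q S O J (N-y) a x * ff q S O J (N-y) b x) := by
        apply sum_congr rfl; intro x _
        unfold SS
        simp only [tm_XX g]
        rw [mul_assoc, sum_mul_sum, mul_sum]
        apply sum_congr rfl; intro a _; rw [mul_sum]; apply sum_congr rfl; intro b _; ring
    _ = ∑ a ∈ range (N+1), ∑ b ∈ range (N+1),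
        XX q o J O P S T N i j y a * XX q o J O P S T' N k l y b * ∑ x ∈ range (N-y+1), (om1 q J O S x (N-y-x) * ff q S O J (N-y) a x * ff q S O J (N-y) b x) := by
        rw [sum_comm]
        apply sum_congr rfl; intro a _
        rw [sum_comm]
        apply sum_congr rfl; intro b _; rw [mul_sum]
    _ = _ := by
        apply sum_congr rfl; intro a ha
        have h0 : ∀ b T i j, ¬ b+y ≤ N → XX q o J O P S T N i j y b = 0 := by
          intro b T i j h; unfold XX; rw [if_neg (by omega)]
        by_cases hay : a+y ≤ N
        · rw [sum_eq_single a]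
          · rw [key a a hay hay, if_pos rfl, mul_one_div]
          · intro b _ hb
            by_cases hby : b+y ≤ N
            · rw [key a b hay hby, if_neg (Ne.symm hb), mul_zero]
            · rw [h0 b _ _ _ hby]; ring
          · intro h; exact absurd ha h
        · simp [h0 a _ _ _ hay]

theorem BO2 {q o J O P S : ℂ} {N : ℕ} (g : Gen q o J O P S N) (T T' : ℕ → ℂ) (i j k l a : ℕ) (ha : a ≤ N) :
    ∑ y ∈ range (N+1), sg q o O P S N y (N-y) * (XX q o J O P S T N i j y a * XX q o J O P S T' N k l y a
        / (om1 q S O J a (N-y-a) * (q*O)^(N-y)))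
    = if j = l ∧ a+j ≤ N then nu q o S j^2 * (T a*T' a*(q*O)^a*(q*O)^a*om1 q P o S j (N-j-a)*kap q o J O P S N a (N-a)*(q*o)^a)
       / ((q*O)^N*(q*o)^N) * (ff q J O P (N-j) i a * ff q J O P (N-j) k a) else 0 := by
  by_cases hj : a+j ≤ N
  swap
  · rw [if_neg (by omega)]; apply sum_eq_zero; intro y _
    rw [XX, if_neg (by omega)]; simp
  by_cases hl : a+l ≤ N
  swap
  · rw [if_neg (by omega)]; apply sum_eq_zero; intro y _
    rw [XX, XX, if_neg (show ¬ (a+l≤N∧_) by omega)]; simp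
  have e1 := g.hq
  have e2 := g.h0
  have e3 := g.h2
  have hO := Oth (N-a) (g.b.mono (M := N-a) (by omega)) j l (by omega) (by omega)
  have hz : (q*o)^(N-a) ≠ 0 := by simp [*]
  have hz0 : (q*o)^a ≠ 0 := by simp [*]
  have hz2 : (q*O)^N ≠ 0 := by simp [*]
  have n1 := g.b.om1_ne j (N-j-a) (by omega)
  calc _ = ∑ y ∈ range (N-a+1), (nu q o S j * nu q o S l * (T a*T' a*(q*O)^a*(q*O)^a*om1 q P o S j (N-j-a)*om1 q P o S l (N-l-a)*kap q o J O P S N a (N-a))/(q*O)^N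
        *(ff q J O P (N-j) i a * ff q J O P (N-l) k a)) * (om1 q S o P y (N-a-y) * ff q P o S (N-a) j y * ff q P o S (N-a) l y) := by
        symm
        rw [← sum_subset (s₁ := range (N-a+1)) (s₂ := range (N+1))]
        · apply sum_congr rfl
          intro y hy
          have hy : y ≤ N - a := by simpa [Nat.lt_succ_iff] using hy
          obtain ⟨v, hv⟩ : ∃ v, N = a + y + v := ⟨N-a-y, by omega⟩
          have := kap_l g a y v hv.symm
          rw [XX, XX, if_pos (by omega), if_pos (by omega), show N-y-a = v by omega, show N-a-y = v by omega]
          rw [show a+v = N-y by omega, show y+v = N-a by omega] at this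
          have n2 := g.c.om1_ne a v (by omega)
          have z1 : (q*O)^(N-y) ≠ 0 := by simp [*]
          have z2 : (q*O)^N = (q*O)^(N-y) * (q*O)^y := by rw [← pow_add]; congr 1; omega
          have z3 : (q*O)^y ≠ 0 := by simp [*]
          rw [z2]
          generalize (q*O)^(N-y) = x1, (q*O)^y = x2, (q*O)^a = x3, om1 q S O J a v = x4, om1 q S o P y v = x5, kap q o J O P S N a (N-a) = x6, sg q o O P S N y (N-y) = x7, om1 q P o S j (N-j-a) = x8, om1 q P o S l (N-l-a) = x9, nu q o S j = x10, nu q o S l = x11, ff q J O P (N-j) i a = y1, ff q J O P (N-l) k a = y2, ff q P o S (N-a) j y = y3, ff q P o S (N-a) l y = y4, T a = y5, T' a = y6 at *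
          field_simp
          linear_combination -x10*x11*y1*y2*y3*y4*y5*y6*x3^2*x9*this
        · intro y; simp; omega
        · intro y _ hy; rw [XX, if_neg]; · simp
          simp at hy; omega
    _ = _ := by
        rw [← mul_sum, eq_div_of_mul_eq hz hO]
        by_cases hjl : j = l
        · subst hjl
          rw [if_pos rfl, if_pos ⟨rfl, hj⟩, show N-a-j = N-j-a by omega,
            show (q*o)^N = (q*o)^(N-a) * (q*o)^a by rw [← pow_add]; congr 1; omega]
          generalize (q*o)^(N-a) = x1, (q*o)^a = x2, (q*O)^N = x3, (q*O)^a = x4, om1 q P o S j (N-j-a) = x8 at *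
          field_simp
        · rw [if_neg hjl, if_neg (by tauto)]; simp

theorem BO {q o J O P S : ℂ} {N : ℕ} (g : Gen q o J O P S N) (i j k l : ℕ) (hij : i+j ≤ N) (hkl : k+l ≤ N) :
    ∑ x ∈ range (N+1), ∑ y ∈ range (N+1-x), om1 q J O S x (N-y-x) * sg q o O P S N y (N-y) *
       SS q o J O P S (Tp q J P N) N i j x y * SS q o J O P S (Tm q O P N) N k l x y
    = if i = k ∧ j = l then nu q o S j^2 * muf q o P S N j (N-j)/ ((q*O)^N*(q*o)^N*(om1 q J O P i (N-j-i)*(q*O)^(N-j))) else 0 := by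
  have hz : (q*O)^(N-j) ≠ 0 := by simp [g.hq, g.h2]
  rw [sum_comm' (t' := range (N+1)) (s' := fun y => range (N-y+1)) (by intro x y; simp; omega)]
  calc _ = ∑ y ∈ range (N+1), ∑ a ∈ range (N+1), sg q o O P S N y (N-y) * (XX q o J O P S (Tp q J P N) N i j y a * XX q o J O P S (Tm q O P N) N k l y a
        / (om1 q S O J a (N-y-a) * (q*O)^(N-y))) := by
        apply sum_congr rfl; intro y hy
        rw [← mul_sum, ← BO1 g _ _ _ _ _ _ y (by simp at hy; omega), mul_sum]
        apply sum_congr rfl; intro x _; ring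
    _ = ∑ a ∈ range (N+1), if j = l ∧ a+j ≤ N then nu q o S j^2 * muf q o P S N j (N-j) / ((q*O)^N*(q*o)^N) * 
         (om1 q P O J a (N-j-a) * ff q J O P (N-j) i a * ff q J O P (N-j) k a) else 0 := by
        rw [sum_comm]
        apply sum_congr rfl; intro a ha
        rw [BO2 g _ _ _ _ _ _ a (by simp at ha; omega)]
        by_cases h : j = l ∧ a+j ≤ N
        · rw [if_pos h, if_pos h]
          obtain ⟨u, hu⟩ : ∃ u, N = a+j+u := ⟨N-a-j, by omega⟩
          have := mu_l g a j u hu.symm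
          rw [show j+u = N-a by omega, show a+u = N-j by omega] at this
          rw [show N-j-a = u by omega]
          linear_combination nu q o S j^2 / ((q*O)^N*(q*o)^N)*(ff q J O P (N-j) i a * ff q J O P (N-j) k a)*this
        · rw [if_neg h, if_neg h]
    _ = _ := by
        by_cases hjl : j = l
        swap
        · rw [if_neg (by tauto)]; apply sum_eq_zero; intro a _; rw [if_neg (by tauto)]
        subst hjl
        have hO := Oth (N-j) (g.a.mono (M := N-j) (by omega)) i k (by omega) (by omega)
        rw [← sum_subset (s₁ := range (N-j+1)) (s₂ := range (N+1))]
        · rw [sum_congr rfl (fun a ha => if_pos ⟨rfl, by simp at ha; omega⟩), ← mul_sum, eq_div_of_mul_eq hz hO]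
          by_cases hik : i = k
          · subst hik
            simp only [and_self, if_true]
            rw [div_div, mul_one_div, div_div]
          · rw [if_neg hik, if_neg (by tauto)]; simp
        · intro y; simp; omega
        · intro y _ hy; rw [if_neg]
          simp at hy; omega


theorem PPd (q c : ℂ) (n : ℕ) : poch q (q*c) n = PP q c n := by unfold PP; rfl

theorem PP_poch (q c : ℂ) (m n : ℕ) : PP q c m * poch q (c*q^(m+1)) n = PP q c (m+n) := by
  induction n with
  | zero => simp [poch_zero]
  | succ n ih =>
    rw [poch_succ, ← add_assoc, PP_succ, ← ih, fbd]; ring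

theorem qt_pow (q : ℂ) (n : ℕ) : qt q n = q^(n*(n+1)/2) := by
  induction n with
  | zero => simp [qt]
  | succ n ih =>
    rw [qt_succ, ih, ← pow_add]; congr 1
    rw [show (n+1)*(n+1+1) = n*(n+1) + 2*(n+1) by ring, Nat.add_mul_div_left _ _ (by norm_num)]

theorem om_eq (q r : ℂ) (n : ℕ) : om q r (n:ℤ) = (-r)^n * qt q n := by
  unfold om
  rw [qt_pow, show ((n:ℤ)*(n+1)/2) = ((n*(n+1)/2 : ℕ):ℤ) by push_cast; rfl]
  simp only [zpow_natCast]
  rw [← mul_pow, neg_one_mul]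

theorem bin_eq (q : ℂ) (n u : ℕ) : binom q ((n+u:ℕ):ℤ) (n:ℤ) = PP q 1 (n+u)/(PP q 1 n * PP q 1 u) := by
  unfold binom PP
  rw [if_pos (by omega), mul_one, show (((n+u:ℕ):ℤ) - n) = (u:ℤ) by push_cast; ring]
  simp only [Int.toNat_natCast]

theorem Om_eq {q s J O P t2 : ℂ} {M : ℕ} (g : Gf q J O P M) (hs : s^2 = q) (ht : t2^2 = O) (n u : ℕ) (h : n+u ≤ M) :
    Om q s J O P t2 ((n+u:ℕ):ℤ) (n:ℤ) = om1 q J O P n u * (s*t2)^(n+u) := by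
  have e1 := g.hq
  have e2 := g.h2
  have hst : s*t2 ≠ 0 := by
    intro h0; have : (s*t2)^2 = 0 := by rw [h0]; ring
    rw [mul_pow, hs, ht] at this; simp_all
  have a1 := q1 q g.hQ n (by omega)
  have a2 := q1 q g.hQ u (by omega)
  have a3 := g.P123 (n+u+1) (by omega)
  have a4 := g.P23 n (by omega)
  have a5 := g.P23 (n+n+u+1) (by omega)
  have a6 := g.P3 n (by omega)
  unfold Om
  rw [bin_eq, show (((n+u:ℕ):ℤ) - n) = (u:ℤ) by push_cast; ring]
  simp only [Int.toNat_natCast]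
  rw [show (((n+u:ℕ):ℤ)+1).toNat = n+u+1 by omega]
  have b1 := PP_poch q (J*O*P) (n+u+1) n
  have b2 := PP_poch q (O*P) n (n+u+1)
  rw [show n+u+1+n = n+n+u+1 by ring] at b1
  rw [show n+(n+u+1) = n+n+u+1 by ring] at b2
  rw [show q^(((n+u:ℕ):ℤ)+2) = q^(n+u+1+1) by rw [← zpow_natCast]; congr 1,
    show q^((n:ℤ)+1) = q^(n+1) by rw [← zpow_natCast]; congr 1,
    show q^(2*(n:ℤ)+1) = q^(n+n+1) by rw [← zpow_natCast]; congr 1; push_cast; ring,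
    show (s*t2)^(2*(n:ℤ) - ((n+u:ℕ):ℤ)) = (q*O)^n/(s*t2)^(n+u) by
      rw [zpow_sub₀ hst, zpow_natCast, zpow_mul, zpow_natCast, ← hs, ← ht, ← mul_pow]; rfl]
  rw [← fbd]
  have hz : (q*O)^n ≠ 0 := by simp [*]
  have hz' := pow_ne_zero (n+u) hst
  unfold om1 om1n om1d
  rw [PPd, PPd, PPd]
  have b3 : poch q (O*P*q^(n+1)) (n+u+1) ≠ 0 := by
    intro h0; rw [h0, mul_zero] at b2; exact a5 b2.symm
  rw [← b1, ← b2]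
  clear g b1 b2 a5
  generalize J*O*P = C, O*P = D at *
  field_simp

theorem p_eq {q s J O P t2 : ℂ} {M : ℕ} (g : Gf q J O P M) (hs : s^2 = q) (ht : t2^2 = O) (K n u x v : ℕ) (h : n+u = K)
    (hx : x+v = K) (hK : K ≤ M) :
    p q s J O P t2 (K:ℤ) (n:ℤ) (x:ℤ) = om1 q J O P n u * (s*t2)^K * ff q J O P K n x := by
  unfold p
  rw [if_pos (by omega)]
  subst h
  rw [Om_eq g hs ht n u hK]
  congr 1
  unfold ff
  simp only [Int.toNat_natCast]
  apply sum_congr rfl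
  intro k _
  unfold tt
  rw [zpow_neg, zpow_neg, zpow_neg, zpow_natCast, zpow_natCast, zpow_natCast,
    show q^(((n+u:ℕ):ℤ)+2) = q^(n+u+2) by rw [← zpow_natCast]; congr 1,
    show q^((n:ℤ)+1) = q^(n+1) by rw [← zpow_natCast]; congr 1,
    show q^((x:ℤ)+1) = q^(x+1) by rw [← zpow_natCast]; congr 1]

theorem xi_eq (q J O t1 t2 : ℂ) (n : ℕ) : xi q J O t1 t2 (n:ℤ) = PP q J n/PP q O n*(t2/t1)^n := by
  unfold xi PP; simp only [Int.toNat_natCast, zpow_natCast]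

theorem Lam_eq {q s J O P S t1 t2 t3 t4 : ℂ} (hq : q ≠ 0) (x w : ℕ) (h1 : PP q (O*J) x ≠ 0) (h2 : PP q (O*J) (x+x+w+1) ≠ 0) :
    Lam q s J O P S t1 t2 t3 t4 ((x+w:ℕ):ℤ) (x:ℤ) =
     (-1)^x * LL q O J x w * (s*t2)^(x+w) * (t1*t3/(t2*t4))^x * qt q x / q^x := by
  unfold Lam
  rw [bin_eq]
  have b2 := PP_poch q (O*J) x (x+w+1)
  rw [show x+(x+w+1) = x+x+w+1 by ring] at b2
  have b3 : poch q (O*J*q^(x+1)) (x+w+1) ≠ 0 := by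
    intro h0; rw [h0, mul_zero] at b2; exact h2 b2.symm
  have hqt : q^((x:ℤ)*(x-1)/2) = qt q x / q^x := by
    rw [qt_pow, eq_div_iff (pow_ne_zero _ hq), ← zpow_natCast, ← zpow_natCast, ← zpow_add₀ hq]
    congr 1
    push_cast
    rw [show (x:ℤ)*(x+1) = x*(x-1) + 2*x by ring, Int.add_mul_ediv_left _ _ (by norm_num)]
  rw [hqt, show (((x+w:ℕ):ℤ)+1).toNat = x+w+1 by omega, show q^((x:ℤ)+1) = q^(x+1) by rw [← zpow_natCast]; congr 1,
    show q^(2*(x:ℤ)+1) = q^(x+x+1) by rw [← zpow_natCast]; congr 1; push_cast; ring,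
    show q^(x+1)*J*O = O*J*q^(x+1) by ring, mul_comm J O, ← fbd]
  simp only [Int.toNat_natCast, zpow_natCast]
  rw [PPd, PPd]
  unfold LL
  rw [← b2]
  field_simp

theorem G_eq {q s o J O P S t0 t1 t2 t3 t4 : ℂ} {N : ℕ} (g : Gen q o J O P S N)
    (hs : s^2 = q) (ht0 : t0^2 = o) (ht2 : t2^2 = O)
    (hc0 : o = (q ^ (2 * (N : ℤ) + 3) * J * O * P * S)⁻¹)
    (h0 : t0 = (s ^ (2 * (N : ℤ) + 3) * t1 * t2 * t3 * t4)⁻¹)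
    (hw : t1*t2*t3/t4 = J*P*q^N*(q*O)*(s*t0))
    (i j x y : ℕ) (hij : i+j ≤ N) (hxy : x+y ≤ N) :
    G q s J O P S t1 t2 t3 t4 (N:ℤ) (i:ℤ) (j:ℤ) (x:ℤ) (y:ℤ) * nu q o S j =
     om1 q J O P i (N-j-i) * (s*t2)^(N-j) * (s*t0)^N * (s*t2)^(N-y) * SS q o J O P S (Tp q J P N) N i j x y := by
  unfold G
  rw [if_pos (by omega), ← hc0, ← h0]
  unfold SS
  rw [mul_sum, sum_mul]
  rw [← sum_subset (s₁ := range ((min ((N:ℤ)-j) (N-y)).toNat+1)) (s₂ := range (N+1))]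
  · apply sum_congr rfl
    intro a ha
    have ha' : a + j ≤ N ∧ a + y ≤ N := by
      simp at ha; omega
    rw [om_eq, show (N:ℤ)-j = ((N-j:ℕ):ℤ) by omega, show (N:ℤ)-y = ((N-y:ℕ):ℤ) by omega, show (N:ℤ)-a = ((N-a:ℕ):ℤ) by omega]
    rw [p_eq g.a hs ht2 (N-j) i (N-j-i) a (N-j-a) (by omega) (by omega) (by omega),
      p_eq g.b hs ht0 (N-a) j (N-j-a) y (N-y-a) (by omega) (by omega) (by omega),
      p_eq g.c hs ht2 (N-y) a (N-y-a) x (N-y-x) (by omega) (by omega) (by omega), tm_XX g, XX, if_pos ha', Tp, hw,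
      show (s*t0)^N = (s*t0)^(N-a)*(s*t0)^a by rw [← pow_add]; congr 1; omega,
      show -(J*P*q^N*(q*O)*(s*t0)) = -(J*P*q^N)*(q*O)*(s*t0) by ring, mul_pow (_ * _) (s*t0) a, mul_pow _ (q*O) a]
    ring
  · intro a; simp; omega
  · intro a _ ha
    rw [tm_no, mul_zero]
    simp at ha; omega


theorem mon1 {q s o J O P S t0 t1 t2 t3 t4 : ℂ} {N : ℕ} (hs : s^2 = q)
    (h0 : t0^2 = o) (h2 : t2^2 = O) (h3 : t3^2 = P) (h4 : t4^2 = S)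
    (rel : s^(2*N+3)*t0*t1*t2*t3*t4 = 1) (x y : ℕ) (hx : x ≤ N) (hy : y ≤ N) :
    (s*t2)^(N-y)*(s*t2)^(N-y)*(s*t3)^(N-x)*((-1)^y*(t3*t4/(t0*t1))^y)*(P*S*q^(N+1))^y
     = (s*t2)^N*(s*t2)^N*(s*t3)^N*(-(P*S*q^N/(q*O)))^y * (q^y*((t4/t2)^x*(t3/t0)^y*(t1/t0)^x*(t4/t1)^y)*(o*O*q^(N+1))^x) := by
  have es : s ≠ 0 := by rintro rfl; simp at rel
  have e0 : t0 ≠ 0 := by rintro rfl; simp at rel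
  have e1 : t1 ≠ 0 := by rintro rfl; simp at rel
  have e2 : t2 ≠ 0 := by rintro rfl; simp at rel
  have e3 : t3 ≠ 0 := by rintro rfl; simp at rel
  have e4 : t4 ≠ 0 := by rintro rfl; simp at rel
  have f2 : (s*t2)^N = (s*t2)^(N-y)*(s*t2)^y := by rw [← pow_add]; congr 1; omega
  have f3 : (s*t3)^N = (s*t3)^(N-x)*(s*t3)^x := by rw [← pow_add]; congr 1; omega
  rw [f2, f3]
  subst hs h0 h2 h3 h4
  have gx : (s*t3)^x*(t4/t2)^x*(t1/t0)^x*(t0^2*t2^2*(s^2)^(N+1))^x = 1 := by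
    simp only [← mul_pow]
    convert one_pow x
    field_simp
    rw [← rel]; ring
  have gy : ((-1)^y*(t3*t4/(t0*t1))^y)*(t3^2*t4^2*(s^2)^(N+1))^y =
     (s*t2)^y*(s*t2)^y*(-(t3^2*t4^2*(s^2)^N/(s^2*t2^2)))^y*(s^2)^y*(t3/t0)^y*(t4/t1)^y := by
    simp only [← mul_pow]
    congr 1
    field_simp
    ring
  generalize (s*t2)^(N-y) = a1, (s*t3)^(N-x) = a2 at *
  linear_combination a1*a1*a2*gy - a1*a1*a2*((s*t2)^y*(s*t2)^y*(-(t3^2*t4^2*(s^2)^N/(s^2*t2^2)))^y*(s^2)^y*(t3/t0)^y*(t4/t1)^y)*gx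

theorem alg1 {o1 o2 o3 K1 K2 b1 b2 b3 b4 b5 b6 b7 b8 b9 b10 b11 b12 b13 b14 b15 d1 d2 d3 d4 d5 d6 d7 d8 r S1 S2 S3 : ℂ}
   (a1 : d1 ≠ 0) (a2 : d2 ≠ 0) (a3 : d3 ≠ 0) (a4 : d4 ≠ 0) (m1 : b1 ≠ 0) (m2 : b2 ≠ 0) (m3 : b3 ≠ 0) (m4 : b4 ≠ 0)
   (m5 : b5 ≠ 0) (m6 : b6 ≠ 0) (m7 : b7 ≠ 0) (this : S3*r*(d7*d8) = S2 * (d5*d6)*(d1*d2)*b2 / (b1*(d3*d4)))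
   (hm : b10*b10*b11*(b14*b12)*b2 = b8*b8*b9*b13*(b3*(b4*b5*b6*b7)*b1)) :
    o1*b10*(b14*o2*b15*b12*o3/b3)/(d1/d4*b4*(d2/d3*b5)*b6*b7)*(K1*b10*S1)*(K2*b11*S3)*((d7*d8)*r)
     = K1*K2*b15*b8*b8*b9*(d5*d6)*(o1*(o2*b13*o3)*S1*S2) := by
  have hw0 : b4*b5*b6*b7 ≠ 0 := by simp [*]
  have hm' := eq_div_of_mul_eq m2 hm
  calc _ = (o1*o2*b15*o3*K1*S1*K2)*((S3*r*(d7*d8))*(b10*b10*b11*(b14*b12))*(d3*d4/(d1*d2)/(b3*(b4*b5*b6*b7)))) := by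
          simp only [div_eq_mul_inv, mul_inv, inv_inv]; ring
      _ = (o1*o2*b15*o3*K1*S1*K2)*((d5*d6)*S2*(b8*b8*b9*b13)) := by
          congr 1
          rw [this, hm']
          generalize b8*b8*b9*b13 = u
          generalize d5*d6 = v
          generalize b4*b5*b6*b7 = w at *
          field_simp
      _ = _ := by ring

theorem term_eq {q s o J O P S t0 t1 t2 t3 t4 : ℂ} {N : ℕ} (g : Gen q o J O P S N) (hs : s^2 = q)
    (h0 : t0^2 = o) (h2 : t2^2 = O) (h3 : t3^2 = P) (h4 : t4^2 = S)
    (rel : s^(2*N+3)*t0*t1*t2*t3*t4 = 1) (i j k l x y : ℕ) (hkl : k+l ≤ N) (hx : x+y ≤ N) (G1 G2 K1 K2: ℂ)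
    (hG1 : G1 * nu q o S j = K1*(s*t2)^(N-y)*SS q o J O P S (Tp q J P N) N i j x y)
    (hG2 : G2 * nu q S o l = K2*(s*t3)^(N-x)*SS q S J P O o (Tp q J O N) N k l y x) :
    Om q s J O S t2 ((N : ℤ) - (y : ℤ)) (x : ℤ)
          * Lam q s P o S J t3 t0 t4 t1 (N : ℤ) (y : ℤ)
          / (xi q O S t2 t4 (x : ℤ) * xi q o P t0 t3 (y : ℤ)
              * (t1 / t0) ^ x * (t4 / t1) ^ y)
          * G1 * G2 * (nu q o S j*nu q S o l*(PP q P k*PP q S l)*Rr q o O P S N k l 0 0)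
     = K1*K2*(s*t0)^N*(s*t2)^N*(s*t2)^N*(s*t3)^N*(PP q O k*PP q o l)*
       (om1 q J O S x (N-y-x) * sg q o O P S N y (N-y) *
       SS q o J O P S (Tp q J P N) N i j x y * SS q o J O P S (Tm q O P N) N k l x y) := by
  have es : s ≠ 0 := by rintro rfl; simp at rel
  have e0 : t0 ≠ 0 := by rintro rfl; simp at rel
  have e1 : t1 ≠ 0 := by rintro rfl; simp at rel
  have e2 : t2 ≠ 0 := by rintro rfl; simp at rel
  have e3 : t3 ≠ 0 := by rintro rfl; simp at rel
  have e4 : t4 ≠ 0 := by rintro rfl; simp at rel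
  have hm := mon1 hs h0 h2 h3 h4 rel x y (by omega) (by omega) (J := J)
  have hS := SymT N g k l x y hkl hx
  unfold SymP at hS
  have hR : Rr q o O P S N k l x y = (o*O*q^(N+1))^x / (P*S*q^(N+1))^y * Rr q o O P S N k l 0 0 := by
    unfold Rr; simp; ring
  rw [hR] at hS
  have P03 : ∀ n, n ≤ 2*N+5 → PP q (o*P) n ≠ 0 := fun n hn => by
    have := g.b.P12 n hn; rwa [mul_comm] at this
  have hO := Om_eq (g.c.symm) hs h2 x (N-y-x) (by omega)
  rw [show ((x+(N-y-x):ℕ):ℤ) = (N:ℤ)-y by omega, show x+(N-y-x) = N-y by omega] at hO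
  have hL := Lam_eq (s := s) (P := S) (S := J) (t1 := t3) (t2 := t0) (t3 := t4) (t4 := t1) g.hq y (N-y) (P03 y (by omega)) (P03 _ (by omega))
  rw [show y+(N-y) = N by omega] at hL
  rw [hO, hL, xi_eq, xi_eq, sg]
  have hq := g.hq
  have a1 := g.a.P2 x (by omega)
  have a2 := g.b.P2 y (by omega)
  have a3 := g.a.P3 y (by omega)
  have a4 := g.b.P3 x (by omega)
  have m1 : (o*O*q^(N+1))^x ≠ 0 := by simp [g.h0, g.h2, hq]
  have m2 : (P*S*q^(N+1))^y ≠ 0 := by simp [g.h3, g.h4, hq]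
  have m3 : q^y ≠ 0 := by simp [hq]
  have m4 : (t4/t2)^x ≠ 0 := by simp [*]
  have m5 : (t3/t0)^y ≠ 0 := by simp [*]
  have m6 : (t1/t0)^x ≠ 0 := by simp [*]
  have m7 : (t4/t1)^y ≠ 0 := by simp [*]
  clear hO hL hR P03 g rel h0 h2 h3 h4 hs es e0 e1 e2 e3 e4 
  generalize (o*O*q^(N+1))^x = b1, (P*S*q^(N+1))^y = b2, q^y = b3, (t4/t2)^x = b4, (t3/t0)^y = b5, (t1/t0)^x = b6, (t4/t1)^y = b7, (s*t2)^N = b8, (s*t3)^N = b9, (s*t2)^(N-y) = b10, (s*t3)^(N-x) = b11, (t3*t4/(t0*t1))^y = b12, (-(P*S*q^N/(q*O)))^y = b13, (-1:ℂ)^y = b14, (s*t0)^N = b15, PP q O x = d1, PP q o y = d2, PP q P y = d3, PP q S x = d4, PP q O k = d5, PP q o l = d6, PP q P k = d7, PP q S l = d8, Rr q o O P S N k l 0 0 = r, SS q o J O P S (Tp q J P N) N i j x y = S1, SS q o J O P S (Tm q O P N) N k l x y = S2, SS q S J P O o (Tp q J O N) N k l y x = S3, nu q o S j = n1, nu q S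 o l = n2, om1 q J O S x (N-y-x) = o1, LL q o P y (N-y) = o2, qt q y = o3 at *
  have hS' : S2 * (d5*d6)*(d1*d2)*b2 = b1*r*S3*(d3*d4*d7*d8) := by
    rw [div_mul_eq_mul_div, div_mul_eq_mul_div, div_mul_eq_mul_div, eq_div_iff m2] at hS
    linear_combination hS
  have E : o1*b10*(b14*o2*b15*b12*o3/b3)/(d1/d4*b4*(d2/d3*b5)*b6*b7)*(K1*b10*S1)*(K2*b11*S3)*((d7*d8)*r)
     = K1*K2*b15*b8*b8*b9*(d5*d6)*(o1*(o2*b13*o3)*S1*S2) := by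
    have : S3*r*(d7*d8) = S2 * (d5*d6)*(d1*d2)*b2 / (b1*(d3*d4)) := by
      rw [eq_div_iff (by simp [*])]; linear_combination -hS'
    exact alg1 a1 a2 a3 a4 m1 m2 m3 m4 m5 m6 m7 this hm
  linear_combination E + o1*b10*(b14*o2*b15*b12*o3/b3)/(d1/d4*b4*(d2/d3*b5)*b6*b7)*((d7*d8)*r)*(G2*n2*hG1 + K1*b10*S1*hG2)


theorem nu_sw {q o J O P S : ℂ} {N : ℕ} (g : Gen q o J O P S N) (j : ℕ) (hj : j ≤ N) :
    nu q o S j*(q*S)^j*PP q o j^2 = nu q S o j*(q*o)^j*PP q S j^2 := by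
  unfold nu
  rw [mul_comm S o]
  have a1 := g.P04 j (by omega)
  have a2 := g.f04 (j+j) (by omega)
  have a3 := g.b.P2 j (by omega)
  have a4 := g.b.P3 j (by omega)
  generalize PP q (o*S) j = b1, Fb q (o*S) (j+j+1) = b2, PP q o j = b3, PP q S j = b4, PP q 1 j = b5, (q*o)^j = b6, (q*S)^j = b7 at *
  field_simp

theorem nu_ne {q o J O P S : ℂ} {N : ℕ} (g : Gen q o J O P S N) (j : ℕ) (hj : j ≤ N) :
    nu q o S j ≠ 0 := by
  unfold nu
  have a1 := g.P04 j (by omega)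
  have a2 := g.f04 (j+j) (by omega)
  have a3 := g.b.P2 j (by omega)
  have a4 := g.b.P3 j (by omega)
  have a5 := q1 q g.hQ j hj
  have a6 := g.hq
  have a7 := g.h0
  have a8 : (q*o)^j ≠ 0 := by simp [*]
  simp only [ne_eq, div_eq_zero_iff, mul_eq_zero, not_or]
  simp [*]

theorem om1_sw {q J O P : ℂ} {M : ℕ} (g : Gf q J O P M) (n u : ℕ) (h : n+u ≤ M) :
    om1 q J P O n u*(q*P)^n*PP q O n^2 = om1 q J O P n u*(q*O)^n*PP q P n^2 := by
  have := g.om1d_ne n u h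
  have t3 : (q*P)^n ≠ 0 := by
    have := g.hq
    have := g.h3
    simp [*]
  unfold om1 om1n om1d at *
  rw [mul_comm P O, mul_right_comm J P O]
  simp only [ne_eq, mul_eq_zero, not_or] at this
  obtain ⟨⟨⟨⟨⟨a1, a2⟩, a3⟩, a4⟩, a5⟩, a6⟩ := this
  have a7 := g.P2 n (by omega)
  generalize (q*O)^n = b1, (q*P)^n = b2, PP q O n = b3, PP q P n = b4, PP q 1 n = b5, PP q 1 u = b6, PP q (J*O*P) (n+u+1) = b7, PP q (O*P) (n+n+u+1) = b8 at *
  field_simp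

theorem mJ {q s o O P S t0 t1 t2 t3 t4 : ℂ} {N : ℕ} (hs : s^2 = q)
    (h0 : t0^2 = o) (h2 : t2^2 = O) (h3 : t3^2 = P) (h4 : t4^2 = S)
    (rel : s^(2*N+3)*t0*t1*t2*t3*t4 = 1) (j : ℕ) :
    (-(t2*t0*t4/t3))^j * (-1)^j * (t4*t3/(t0*t1))^j * (-(1/S))^j * (q*S)^j * (s*t3)^j
     = (-(P*S*q^N))^j * q^j * (t4/t0)^j * (q*o)^j * (q*O)^j := by
  have e0 : t0 ≠ 0 := by rintro rfl; simp at rel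
  have e1 : t1 ≠ 0 := by rintro rfl; simp at rel
  have e3 : t3 ≠ 0 := by rintro rfl; simp at rel
  have e4 : t4 ≠ 0 := by rintro rfl; simp at rel
  simp only [← mul_pow]
  congr 1
  subst hs h0 h2 h3 h4
  field_simp
  rw [← pow_mul]
  linear_combination (t2*s^3)*rel

theorem mN {q s o O P S t0 t1 t2 t3 t4 : ℂ} {N : ℕ} (hs : s^2 = q)
    (h0 : t0^2 = o) (h2 : t2^2 = O) (h3 : t3^2 = P) (h4 : t4^2 = S)
    (rel : s^(2*N+3)*t0*t1*t2*t3*t4 = 1) :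
    (-(s*t1*t2*t3))^N * (q^(N+1))^N * (-(P*S/O))^N * (q*O)^N * (q*o)^N * (q*O)^N
     = (s*t4)^N * (s*t0)^N * (s*t2)^N * (s*t2)^N * (s*t3)^N * (s*t3)^N := by
  have e2 : t2 ≠ 0 := by rintro rfl; simp at rel
  simp only [← mul_pow]
  congr 1
  subst hs h0 h2 h3 h4
  field_simp
  linear_combination (t0*t3^2*t4*s^6)*rel

theorem mI {q s O P t2 t3 : ℂ} (h2 : t2^2 = O) (h3 : t3^2 = P) (e2 : t2 ≠ 0) (i : ℕ) :
    (-O)^i * (q*P)^i = (-(t2*t3))^i * (t3/t2)^i * (q*O)^i := by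
  simp only [← mul_pow]
  congr 1
  subst h2 h3
  field_simp

set_option maxHeartbeats 2000000 in
theorem alg2 {aj aN qN ai qi o1 o2 w bj LL E0 dj tj qj P2 P3 P0 P4 ei fj n1 n2 rN ri rj v E4 E2 E3 mj C2 C0 z
   g0 g4 u2 u3 Q s3 k2 : ℂ}
   (hP2 : P2 ≠ 0) (hP0 : P0 ≠ 0) (hP3 : P3 ≠ 0) (hP4 : P4 ≠ 0) (hai : ai ≠ 0) (hqi : qi ≠ 0) (hei : ei ≠ 0)
   (hfj : fj ≠ 0) (htj : tj ≠ 0) (hqj : qj ≠ 0) (hC2 : C2 ≠ 0) (hC0 : C0 ≠ 0) (hz : z ≠ 0) (hg4 : g4 ≠ 0) (hu3 : u3 ≠ 0)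
   (ho1 : o1 ≠ 0) (hs3 : s3 ≠ 0) (hk2 : k2 ≠ 0)
   (hn : n1*g4*P0^2 = n2*g0*P4^2) (ho : o2*u3*P2^2 = o1*u2*P3^2)
   (hI : ri*u3 = ai*ei*u2) (hQ : qN*qN = Q)
   (hJ : aj*bj*dj*rj*g4*s3 = mj*qj*fj*g0*k2) (hN : aN*Q*rN*C2*C0*C2 = E4*E0*E2*E2*E3*E3)
   (hv : v*s3 = E3) (hzz : z*k2 = C2) :
   ((aj*tj)*(aN*qN)/(ai*qi) * (o1*w*(bj*LL*E0*dj*tj/qj)/(P2/P3*ei*(P0/P4*fj)))) *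
     (n1*n2*(P3*P4)*((rN*qN)*(ri*qi)*(rj/tj)))
   = (o1*w*E0)*(o2*v*E4)*E0*E2*E2*E3*(P2*P0)*(n1^2*(LL*mj*tj)/(C2*C0*(o1*z))) := by
  have hm : aj*aN*Q*bj*dj*rN*rj*C2*C0*z*g4 = v*E4*E0*E2^2*E3*mj*qj*fj*g0 := by
    apply mul_right_cancel₀ (mul_ne_zero hs3 hk2)
    linear_combination (aN*Q*rN*C2*C0*z*k2)*hJ + (mj*qj*fj*g0*k2)*hN + (aN*Q*rN*C2*C0*mj*qj*fj*g0*k2)*hzz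
      - (E4*E0*E2^2*E3*mj*qj*fj*g0*k2)*hv
  have L : ((aj*tj)*(aN*qN)/(ai*qi) * (o1*w*(bj*LL*E0*dj*tj/qj)/(P2/P3*ei*(P0/P4*fj)))) *
     (n1*n2*(P3*P4)*((rN*qN)*(ri*qi)*(rj/tj))) =
     (aj*tj*aN*Q*o1*w*bj*LL*E0*dj*n1*n2*P3^2*P4^2*rN*ri*rj)/(ai*qj*P2*P0*ei*fj) := by
    subst hQ
    have k1 : qi*qi⁻¹ = 1 := mul_inv_cancel₀ hqi
    have k2 : tj*tj⁻¹ = 1 := mul_inv_cancel₀ htj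
    have : ((aj*tj)*(aN*qN)/(ai*qi) * (o1*w*(bj*LL*E0*dj*tj/qj)/(P2/P3*ei*(P0/P4*fj)))) *
     (n1*n2*(P3*P4)*((rN*qN)*(ri*qi)*(rj/tj))) =
     (aj*tj*aN*(qN*qN)*o1*w*bj*LL*E0*dj*n1*n2*P3^2*P4^2*rN*ri*rj)/(ai*qj*P2*P0*ei*fj) * (qi*qi⁻¹)*(tj*tj⁻¹) := by
      clear * -
      simp only [div_eq_mul_inv, mul_inv, inv_inv]
      ring
    rw [this, k1, k2, mul_one, mul_one]
  have R : (o1*w*E0)*(o2*v*E4)*E0*E2*E2*E3*(P2*P0)*(n1^2*(LL*mj*tj)/(C2*C0*(o1*z))) =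
    (w*E0*o2*v*E4*E0*E2^2*E3*P2*P0*n1^2*LL*mj*tj)/(C2*C0*z) := by
    have k1 : o1*o1⁻¹ = 1 := mul_inv_cancel₀ ho1
    have : (o1*w*E0)*(o2*v*E4)*E0*E2*E2*E3*(P2*P0)*(n1^2*(LL*mj*tj)/(C2*C0*(o1*z))) =
      (w*E0*o2*v*E4*E0*E2^2*E3*P2*P0*n1^2*LL*mj*tj)/(C2*C0*z) * (o1*o1⁻¹) := by
      clear * -
      ring
    rw [this, k1, mul_one]
  rw [L, R, div_eq_div_iff (by simp [*]) (by simp [*])]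
  apply mul_right_cancel₀ (mul_ne_zero (mul_ne_zero hg4 hu3) (mul_ne_zero hP2 hP0))
  linear_combination (tj*o1*w*LL*E0*n1*n2*P3^2*P4^2*ri*u3*P2*P0)*hm 
    + (tj*o1*w*LL*E0*n1*n2*P3^2*P4^2*P2*P0*v*E4*E0*E2^2*E3*mj*qj*fj*g0)*hI
    - (w*E0*v*E4*E0*E2^2*E3*P2*P0*n1^2*LL*mj*tj*ai*qj*ei*fj*P0^2*g4)*ho
    - (w*E0*v*E4*E0*E2^2*E3*P2*P0*n1*LL*mj*tj*ai*qj*ei*fj*o1*u2*P3^2)*hn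

theorem const_eq {q s o J O P S t0 t1 t2 t3 t4 : ℂ} {N : ℕ} (g : Gen q o J O P S N)
    (hs : s^2 = q) (h0 : t0^2 = o) (h2 : t2^2 = O) (h3 : t3^2 = P) (h4 : t4^2 = S)
    (rel : s^(2*N+3)*t0*t1*t2*t3*t4 = 1) (i j : ℕ) (hij : i+j ≤ N) :
   ((om q (t2 * t0 * t4 / t3) (j : ℤ) * om q (s * t1 * t2 * t3) (N : ℤ) / om q (t2 * t3) (i : ℤ))
          * (Om q s J O P t2 ((N : ℤ) - (j : ℤ)) (i : ℤ)
              * Lam q s S o P J t4 t0 t3 t1 (N : ℤ) (j : ℤ)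
              / (xi q O P t2 t3 (i : ℤ) * xi q o S t0 t4 (j : ℤ)))) *
     (nu q o S j*nu q S o j*(PP q P i*PP q S j)*Rr q o O P S N i j 0 0)
   = (om1 q J O P i (N-j-i)*(s*t2)^(N-j)*(s*t0)^N)*(om1 q J P O i (N-j-i)*(s*t3)^(N-j)*(s*t4)^N)*
      (s*t0)^N*(s*t2)^N*(s*t2)^N*(s*t3)^N*(PP q O i*PP q o j)*
      (nu q o S j^2 * muf q o P S N j (N-j)/ ((q*O)^N*(q*o)^N*(om1 q J O P i (N-j-i)*(q*O)^(N-j)))) := by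
  have es : s ≠ 0 := by rintro rfl; simp at rel
  have e0 : t0 ≠ 0 := by rintro rfl; simp at rel
  have e1 : t1 ≠ 0 := by rintro rfl; simp at rel
  have e2 : t2 ≠ 0 := by rintro rfl; simp at rel
  have e3 : t3 ≠ 0 := by rintro rfl; simp at rel
  have e4 : t4 ≠ 0 := by rintro rfl; simp at rel
  have hq := g.hq
  have d0 := g.h0
  have d2 := g.h2
  have d3 := g.h3
  have d4 := g.h4
  have hO := Om_eq (g.a) hs h2 i (N-j-i) (by omega)
  rw [show ((i+(N-j-i):ℕ):ℤ) = (N:ℤ)-j by omega, show i+(N-j-i) = N-j by omega] at hO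
  have hL := Lam_eq (s := s) (P := P) (S := J) (t1 := t4) (t2 := t0) (t3 := t3) (t4 := t1) g.hq j (N-j) (g.P04 j (by omega)) (g.P04 _ (by omega))
  rw [show j+(N-j) = N by omega] at hL
  rw [hO, hL, xi_eq, xi_eq, om_eq, om_eq, om_eq]
  have hR : Rr q o O P S N i j 0 0 = ((-(P*S/O))^N*qt q N)*((-O)^i*qt q i)*((-(1/S))^j/qt q j) := by
    unfold Rr; simp
  rw [hR, muf]
  have hQ : qt q N * qt q N = (q^(N+1))^N := by
    have := qt_add q 0 N
    simp only [zero_add] at this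
    rw [← this]; simp [qt]
  have hz : (q*O)^(N-j)*(q*O)^j = (q*O)^N := by rw [← pow_add]; congr 1; omega
  have hv : (s*t3)^(N-j)*(s*t3)^j = (s*t3)^N := by rw [← pow_add]; congr 1; omega
  exact alg2 (g.a.P2 i (by omega)) (g.b.P2 j (by omega)) (g.a.P3 i (by omega)) (g.b.P3 j (by omega))
    (by simp [*]) (qt_ne q hq i) (by simp [*]) (by simp [*]) (qt_ne q hq j) (by simp [*]) (by simp [*])
    (by simp [*]) (by simp [*]) (by simp [*]) (by simp [*]) (g.a.om1_ne i (N-j-i) (by omega)) (by simp [*]) (by simp [*])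
    (nu_sw g j (by omega)) (om1_sw g.a i (N-j-i) (by omega)) (mI (s := s) h2 h3 e2 i) hQ (mJ hs h0 h2 h3 h4 rel j)
    (mN hs h0 h2 h3 h4 rel) hv hz

theorem final_thm
    (N : ℕ) (q s J O P S o t1 t2 t3 t4 t0 : ℂ)
    (hq : q ≠ 0) (hc1 : J ≠ 0) (hc2 : O ≠ 0) (hc3 : P ≠ 0) (hc4 : S ≠ 0)
    (hs : s ^ 2 = q) (ht1 : t1 ^ 2 = J) (ht2 : t2 ^ 2 = O) (ht3 : t3 ^ 2 = P)
    (ht4 : t4 ^ 2 = S)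
    (hc0 : o = (q ^ (2 * (N : ℤ) + 3) * J * O * P * S)⁻¹)
    (ht0 : t0 = (s ^ (2 * (N : ℤ) + 3) * t1 * t2 * t3 * t4)⁻¹)
    (hgen : ∀ e0 e1 e2 e3 e4 : ℕ, e0 ≤ 1 → e1 ≤ 1 → e2 ≤ 1 → e3 ≤ 1 → e4 ≤ 1 →
      1 ≤ e0 + e1 + e2 + e3 + e4 → e0 + e1 + e2 + e3 + e4 ≤ 4 →
      ∀ k : ℤ, 1 ≤ k → k ≤ 2 * (N : ℤ) + 5 →
        o ^ e0 * J ^ e1 * O ^ e2 * P ^ e3 * S ^ e4 ≠ q ^ (-k))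
    (hq1 : ∀ k : ℕ, 1 ≤ k → k ≤ N → q ^ k ≠ 1)
    (i j k l : ℕ) (hij : i + j ≤ N) (hkl : k + l ≤ N) :
    ∑ x ∈ Finset.range (N + 1), ∑ y ∈ Finset.range (N + 1 - x),
        qR.Om q s J O S t2 ((N : ℤ) - (y : ℤ)) (x : ℤ)
          * qR.Lam q s P o S J t3 t0 t4 t1 (N : ℤ) (y : ℤ)
          / (qR.xi q O S t2 t4 (x : ℤ) * qR.xi q o P t0 t3 (y : ℤ)
              * (t1 / t0) ^ x * (t4 / t1) ^ y)
          * qR.G q s J O P S t1 t2 t3 t4 (N : ℤ) (i : ℤ) (j : ℤ) (x : ℤ) (y : ℤ)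
          * qR.G q s J P O o t1 t3 t2 t0 (N : ℤ) (k : ℤ) (l : ℤ) (y : ℤ) (x : ℤ)
      = (if i = k ∧ j = l then 1 else 0)
          * (qR.om q (t2 * t0 * t4 / t3) (j : ℤ) * qR.om q (s * t1 * t2 * t3) (N : ℤ)
              / qR.om q (t2 * t3) (i : ℤ))
          * (qR.Om q s J O P t2 ((N : ℤ) - (j : ℤ)) (i : ℤ)
              * qR.Lam q s S o P J t4 t0 t3 t1 (N : ℤ) (j : ℤ)
              / (qR.xi q O P t2 t3 (i : ℤ) * qR.xi q o S t0 t4 (j : ℤ))) := by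
  have es : s ≠ 0 := by rintro rfl; simp at hs; exact hq hs.symm
  have e1 : t1 ≠ 0 := by rintro rfl; simp at ht1; exact hc1 ht1.symm
  have e2 : t2 ≠ 0 := by rintro rfl; simp at ht2; exact hc2 ht2.symm
  have e3 : t3 ≠ 0 := by rintro rfl; simp at ht3; exact hc3 ht3.symm
  have e4 : t4 ≠ 0 := by rintro rfl; simp at ht4; exact hc4 ht4.symm
  have zq : q ^ (2 * (N : ℤ) + 3) = q^(2*N+3) := by rw [← zpow_natCast]; congr 1
  have zs : s ^ (2 * (N : ℤ) + 3) = s^(2*N+3) := by rw [← zpow_natCast]; congr 1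
  have es' : s^(2*N+3) ≠ 0 := by simp [es]
  have eq' : q^(2*N+3) ≠ 0 := by simp [hq]
  have rel : s^(2*N+3)*t0*t1*t2*t3*t4 = 1 := by
    rw [ht0, zs]; field_simp
  have e0 : t0 ≠ 0 := by rintro h; simp [h] at rel
  have rel' : o*J*O*P*S*q^(2*N+3) = 1 := by
    rw [hc0, zq]; field_simp
  have h00 : t0^2 = o := by
    rw [hc0, ht0, zq, zs, ← hs, ← ht1, ← ht2, ← ht3, ← ht4, ← pow_mul, mul_comm 2, pow_mul]
    rw [inv_pow]; congr 1; ring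
  have d0 : o ≠ 0 := by rw [← h00]; simp [e0]
  have g : Gen q o J O P S N := by
    refine ⟨hq, rel', fun k h h' => sub_ne_zero.mpr (hq1 k h h').symm, ?_⟩
    intro f0 f1 f2 f3 f4 a0 a1 a2 a3 a4 b b' k hk hk' h
    refine hgen f0 f1 f2 f3 f4 a0 a1 a2 a3 a4 b b' k (by omega) (by omega) ?_
    rw [zpow_neg, zpow_natCast]
    exact eq_inv_of_mul_eq_one_left (sub_eq_zero.mp h).symm
  have hc4' : S = (q ^ (2 * (N : ℤ) + 3) * J * P * O * o)⁻¹ := by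
    rw [zq]; apply eq_inv_of_mul_eq_one_left; linear_combination rel'
  have ht4' : t4 = (s ^ (2 * (N : ℤ) + 3) * t1 * t3 * t2 * t0)⁻¹ := by
    rw [zs]; apply eq_inv_of_mul_eq_one_left; linear_combination rel
  have hw : t1*t2*t3/t4 = J*P*q^N*(q*O)*(s*t0) := by
    rw [div_eq_iff e4, ← hs, ← ht1, ← ht2, ← ht3, ← pow_mul]
    linear_combination (-t1*t2*t3)*rel
  have hw' : t1*t3*t2/t0 = J*O*q^N*(q*P)*(s*t4) := by
    rw [div_eq_iff e0, ← hs, ← ht1, ← ht2, ← ht3, ← pow_mul]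
    linear_combination (-t1*t2*t3)*rel
  set D := nu q o S j*nu q S o l*(PP q P k*PP q S l)*Rr q o O P S N k l 0 0 with hD
  have hD0 : D ≠ 0 := by
    rw [hD]
    have a1 := nu_ne g j (by omega)
    have a2 := nu_ne g.sw l (by omega)
    have a3 := g.a.P3 k (by omega)
    have a4 := g.b.P3 l (by omega)
    have a5 := fun n => qt_ne q hq n
    have a6 : Rr q o O P S N k l 0 0 ≠ 0 := by
      unfold Rr
      have b1 : (-(P*S/O))^N ≠ 0 := by simp [hc2, hc3, hc4]
      have b2 : (-O)^k ≠ 0 := by simp [hc2]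
      have b3 : (-(1/S))^l ≠ 0 := by simp [hc4]
      simp only [pow_zero, div_one, one_mul]
      exact mul_ne_zero (mul_ne_zero (mul_ne_zero b1 (a5 N)) (mul_ne_zero b2 (a5 k))) (div_ne_zero b3 (a5 l))
    exact mul_ne_zero (mul_ne_zero (mul_ne_zero a1 a2) (mul_ne_zero a3 a4)) a6
  apply mul_right_cancel₀ hD0
  have key := BO g i j k l hij hkl
  have step : (∑ x ∈ Finset.range (N + 1), ∑ y ∈ Finset.range (N + 1 - x),
        qR.Om q s J O S t2 ((N : ℤ) - (y : ℤ)) (x : ℤ)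
          * qR.Lam q s P o S J t3 t0 t4 t1 (N : ℤ) (y : ℤ)
          / (qR.xi q O S t2 t4 (x : ℤ) * qR.xi q o P t0 t3 (y : ℤ)
              * (t1 / t0) ^ x * (t4 / t1) ^ y)
          * qR.G q s J O P S t1 t2 t3 t4 (N : ℤ) (i : ℤ) (j : ℤ) (x : ℤ) (y : ℤ)
          * qR.G q s J P O o t1 t3 t2 t0 (N : ℤ) (k : ℤ) (l : ℤ) (y : ℤ) (x : ℤ)) * D
     = ((om1 q J O P i (N-j-i)*(s*t2)^(N-j)*(s*t0)^N)*(om1 q J P O k (N-l-k)*(s*t3)^(N-l)*(s*t4)^N)*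
      (s*t0)^N*(s*t2)^N*(s*t2)^N*(s*t3)^N*(PP q O k*PP q o l)) * 
      (if i = k ∧ j = l then nu q o S j^2 * muf q o P S N j (N-j)/ ((q*O)^N*(q*o)^N*(om1 q J O P i (N-j-i)*(q*O)^(N-j))) else 0) := by
    rw [← key, sum_mul, mul_sum]
    apply sum_congr rfl
    intro x hx
    rw [sum_mul, mul_sum]
    apply sum_congr rfl
    intro y hy
    simp only [mem_range] at hx hy
    exact term_eq g hs h00 ht2 ht3 ht4 rel i j k l x y hkl (by omega) _ _ _ _
      (G_eq g hs h00 ht2 hc0 ht0 hw i j x y hij (by omega))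
      (G_eq g.sw hs ht4 ht3 hc4' ht4' hw' k l y x hkl (by omega))
  rw [step]
  by_cases h : i = k ∧ j = l
  · obtain ⟨rfl, rfl⟩ := h
    simp only [and_self, if_true, one_mul]
    exact (const_eq g hs h00 ht2 ht3 ht4 rel i j hij).symm
  · simp [h]

end

/-- Biorthogonality of the Griffiths polynomials of q-Racah type. -/
theorem griffiths_biorthogonality
    (N : ℕ) (q s c1 c2 c3 c4 c0 t1 t2 t3 t4 t0 : ℂ)
    (hq : q ≠ 0) (hc1 : c1 ≠ 0) (hc2 : c2 ≠ 0) (hc3 : c3 ≠ 0) (hc4 : c4 ≠ 0)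
    (hs : s ^ 2 = q) (ht1 : t1 ^ 2 = c1) (ht2 : t2 ^ 2 = c2) (ht3 : t3 ^ 2 = c3)
    (ht4 : t4 ^ 2 = c4)
    (hc0 : c0 = (q ^ (2 * (N : ℤ) + 3) * c1 * c2 * c3 * c4)⁻¹)
    (ht0 : t0 = (s ^ (2 * (N : ℤ) + 3) * t1 * t2 * t3 * t4)⁻¹)
    (hgen : ∀ e0 e1 e2 e3 e4 : ℕ, e0 ≤ 1 → e1 ≤ 1 → e2 ≤ 1 → e3 ≤ 1 → e4 ≤ 1 →
      1 ≤ e0 + e1 + e2 + e3 + e4 → e0 + e1 + e2 + e3 + e4 ≤ 4 →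
      ∀ k : ℤ, 1 ≤ k → k ≤ 2 * (N : ℤ) + 5 →
        c0 ^ e0 * c1 ^ e1 * c2 ^ e2 * c3 ^ e3 * c4 ^ e4 ≠ q ^ (-k))
    (hq1 : ∀ k : ℕ, 1 ≤ k → k ≤ N → q ^ k ≠ 1)
    (i j k l : ℕ) (hij : i + j ≤ N) (hkl : k + l ≤ N) :
    ∑ x ∈ Finset.range (N + 1), ∑ y ∈ Finset.range (N + 1 - x),
        qR.Om q s c1 c2 c4 t2 ((N : ℤ) - (y : ℤ)) (x : ℤ)
          * qR.Lam q s c3 c0 c4 c1 t3 t0 t4 t1 (N : ℤ) (y : ℤ)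
          / (qR.xi q c2 c4 t2 t4 (x : ℤ) * qR.xi q c0 c3 t0 t3 (y : ℤ)
              * (t1 / t0) ^ x * (t4 / t1) ^ y)
          * qR.G q s c1 c2 c3 c4 t1 t2 t3 t4 (N : ℤ) (i : ℤ) (j : ℤ) (x : ℤ) (y : ℤ)
          * qR.G q s c1 c3 c2 c0 t1 t3 t2 t0 (N : ℤ) (k : ℤ) (l : ℤ) (y : ℤ) (x : ℤ)
      = (if i = k ∧ j = l then 1 else 0)
          * (qR.om q (t2 * t0 * t4 / t3) (j : ℤ) * qR.om q (s * t1 * t2 * t3) (N : ℤ)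
              / qR.om q (t2 * t3) (i : ℤ))
          * (qR.Om q s c1 c2 c3 t2 ((N : ℤ) - (j : ℤ)) (i : ℤ)
              * qR.Lam q s c4 c0 c3 c1 t4 t0 t3 t1 (N : ℤ) (j : ℤ)
              / (qR.xi q c2 c3 t2 t3 (i : ℤ) * qR.xi q c0 c4 t0 t4 (j : ℤ))) := by
  exact final_thm N q s c1 c2 c3 c4 c0 t1 t2 t3 t4 t0 hq hc1 hc2 hc3 hc4 hs ht1 ht2 ht3 ht4 hc0 ht0
    hgen hq1 i j k l hij hkl
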